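/- Fix d ≥ 2. There exists a constant C₇ > 0 such that, uniformly in real 1 ≤ a ≤ 2, the events { A_{⌊(a−1) b_n⌋}(B[n]) ⊆ B[n a^{1/d}(1 + C₇ n^{−1/(5d)})] } occur with superpolynomially large probability in n: for every k > 0 there is a constant C_k with P(failure) ≤ C_k n^{−k} for all n and all 1 ≤ a ≤ 2. -/

import Mathlib

open MeasureTheory Filter
open scoped ENNReal

noncomputable section

/-- The `k`-th binary digit of `x ∈ [0,1)` (after the binary point). -/
def bit (x : ℝ) (k : ℕ) : Bool := ⌊x * 2 ^ (k + 1)⌋ % 2 == 1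

/-- From one uniform sample on `[0,1]`, extract countably many independent uniform
samples on `[0,1]`, using disjoint subsequences of binary digits. -/
def uSlice (x : ℝ) (i : ℕ) : ℝ :=
  ∑' j : ℕ, if bit x (Nat.pair i j) then ((2 : ℝ) ^ (-(j : ℤ) - 1)) else 0

/-- The base probability space: Lebesgue measure restricted to `[0,1]`. -/
def μ0 : Measure ℝ := volume.restrict (Set.Icc 0 1)

/-- The vertex set of the lattice `ℤ^d`. -/
abbrev V (d : ℕ) := Fin d → ℤ

instance (d : ℕ) : MeasurableSpace (Finset (V d)) := ⊤

open Classical in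
/-- `B[r]`: the Euclidean ball of radius `r` in `ℤ^d`, as a `Finset`. -/
def ball (d : ℕ) (r : ℝ) : Finset (V d) :=
  (Finset.Icc (fun _ => -⌈r⌉) (fun _ => ⌈r⌉)).filter
    (fun y => Real.sqrt (∑ i, ((y i : ℝ)) ^ 2) ≤ r)

/-- `b_n`: the number of lattice points in the Euclidean ball of radius `n`. -/
def bn (d n : ℕ) : ℕ := (ball d n).card

/-- The `2d` unit vectors of `ℤ^d` (the possible steps of the simple random walk). -/
def unitVecs (d : ℕ) : Finset (V d) :=
  Finset.image
    (fun p : Fin d × Bool => fun j => if j = p.1 then (if p.2 then 1 else -1) else 0)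
    Finset.univ

/-- Given `u` uniform on `[0,1]`, `pick S u` is a uniformly chosen element of `S`. -/
def pick {d : ℕ} (S : Finset (V d)) (u : ℝ) : V d :=
  if h : S.Nonempty then
    (S.equivFin.symm ⟨(⌊u * S.card⌋).toNat % S.card,
      Nat.mod_lt _ (Finset.card_pos.mpr h)⟩).val
  else 0

/-- Position at time `t` of the simple random walk started at `x`, driven by the
random seed `ω`: the steps `pick (unitVecs d) (uSlice ω i)` are i.i.d. uniform on
the `2d` unit vectors when `ω` is uniform on `[0,1]`. -/
def walk {d : ℕ} (x : V d) (ω : ℝ) (t : ℕ) : V d :=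
  x + ∑ i ∈ Finset.range t, pick (unitVecs d) (uSlice ω i)

/-- `t_S`: the first time the walk started at `x` is outside `S`. -/
def exitT {d : ℕ} (S : Finset (V d)) (x : V d) (ω : ℝ) : ℕ :=
  sInf {t | walk x ω t ∉ S}

/-- The position `ξ(t_S)` at which the walk started at `x` first exits `S`. -/
def hitPt {d : ℕ} (S : Finset (V d)) (x : V d) (ω : ℝ) : V d :=
  walk x ω (exitT S x ω)

/-- `Add[ξ,S]`: add to `S` the exit point of a random walk started at `x`. -/
def addPt {d : ℕ} (S : Finset (V d)) (x : V d) (ω : ℝ) : Finset (V d) :=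
  insert (hitPt S x ω) S

/-- `P_x(ξ(τ_A) = y)`: the probability that the walk started at `x` exits `A` at `y`. -/
def hitProb {d : ℕ} (A : Finset (V d)) (x y : V d) : ℝ≥0∞ :=
  μ0 {ω | hitPt A x ω = y}

/-- The outer boundary `∂A`: vertices outside `A` with a neighbour in `A`. -/
def outb {d : ℕ} (A : Finset (V d)) : Finset (V d) :=
  (A.biUnion fun x => (unitVecs d).image (fun e => x + e)) \ A

/-- `DA_X(S)`: the IDLA aggregate obtained from `S` by launching one particle from each
point of the list `xs` in turn (driven by independent slices of the seed `ω`). -/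
def daFrom {d : ℕ} : Finset (V d) → List (V d) → ℝ → Finset (V d)
  | S, [], _ => S
  | S, x :: xs, ω => daFrom (addPt S x (uSlice ω 0)) xs (uSlice ω 1)

/-- The law of the IDLA aggregate `DA_X(S)`. -/
def daLaw {d : ℕ} (S : Finset (V d)) (xs : List (V d)) : Measure (Finset (V d)) :=
  μ0.map (fun ω => daFrom S xs ω)

/-- One uIDLA step: launch a particle from a uniformly chosen point of `S`. -/
def uStep {d : ℕ} (S : Finset (V d)) (ω : ℝ) : Finset (V d) :=
  addPt S (pick S (uSlice ω 0)) (uSlice ω 1)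

/-- `A_k(S)`: the uIDLA aggregate obtained by adding `k` particles to `S`,
each started at a uniform point of the current aggregate. -/
def uAggFrom {d : ℕ} (S : Finset (V d)) (ω : ℝ) : ℕ → Finset (V d)
  | 0 => S
  | k + 1 => uStep (uAggFrom S ω k) (uSlice ω k)

/-- The law of the uIDLA aggregate `A_k(S)`. -/
def uLaw {d : ℕ} (S : Finset (V d)) (k : ℕ) : Measure (Finset (V d)) :=
  μ0.map (fun ω => uAggFrom S ω k)

/-- One step of the subset uIDLA `A_·(E;m)`: at step `k`, perform a uIDLA step
with probability `|E|/(m+k)` and otherwise do nothing. -/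
def subStep {d : ℕ} (m k : ℕ) (E : Finset (V d)) (ω : ℝ) : Finset (V d) :=
  if uSlice ω 0 * ((m : ℝ) + k) ≤ E.card then uStep E (uSlice ω 1) else E

/-- The subset uIDLA `A_n(E;m)`. -/
def subAggFrom {d : ℕ} (E : Finset (V d)) (m : ℕ) (ω : ℝ) : ℕ → Finset (V d)
  | 0 => E
  | k + 1 => subStep m k (subAggFrom E m ω k) (uSlice ω k)

/-- The law of the subset uIDLA `A_n(E;m)`. -/
def subLaw {d : ℕ} (E : Finset (V d)) (m k : ℕ) : Measure (Finset (V d)) :=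
  μ0.map (fun ω => subAggFrom E m ω k)

/-- Stochastic domination of random finite subsets of `ℤ^d`: `μ` dominates `ν` if
there is a coupling under which the sample of `ν` is a.s. contained in that of `μ`. -/
def StochDom {d : ℕ} (μ ν : Measure (Finset (V d))) : Prop :=
  ∃ π : Measure (Finset (V d) × Finset (V d)), IsProbabilityMeasure π ∧
    π.map Prod.fst = μ ∧ π.map Prod.snd = ν ∧ π {p | p.2 ⊆ p.1} = 1

/-- A `Geometric(1/2)` sample (taking value `j ≥ 0` with probability `2^{-(j+1)}`)
produced from a uniform sample `u` on `[0,1]` by inverting the CDF. -/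
def geom (u : ℝ) : ℕ := sInf {j : ℕ | u ≤ 1 - (2 : ℝ) ^ (-(j : ℤ) - 1)}

/-- The parent of vertex `j ≥ 1` in the uniform random recursive tree (vertex `0` is
the root): uniform on `{0, …, j-1}` when the seed is uniform on `[0,1]`. -/
def parent (ω : ℝ) (j : ℕ) : ℕ := (⌊uSlice ω (Nat.pair 0 j) * j⌋).toNat % j

/-- The reaching time of vertex `j` in a uniform random recursive tree whose edges
carry i.i.d. `Geometric(1/2)` weights: the sum of the weights on the path from the
root to `j`. (The `min` is a.s. inoperative, since a.s. `parent ω (j+1) ≤ j`.) -/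
def reach (ω : ℝ) : ℕ → ℕ
  | 0 => 0
  | j + 1 => reach ω (min (parent ω (j + 1)) j) + geom (uSlice ω (Nat.pair 1 (j + 1)))
termination_by j => j
decreasing_by exact Nat.lt_succ_of_le (min_le_right _ _)

end


namespace U11

instance instProb : IsProbabilityMeasure μ0 := ⟨by simp [μ0]⟩

theorem mu0_Ico : μ0 = volume.restrict (Set.Ico 0 1) := by
  rw [μ0]; exact (Measure.restrict_congr_set Ico_ae_eq_Icc).symm

noncomputable def coin : Measure Bool := (1/2 : ℝ≥0∞) • Measure.dirac true + (1/2 : ℝ≥0∞) • Measure.dirac false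

instance instCoin : IsProbabilityMeasure coin := ⟨by
  simp [coin, ENNReal.inv_two_add_inv_two]⟩

theorem measurable_bit (k : ℕ) : Measurable (fun x => bit x k) := by
  unfold bit
  have h1 : Measurable (fun x : ℝ => ⌊x * 2 ^ (k + 1)⌋) := Int.measurable_floor.comp (measurable_id.mul_const _)
  exact (measurable_from_top (f := fun z : ℤ => (z % 2 == 1))).comp h1

theorem bit_succ (x : ℝ) (k : ℕ) : bit x (k+1) = bit (Int.fract (2 * x)) k := by
  unfold bit
  have : Int.fract (2 * x) * 2 ^ (k+1) = x * 2 ^ (k+1+1) - ((⌊2 * x⌋ * 2 ^ (k+1) : ℤ) : ℝ) := by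
    rw [Int.fract]; push_cast; ring
  rw [this, Int.floor_sub_intCast]
  have e : ⌊2 * x⌋ * 2 ^ (k+1) = (⌊2 * x⌋ * 2 ^ k) * 2 := by ring
  have e2 : (⌊x * 2 ^ (k+1+1)⌋ - ⌊2 * x⌋ * 2 ^ (k+1)) % 2 = ⌊x * 2 ^ (k+1+1)⌋ % 2 := by
    rw [e]; omega
  rw [e2]

theorem bit_false {x : ℝ} (h0 : 0 ≤ x) (h1 : x < 1/2) : bit x 0 = false := by
  have : ⌊x * 2 ^ (0+1)⌋ = 0 := by rw [Int.floor_eq_iff]; constructor <;> norm_num <;> linarith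
  simp only [bit, this]; rfl

theorem bit_true {x : ℝ} (h0 : 1/2 ≤ x) (h1 : x < 1) : bit x 0 = true := by
  have : ⌊x * 2 ^ (0+1)⌋ = 1 := by rw [Int.floor_eq_iff]; constructor <;> norm_num <;> linarith
  simp only [bit, this]; rfl

theorem bit_head_false (E : Set ℝ) (hE : MeasurableSet E) :
    μ0 {x | bit x 0 = false ∧ Int.fract (2 * x) ∈ E} = 1/2 * μ0 E := by
  have hm : MeasurableSet {x | bit x 0 = false ∧ Int.fract (2 * x) ∈ E} := by
    refine MeasurableSet.inter ?_ ?_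
    · exact measurable_bit 0 (MeasurableSet.singleton false)
    · exact (measurable_fract.comp (measurable_const_mul 2)) hE
  rw [mu0_Ico, Measure.restrict_apply hm, Measure.restrict_apply hE]
  have : {x | bit x 0 = false ∧ Int.fract (2 * x) ∈ E} ∩ Set.Ico 0 1 = (fun x => 2 * x) ⁻¹' (E ∩ Set.Ico 0 1) := by
    ext x
    simp only [Set.mem_inter_iff, Set.mem_ofPred_eq, Set.mem_Ico, Set.mem_preimage]
    constructor
    · rintro ⟨⟨hb, hf⟩, h0, h1⟩
      have h2 : x < 1/2 := by
        by_contra h; rw [bit_true (by linarith) h1] at hb; simp at hb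
      rw [Int.fract_eq_self.2 ⟨by linarith, by linarith⟩] at hf
      exact ⟨hf, by linarith, by linarith⟩
    · rintro ⟨hf, h0, h1⟩
      refine ⟨⟨bit_false (by linarith) (by linarith), ?_⟩, by linarith, by linarith⟩
      rwa [Int.fract_eq_self.2 ⟨by linarith, by linarith⟩]
  rw [this, Real.volume_preimage_mul_left (by norm_num)]
  congr 1
  rw [abs_of_pos (by norm_num), ENNReal.ofReal_inv_of_pos (by norm_num)]; simp

theorem bit_head_true (E : Set ℝ) (hE : MeasurableSet E) :
    μ0 {x | bit x 0 = true ∧ Int.fract (2 * x) ∈ E} = 1/2 * μ0 E := by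
  have hm : MeasurableSet {x | bit x 0 = true ∧ Int.fract (2 * x) ∈ E} := by
    refine MeasurableSet.inter ?_ ?_
    · exact measurable_bit 0 (MeasurableSet.singleton true)
    · exact (measurable_fract.comp (measurable_const_mul 2)) hE
  rw [mu0_Ico, Measure.restrict_apply hm, Measure.restrict_apply hE]
  have : {x | bit x 0 = true ∧ Int.fract (2 * x) ∈ E} ∩ Set.Ico 0 1 = (fun x => 2 * x) ⁻¹' ((fun x => x + (-1)) ⁻¹' (E ∩ Set.Ico 0 1)) := by
    ext x
    simp only [Set.mem_inter_iff, Set.mem_ofPred_eq, Set.mem_Ico, Set.mem_preimage]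
    have key : 1/2 ≤ x → x < 1 → Int.fract (2 * x) = 2 * x + (-1) := by
      intro h h1
      rw [Int.fract_eq_iff]; refine ⟨by linarith, by linarith, 1, by push_cast; ring⟩
    constructor
    · rintro ⟨⟨hb, hf⟩, h0, h1⟩
      have h2 : 1/2 ≤ x := by
        by_contra h; rw [bit_false h0 (by linarith)] at hb; simp at hb
      rw [key h2 h1] at hf
      exact ⟨hf, by linarith, by linarith⟩
    · rintro ⟨hf, h0, h1⟩
      refine ⟨⟨bit_true (by linarith) (by linarith), ?_⟩, by linarith, by linarith⟩
      rwa [key (by linarith) (by linarith)]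
  rw [this, Real.volume_preimage_mul_left (by norm_num), measure_preimage_add_right]
  congr 1
  rw [abs_of_pos (by norm_num), ENNReal.ofReal_inv_of_pos (by norm_num)]; simp

theorem bit_head (t : Set Bool) (E : Set ℝ) (hE : MeasurableSet E) :
    μ0 {x | bit x 0 ∈ t ∧ Int.fract (2 * x) ∈ E} = coin t * μ0 E := by
  classical
  have hms : ∀ b, MeasurableSet {x | bit x 0 = b ∧ Int.fract (2 * x) ∈ E} := fun b => by
    refine MeasurableSet.inter ?_ ?_
    · exact measurable_bit 0 (MeasurableSet.singleton b)
    · exact (measurable_fract.comp (measurable_const_mul 2)) hE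
  have hd : {x | bit x 0 ∈ t ∧ Int.fract (2 * x) ∈ E} =
     (if true ∈ t then {x | bit x 0 = true ∧ Int.fract (2 * x) ∈ E} else ∅) ∪
     (if false ∈ t then {x | bit x 0 = false ∧ Int.fract (2 * x) ∈ E} else ∅) := by
    ext x
    cases h : bit x 0 <;> by_cases h1 : true ∈ t <;> by_cases h2 : false ∈ t <;> simp [h, h1, h2]
  rw [hd, measure_union]
  · by_cases h1 : true ∈ t <;> by_cases h2 : false ∈ t <;>
      simp [h1, h2, bit_head_true E hE, bit_head_false E hE, coin, -one_div]
    rw [← add_mul]; simp [ENNReal.inv_two_add_inv_two]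
  · rw [Set.disjoint_left]
    intro x
    by_cases h1 : true ∈ t <;> by_cases h2 : false ∈ t <;> simp [h1, h2]
    intro h; simp [h]
  · split_ifs
    · exact hms _
    · exact MeasurableSet.empty

theorem bits_box (N : ℕ) : ∀ t : ℕ → Set Bool, μ0 {x | ∀ k < N, bit x k ∈ t k} = ∏ k ∈ Finset.range N, coin (t k) := by
  induction N with
  | zero => intro t; simp
  | succ N ih =>
    intro t
    have : {x | ∀ k < N+1, bit x k ∈ t k} = {x | bit x 0 ∈ t 0 ∧ Int.fract (2 * x) ∈ {x | ∀ k < N, bit x k ∈ t (k+1)}} := by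
      ext x
      simp only [Set.mem_ofPred_eq]
      constructor
      · intro h
        refine ⟨h 0 (by omega), fun k hk => ?_⟩
        rw [← bit_succ]; exact h _ (by omega)
      · rintro ⟨h0, h⟩ k hk
        cases k with
        | zero => exact h0
        | succ k => rw [bit_succ]; exact h k (by omega)
    rw [this, bit_head, ih (fun k => t (k+1)), Finset.prod_range_succ', mul_comm]
    have : {x | ∀ k < N, bit x k ∈ t (k+1)} = ⋂ k, ⋂ (_ : k < N), (fun x => bit x k) ⁻¹' (t (k+1)) := by
      ext; simp
    rw [this]
    exact MeasurableSet.iInter fun k => MeasurableSet.iInter fun _ => measurable_bit k (Set.toFinite _).measurableSet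

theorem measurable_bits : Measurable (fun x k => bit x k) := measurable_pi_lambda _ measurable_bit

theorem bits_law : μ0.map (fun x k => bit x k) = Measure.infinitePi (fun _ : ℕ => coin) := by
  classical
  apply Measure.eq_infinitePi
  intro s t ht
  rw [Measure.map_apply measurable_bits (MeasurableSet.pi s.countable_toSet fun i _ => ht i)]
  obtain ⟨N, hN⟩ : ∃ N, s ⊆ Finset.range N := ⟨s.sup id + 1, fun i hi => by
    rw [Finset.mem_range]; exact Nat.lt_succ_of_le (Finset.le_sup (f := id) hi)⟩
  have := bits_box N (fun k => if k ∈ s then t k else Set.univ)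
  have e : (fun x k => bit x k) ⁻¹' (Set.pi s t) = {x | ∀ k < N, bit x k ∈ (if k ∈ s then t k else Set.univ)} := by
    ext x
    simp only [Set.mem_preimage, Set.mem_pi, Finset.mem_coe, Set.mem_ofPred_eq]
    constructor
    · intro h k _; split_ifs with hk
      · exact h k hk
      · trivial
    · intro h k hk
      have := h k (Finset.mem_range.1 (hN hk)); rwa [if_pos hk] at this
  rw [e, this, ← Finset.prod_subset hN]
  · exact Finset.prod_congr rfl fun i hi => by rw [if_pos hi]
  · intro i _ hi; rw [if_neg hi]; exact measure_univ

noncomputable def toR (b : ℕ → Bool) : ℝ := ∑' j : ℕ, if b j then ((2 : ℝ) ^ (-(j : ℤ) - 1)) else 0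

theorem two_zpow (j : ℕ) : (2:ℝ) ^ (-(j:ℤ)-1) = (1/2)^(j+1) := by
  rw [one_div, inv_pow, ← zpow_natCast, ← zpow_neg]; congr 1; push_cast; ring

theorem measurable_toR : Measurable toR := by
  have : Continuous toR := by
    unfold toR
    refine continuous_tsum (u := fun j : ℕ => (1/2 : ℝ)^(j+1)) ?_ ?_ ?_
    · intro j
      exact (continuous_of_discreteTopology (f := fun b : Bool => if b then ((2 : ℝ) ^ (-(j : ℤ) - 1)) else 0)).comp (continuous_apply j)
    · exact (summable_nat_add_iff 1).2 (summable_geometric_of_lt_one (by norm_num) (by norm_num))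
    · intro j b
      rw [two_zpow]
      split_ifs
      · rw [Real.norm_of_nonneg (by positivity)]
      · simp
  exact this.measurable

theorem toR_bits {x : ℝ} (hx : x ∈ Set.Ico (0:ℝ) 1) : toR (fun k => bit x k) = x := by
  have h := Real.hasSum_ofDigitsTerm_digits x (b := 2) (by norm_num) hx
  refine Eq.trans ?_ h.tsum_eq
  rw [toR]
  congr 1; ext j
  rw [two_zpow, Real.ofDigitsTerm, Real.digits]
  have h0 : 0 ≤ x * 2 ^ (j+1) := by have := hx.1; positivity
  have hz : ⌊x * 2 ^ (j+1)⌋ = (⌊x * 2 ^ (j+1)⌋₊ : ℤ) := (Int.natCast_floor_eq_floor h0).symm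
  simp only [bit, hz]
  push_cast
  rcases Nat.mod_two_eq_zero_or_one ⌊x * 2 ^ (j+1)⌋₊ with h | h
  · have : ((⌊x * 2 ^ (j+1)⌋₊ : ℤ)) % 2 = 0 := by omega
    simp [this, h]
  · have : ((⌊x * 2 ^ (j+1)⌋₊ : ℤ)) % 2 = 1 := by omega
    simp [this, h]

theorem coin_toR : (Measure.infinitePi (fun _ : ℕ => coin)).map toR = μ0 := by
  rw [← bits_law, Measure.map_map measurable_toR measurable_bits]
  have : (toR ∘ fun x k => bit x k) =ᵐ[μ0] id := by
    rw [mu0_Ico]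
    filter_upwards [ae_restrict_mem measurableSet_Ico] with x hx
    exact toR_bits hx
  rw [Measure.map_congr this, Measure.map_id]

/-- the law of i.i.d. sequences -/
noncomputable def ν : Measure (ℕ → ℝ) := Measure.infinitePi (fun _ : ℕ => μ0)

instance instNu : IsProbabilityMeasure ν := by unfold ν; infer_instance

theorem uSlice_eq (x : ℝ) (i : ℕ) : uSlice x i = toR (fun j => bit x (Nat.pair i j)) := rfl

theorem measurable_uSlice (i : ℕ) : Measurable (fun x => uSlice x i) := by
  simp only [uSlice_eq]
  exact measurable_toR.comp (measurable_pi_lambda _ fun j => measurable_bit _)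

theorem measurable_slices : Measurable (fun x i => uSlice x i) := measurable_pi_lambda _ measurable_uSlice

theorem slices_law : μ0.map (fun x i => uSlice x i) = ν := by
  have h1 := Measure.infinitePi_map_piCongrLeft (fun _ : ℕ × ℕ => coin) (Nat.pairEquiv.symm)
  have h2 := Measure.infinitePi_map_curry (fun _ _ : ℕ => coin)
  have h3 := Measure.infinitePi_map_pi (fun _ : ℕ => Measure.infinitePi (fun _ : ℕ => coin)) (f := fun _ => toR)
    (fun _ => measurable_toR)
  have h4 : ν = Measure.infinitePi (fun _ : ℕ => (Measure.infinitePi (fun _ : ℕ => coin)).map toR) := by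
    rw [ν, coin_toR]
  have m3 : Measurable (fun (x : ℕ → ℕ → Bool) (i : ℕ) => toR (x i)) :=
    measurable_pi_lambda _ (fun i => measurable_toR.comp (measurable_pi_apply i))
  rw [h4, ← h3, ← h2, ← h1]
  rw [show (Measure.infinitePi fun i => coin) = μ0.map (fun x k => bit x k) from bits_law.symm]
  rw [Measure.map_map (by fun_prop) measurable_bits]
  rw [Measure.map_map (g := (fun (x : ℕ → ℕ → Bool) (i : ℕ) => toR (x i))) m3 (by fun_prop)]
  rw [Measure.map_map (m3.comp (by fun_prop)) ((MeasurableEquiv.measurable _).comp measurable_bits)]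
  congr 1
  funext x i
  simp only [Function.comp, uSlice_eq]
  congr 1
  funext j
  have e : (MeasurableEquiv.piCongrLeft (fun _ : ℕ × ℕ => Bool) Nat.pairEquiv.symm) (fun k => bit x k) (Nat.pairEquiv.symm (Nat.pair i j)) = bit x (Nat.pair i j) :=
    Equiv.piCongrLeft_apply_apply (P := fun _ : ℕ × ℕ => Bool) (e := Nat.pairEquiv.symm) (f := fun k => bit x k) (Nat.pair i j)
  have e2 : Nat.pairEquiv.symm (Nat.pair i j) = (i, j) := Nat.unpair_pair i j
  rw [e2] at e
  exact e.symm

end U11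


namespace U11

/-- coordinate unit vector -/
def ev {d : ℕ} (i : Fin d) : V d := Pi.single i 1

/-- average over neighbours -/
noncomputable def PP {d : ℕ} (u : V d → ℝ) (y : V d) : ℝ := (∑ i, (u (y + ev i) + u (y - ev i))) / (2 * d)

theorem unitVecs_inj (d : ℕ) : Function.Injective
    (fun p : Fin d × Bool => (fun j => if j = p.1 then (if p.2 then 1 else -1) else 0 : V d)) := by
  rintro ⟨i, b⟩ ⟨j, c⟩ h
  have h1 := congrFun h i
  have h2 := congrFun h j
  simp only [] at h1 h2
  by_cases hij : i = j
  · subst hij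
    cases b <;> cases c <;> simp_all
  · cases b <;> simp_all

theorem card_unitVecs (d : ℕ) : (unitVecs d).card = 2 * d := by
  rw [unitVecs, Finset.card_image_of_injective _ (unitVecs_inj d)]
  simp [mul_comm]

theorem sum_unitVecs {d : ℕ} {M : Type*} [AddCommMonoid M] (g : V d → M) :
    ∑ e ∈ unitVecs d, g e = ∑ i, (g (ev i) + g (- ev i)) := by
  rw [unitVecs, Finset.sum_image (fun a _ b _ h => unitVecs_inj d h), ← Finset.univ_product_univ, Finset.sum_product]
  refine Finset.sum_congr rfl fun i _ => ?_
  rw [Fintype.sum_bool]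
  congr 2
  · ext j; simp [ev, Pi.single_apply]
  · ext j; simp only [ev, Pi.single_apply, Pi.neg_apply]; split_ifs <;> simp_all

theorem PP_eq {d : ℕ} (u : V d → ℝ) (y : V d) : PP u y = (∑ e ∈ unitVecs d, u (y + e)) / (2 * d) := by
  rw [sum_unitVecs (fun e => u (y + e))]
  simp only [PP, sub_eq_add_neg]

theorem mem_unitVecs {d : ℕ} (e : V d) : e ∈ unitVecs d ↔ ∃ i, e = ev i ∨ e = - ev i := by
  rw [unitVecs, Finset.mem_image]
  constructor
  · rintro ⟨⟨i, b⟩, -, rfl⟩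
    refine ⟨i, ?_⟩
    cases b
    · right; ext j; simp only [ev, Pi.single_apply, Pi.neg_apply]; split_ifs <;> simp_all
    · left; ext j; simp [ev, Pi.single_apply]
  · rintro ⟨i, h | h⟩
    · refine ⟨(i, true), Finset.mem_univ _, ?_⟩
      rw [h]; ext j; simp [ev, Pi.single_apply]
    · refine ⟨(i, false), Finset.mem_univ _, ?_⟩
      rw [h]; ext j; simp only [ev, Pi.single_apply, Pi.neg_apply]; split_ifs <;> simp_all

theorem mem_outb {d : ℕ} (A : Finset (V d)) (z : V d) :
    z ∈ outb A ↔ z ∉ A ∧ ∃ x ∈ A, ∃ i, z = x + ev i ∨ z = x - ev i := by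
  simp only [outb, Finset.mem_sdiff, Finset.mem_biUnion, Finset.mem_image, mem_unitVecs]
  rw [and_comm]
  refine and_congr_right fun _ => exists_congr fun x => and_congr_right fun _ => ?_
  constructor
  · rintro ⟨e, ⟨i, rfl | rfl⟩, rfl⟩
    · exact ⟨i, Or.inl rfl⟩
    · exact ⟨i, Or.inr (sub_eq_add_neg _ _).symm⟩
  · rintro ⟨i, rfl | rfl⟩
    · exact ⟨_, ⟨i, Or.inl rfl⟩, rfl⟩
    · exact ⟨_, ⟨i, Or.inr rfl⟩, (sub_eq_add_neg _ _).symm⟩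

theorem nbr_cases {d : ℕ} (A : Finset (V d)) {x : V d} (hx : x ∈ A) (i : Fin d) :
    (x + ev i ∈ A ∨ x + ev i ∈ outb A) ∧ (x - ev i ∈ A ∨ x - ev i ∈ outb A) := by
  constructor
  · by_cases h : x + ev i ∈ A
    · exact Or.inl h
    · exact Or.inr ((mem_outb _ _).2 ⟨h, x, hx, i, Or.inl rfl⟩)
  · by_cases h : x - ev i ∈ A
    · exact Or.inl h
    · exact Or.inr ((mem_outb _ _).2 ⟨h, x, hx, i, Or.inr rfl⟩)

theorem PP_add {d : ℕ} (u v : V d → ℝ) (y : V d) : PP (fun z => u z + v z) y = PP u y + PP v y := by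
  simp only [PP, ← add_div, ← Finset.sum_add_distrib]
  congr 1; refine Finset.sum_congr rfl fun i _ => ?_; ring

theorem PP_sub {d : ℕ} (u v : V d → ℝ) (y : V d) : PP (fun z => u z - v z) y = PP u y - PP v y := by
  simp only [PP, ← sub_div, ← Finset.sum_sub_distrib]
  congr 1; refine Finset.sum_congr rfl fun i _ => ?_; ring

theorem PP_smul {d : ℕ} (c : ℝ) (u : V d → ℝ) (y : V d) : PP (fun z => c * u z) y = c * PP u y := by
  simp only [PP, ← mul_div_assoc, Finset.mul_sum]
  congr 1; refine Finset.sum_congr rfl fun i _ => ?_; ring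

theorem PP_const {d : ℕ} (hd : 0 < d) (c : ℝ) (y : V d) : PP (fun _ => c) y = c := by
  have : (d : ℝ) ≠ 0 := by positivity
  simp only [PP, Finset.sum_const, Finset.card_univ, Fintype.card_fin, nsmul_eq_mul]
  field_simp; ring

theorem PP_sum {d : ℕ} {ι : Type*} (s : Finset ι) (u : ι → V d → ℝ) (y : V d) :
    PP (fun z => ∑ j ∈ s, u j z) y = ∑ j ∈ s, PP (u j) y := by
  classical
  induction s using Finset.induction_on with
  | empty => simp [PP]
  | insert a s ha ih => simp only [Finset.sum_insert ha, PP_add, ih]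

theorem PP_mono {d : ℕ} {u v : V d → ℝ} {y : V d} (h : ∀ i, u (y + ev i) ≤ v (y + ev i) ∧ u (y - ev i) ≤ v (y - ev i)) :
    PP u y ≤ PP v y := by
  unfold PP
  gcongr with i _
  · exact (h i).1
  · exact (h i).2

theorem max_principle {d : ℕ} (hd : 0 < d) (S : Finset (V d)) (g : V d → ℝ)
    (h1 : ∀ y ∈ S, PP g y ≤ g y) (h2 : ∀ y ∈ outb S, 0 ≤ g y) : ∀ y ∈ S, 0 ≤ g y := by
  by_contra! hcon
  obtain ⟨x, hx, hx0⟩ := hcon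
  obtain ⟨m, hm, hmin⟩ := S.exists_min_image g ⟨x, hx⟩
  have hm0 : g m < 0 := lt_of_le_of_lt (hmin x hx) hx0
  let i0 : Fin d := ⟨0, hd⟩
  obtain ⟨y, hy, hmax⟩ := (S.filter (fun z => g z = g m)).exists_max_image (fun z => z i0) ⟨m, by simp [hm]⟩
  rw [Finset.mem_filter] at hy
  have hall : ∀ z, (z ∈ S ∨ z ∈ outb S) → g m ≤ g z := by
    rintro z (hz | hz)
    · exact hmin z hz
    · exact hm0.le.trans (h2 z hz)
  have hlt : g m < g (y + ev i0) := by
    rcases (nbr_cases S hy.1 i0).1 with h | h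
    · refine lt_of_le_of_ne (hmin _ h) fun he => ?_
      have := hmax (y + ev i0) (by simp [h, he.symm])
      simp [ev] at this
    · exact hm0.trans_le (h2 _ h)
  have h3 := h1 y hy.1
  rw [hy.2, PP, div_le_iff₀ (by positivity)] at h3
  have : ∑ i : Fin d, (g m + g m) < ∑ i, (g (y + ev i) + g (y - ev i)) := by
    refine Finset.sum_lt_sum (fun i _ => add_le_add (hall _ (nbr_cases S hy.1 i).1) (hall _ (nbr_cases S hy.1 i).2)) ⟨i0, Finset.mem_univ _, ?_⟩
    exact add_lt_add_of_lt_of_le hlt (hall _ (nbr_cases S hy.1 i0).2)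
  simp only [Finset.sum_const, Finset.card_univ, Fintype.card_fin, nsmul_eq_mul] at this
  nlinarith

theorem comparison {d : ℕ} (hd : 0 < d) (S : Finset (V d)) (f g : V d → ℝ)
    (h1 : ∀ y ∈ S, f y - PP f y ≤ g y - PP g y) (h2 : ∀ y ∈ outb S, f y ≤ g y) : ∀ y ∈ S, f y ≤ g y := by
  intro y hy
  have := max_principle hd S (fun z => g z - f z) (fun y hy => by rw [PP_sub]; linarith [h1 y hy])
    (fun y hy => by linarith [h2 y hy]) y hy
  linarith

end U11


namespace U11

def cons (u : ℝ) (y : ℕ → ℝ) : ℕ → ℝ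
  | 0 => u
  | k + 1 => y k

theorem measurable_cons : Measurable (fun p : ℝ × (ℕ → ℝ) => cons p.1 p.2) := by
  refine measurable_pi_lambda _ fun k => ?_
  cases k with
  | zero => exact measurable_fst
  | succ k => exact (measurable_pi_apply k).comp measurable_snd

theorem cons_law : (μ0.prod ν).map (fun p => cons p.1 p.2) = ν := by
  classical
  apply Measure.eq_infinitePi
  intro s t ht
  rw [Measure.map_apply measurable_cons (MeasurableSet.pi s.countable_toSet fun i _ => ht i)]
  obtain ⟨N, hN⟩ : ∃ N, s ⊆ Finset.range (N+1) := ⟨s.sup id, fun i hi => by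
    rw [Finset.mem_range]; exact Nat.lt_succ_of_le (Finset.le_sup (f := id) hi)⟩
  set T : ℕ → Set ℝ := fun k => if k ∈ s then t k else Set.univ with hT
  have hTm : ∀ k, MeasurableSet (T k) := fun k => by
    simp only [hT]; split_ifs
    · exact ht k
    · exact MeasurableSet.univ
  have e : (fun p : ℝ × (ℕ → ℝ) => cons p.1 p.2) ⁻¹' (Set.pi s t) =
      T 0 ×ˢ Set.pi (Finset.range N : Set ℕ) (fun k => T (k+1)) := by
    ext ⟨u, y⟩
    simp only [Set.mem_preimage, Set.mem_pi, Finset.mem_coe, Set.mem_prod, Finset.mem_range, hT]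
    constructor
    · intro h
      constructor
      · split_ifs with h0
        · exact h 0 h0
        · trivial
      · intro k _; split_ifs with h0
        · exact h (k+1) h0
        · trivial
    · rintro ⟨h0, h⟩ k hk
      cases k with
      | zero => rw [if_pos hk] at h0; exact h0
      | succ k =>
        have := h k (by have := Finset.mem_range.1 (hN hk); omega)
        rw [if_pos hk] at this; exact this
  rw [e, Measure.prod_prod]
  rw [show ν = Measure.infinitePi (fun _ : ℕ => μ0) from rfl, Measure.infinitePi_pi _ (fun i _ => hTm _)]
  have : ∏ i ∈ s, μ0 (t i) = ∏ i ∈ Finset.range (N+1), μ0 (T i) := by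
    rw [← Finset.prod_subset hN]
    · exact Finset.prod_congr rfl fun i hi => by simp only [hT]; rw [if_pos hi]
    · intro i _ hi; simp only [hT]; rw [if_neg hi]; exact measure_univ
  rw [this, Finset.prod_range_succ', mul_comm]

theorem lintegral_nu (Ψ : (ℕ → ℝ) → ℝ≥0∞) (h : Measurable Ψ) :
    ∫⁻ y, Ψ y ∂ν = ∫⁻ u, ∫⁻ y, Ψ (cons u y) ∂ν ∂μ0 := by
  conv_lhs => rw [← cons_law]
  rw [lintegral_map h measurable_cons, lintegral_prod (fun p : ℝ × (ℕ → ℝ) => Ψ (cons p.1 p.2)) (h.comp measurable_cons).aemeasurable]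

theorem lintegral_slices (Ψ : (ℕ → ℝ) → ℝ≥0∞) (h : Measurable Ψ) :
    ∫⁻ ω, Ψ (fun i => uSlice ω i) ∂μ0 = ∫⁻ y, Ψ y ∂ν := by
  rw [← slices_law, lintegral_map h measurable_slices]

/-! ### uniform choice -/

noncomputable def idx (m : ℕ) (hm : 0 < m) (u : ℝ) : Fin m := ⟨(⌊u * m⌋).toNat % m, Nat.mod_lt _ hm⟩

theorem measurable_idx (m : ℕ) (hm : 0 < m) : Measurable (idx m hm) := by
  have h1 : Measurable (fun u : ℝ => ⌊u * m⌋) := Int.measurable_floor.comp (measurable_id.mul_const _)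
  exact (measurable_from_top (f := fun z : ℤ => (⟨z.toNat % m, Nat.mod_lt _ hm⟩ : Fin m))).comp h1

theorem idx_law (m : ℕ) (hm : 0 < m) (j : Fin m) : μ0 (idx m hm ⁻¹' {j}) = (m : ℝ≥0∞)⁻¹ := by
  rw [mu0_Ico, Measure.restrict_apply (measurable_idx m hm (MeasurableSet.singleton j))]
  have hm' : (0:ℝ) < m := by exact_mod_cast hm
  have : idx m hm ⁻¹' {j} ∩ Set.Ico 0 1 = Set.Ico ((j : ℝ) / m) (((j : ℝ) + 1) / m) := by
    ext u
    simp only [Set.mem_inter_iff, Set.mem_preimage, Set.mem_singleton_iff, Set.mem_Ico, idx, Fin.ext_iff]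
    rw [div_le_iff₀ hm', lt_div_iff₀ hm']
    have key : 0 ≤ u → u < 1 → (⌊u * m⌋).toNat % m = (⌊u * m⌋).toNat := by
      intro h0 h1
      apply Nat.mod_eq_of_lt
      have : ⌊u * m⌋ < (m : ℤ) := by
        rw [Int.floor_lt]; push_cast; nlinarith
      omega
    have hj : ((j : ℕ) : ℝ) + 1 ≤ m := by exact_mod_cast j.2
    have hj0 : (0:ℝ) ≤ (j : ℕ) := by positivity
    constructor
    · rintro ⟨h, h0, h1⟩
      rw [key h0 h1] at h
      have h2 : (0 : ℤ) ≤ ⌊u * m⌋ := Int.floor_nonneg.2 (by positivity)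
      have h3 : ⌊u * m⌋ = (j : ℕ) := by omega
      rw [Int.floor_eq_iff] at h3
      exact_mod_cast h3
    · rintro ⟨h0, h1⟩
      have hu0 : 0 ≤ u := by
        by_contra hc; push Not at hc
        have := mul_neg_of_neg_of_pos hc hm'; linarith
      have hu1 : u < 1 := by
        by_contra hc; push Not at hc
        nlinarith
      refine ⟨?_, hu0, hu1⟩
      rw [key hu0 hu1]
      have h3 : ⌊u * m⌋ = (j : ℕ) := by
        rw [Int.floor_eq_iff]; push_cast; exact ⟨h0, h1⟩
      omega
  rw [this, Real.volume_Ico, ← sub_div, add_sub_cancel_left, one_div, ENNReal.ofReal_inv_of_pos hm', ENNReal.ofReal_natCast]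

theorem pick_eq {d : ℕ} (S : Finset (V d)) (hS : S.Nonempty) (u : ℝ) :
    pick S u = (S.equivFin.symm (idx S.card (Finset.card_pos.mpr hS) u)).val := by
  rw [pick, dif_pos hS]; rfl

theorem measurable_pick {d : ℕ} (S : Finset (V d)) : Measurable (pick S) := by
  by_cases hS : S.Nonempty
  · have : pick S = (fun j => (S.equivFin.symm j).val) ∘ (idx S.card (Finset.card_pos.mpr hS)) := by
      ext1 u; exact pick_eq S hS u
    rw [this]
    exact (measurable_of_finite _).comp (measurable_idx _ _)
  · have : pick S = fun _ => 0 := by ext1 u; simp [pick, hS]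
    rw [this]; exact measurable_const

theorem pick_mem {d : ℕ} (S : Finset (V d)) (hS : S.Nonempty) (u : ℝ) : pick S u ∈ S := by
  rw [pick_eq S hS]; exact Subtype.prop _

theorem lintegral_pick {d : ℕ} (S : Finset (V d)) (hS : S.Nonempty) (g : V d → ℝ≥0∞) :
    ∫⁻ u, g (pick S u) ∂μ0 = ∑ x ∈ S, (S.card : ℝ≥0∞)⁻¹ * g x := by
  have hm := measurable_idx S.card (Finset.card_pos.mpr hS)
  simp_rw [pick_eq S hS]
  rw [← lintegral_map (f := fun j => g (S.equivFin.symm j).val) (measurable_of_finite _) hm, lintegral_fintype]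
  rw [← Finset.sum_coe_sort S, ← Equiv.sum_comp S.equivFin.symm]
  refine Finset.sum_congr rfl fun j _ => ?_
  rw [Measure.map_apply hm (MeasurableSet.singleton _), idx_law, mul_comm]

/-! ### the walk on sequences -/

noncomputable def walkS {d : ℕ} (x : V d) (y : ℕ → ℝ) (t : ℕ) : V d :=
  x + ∑ i ∈ Finset.range t, pick (unitVecs d) (y i)

noncomputable def exitS {d : ℕ} (S : Finset (V d)) (x : V d) (y : ℕ → ℝ) : ℕ := sInf {t | walkS x y t ∉ S}

noncomputable def hitS {d : ℕ} (S : Finset (V d)) (x : V d) (y : ℕ → ℝ) : V d := walkS x y (exitS S x y)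

theorem hitPt_eq {d : ℕ} (S : Finset (V d)) (x : V d) (ω : ℝ) : hitPt S x ω = hitS S x (fun i => uSlice ω i) := rfl

theorem walkS_cons {d : ℕ} (x : V d) (u : ℝ) (y : ℕ → ℝ) (t : ℕ) :
    walkS x (cons u y) (t+1) = walkS (x + pick (unitVecs d) u) y t := by
  simp only [walkS, Finset.sum_range_succ', cons]
  abel

theorem measurable_walkS {d : ℕ} (x : V d) (t : ℕ) : Measurable (fun y => walkS x y t) := by
  unfold walkS
  refine measurable_const.add (Finset.measurable_sum _ fun i _ => ?_)
  exact (measurable_pick _).comp (measurable_pi_apply i)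

theorem hitS_eq_iff {d : ℕ} (S : Finset (V d)) (x z : V d) (hz : z ∉ S) (y : ℕ → ℝ) :
    hitS S x y = z ↔ ∃ t, walkS x y t = z ∧ ∀ s < t, walkS x y s ∈ S := by
  constructor
  · intro h
    refine ⟨exitS S x y, h, fun s hs => ?_⟩
    have := Nat.notMem_of_lt_sInf hs
    simpa using this
  · rintro ⟨t, ht, hlt⟩
    have : exitS S x y = t := by
      refine le_antisymm (Nat.sInf_le (by simp [ht, hz])) ?_
      refine le_csInf ⟨t, by simp [ht, hz]⟩ fun s hs => ?_
      by_contra hc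
      exact hs (hlt s (by omega))
    rw [hitS, this, ht]

theorem measurable_walkS_mem {d : ℕ} (x : V d) (t : ℕ) (E : Set (V d)) : MeasurableSet {y | walkS x y t ∈ E} :=
  measurable_walkS x t (Set.to_countable E).measurableSet

theorem measurable_hitS_eq {d : ℕ} (S : Finset (V d)) (x z : V d) (hz : z ∉ S) :
    MeasurableSet {y | hitS S x y = z} := by
  have : {y | hitS S x y = z} = ⋃ t, ({y | walkS x y t ∈ ({z} : Set (V d))} ∩ ⋂ s, ⋂ (_ : s < t), {y | walkS x y s ∈ (S : Set (V d))}) := by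
    ext y; simp [hitS_eq_iff S x z hz]
  rw [this]
  exact MeasurableSet.iUnion fun t => (measurable_walkS_mem x t _).inter
    (MeasurableSet.iInter fun s => MeasurableSet.iInter fun _ => measurable_walkS_mem x s _)

theorem measurable_hitS {d : ℕ} (S : Finset (V d)) (x : V d) : Measurable (hitS S x) := by
  refine measurable_to_countable' fun z => ?_
  by_cases hz : z ∉ S
  · exact measurable_hitS_eq S x z hz
  · push Not at hz
    have hT : MeasurableSet {y | ∃ w, w ∉ S ∧ hitS S x y = w} := by
      have : {y | ∃ w, w ∉ S ∧ hitS S x y = w} = ⋃ w, ⋃ (_ : w ∉ S), {y | hitS S x y = w} := by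
        ext y; simp
      rw [this]
      exact MeasurableSet.iUnion fun w => MeasurableSet.iUnion fun hw => measurable_hitS_eq S x w hw
    have hin : ∀ y, hitS S x y ∈ S → hitS S x y = x := by
      intro y hy
      by_cases hne : {t | walkS x y t ∉ S}.Nonempty
      · exact absurd hy (Nat.sInf_mem hne)
      · rw [Set.not_nonempty_iff_eq_empty] at hne
        rw [hitS, exitS, hne]; simp [walkS]
    by_cases hzx : z = x
    · have : hitS S x ⁻¹' {z} = {y | ∃ w, w ∉ S ∧ hitS S x y = w}ᶜ := by
        ext y
        simp only [Set.mem_preimage, Set.mem_singleton_iff, Set.mem_compl_iff, Set.mem_ofPred_eq]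
        constructor
        · rintro h ⟨w, hw, h2⟩; rw [h] at h2; exact hw (h2 ▸ hz)
        · intro h
          rw [hzx]; apply hin
          by_contra hc; exact h ⟨_, hc, rfl⟩
      rw [this]; exact hT.compl
    · have : hitS S x ⁻¹' {z} = ∅ := by
        ext y
        simp only [Set.mem_preimage, Set.mem_singleton_iff, Set.mem_empty_iff_false, iff_false]
        intro h
        have := hin y (h ▸ hz)
        exact hzx (h.symm.trans this)
      rw [this]; exact MeasurableSet.empty

theorem hitS_cons {d : ℕ} (S : Finset (V d)) (x z : V d) (hx : x ∈ S) (hz : z ∉ S) (u : ℝ) (y : ℕ → ℝ) :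
    hitS S x (cons u y) = z ↔ hitS S (x + pick (unitVecs d) u) y = z := by
  rw [hitS_eq_iff S _ _ hz, hitS_eq_iff S _ _ hz]
  have h0 : walkS x (cons u y) 0 = x := by simp [walkS]
  constructor
  · rintro ⟨t, ht, hlt⟩
    cases t with
    | zero => rw [h0] at ht; exact absurd (ht ▸ hx) hz
    | succ t =>
      refine ⟨t, by rw [← walkS_cons]; exact ht, fun s hs => ?_⟩
      rw [← walkS_cons]; exact hlt _ (by omega)
  · rintro ⟨t, ht, hlt⟩
    refine ⟨t+1, by rw [walkS_cons]; exact ht, fun s hs => ?_⟩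
    cases s with
    | zero => rw [h0]; exact hx
    | succ s => rw [walkS_cons]; exact hlt _ (by omega)

/-- hitting kernel -/
noncomputable def hk {d : ℕ} (S : Finset (V d)) (x z : V d) : ℝ := (ν {y | hitS S x y = z}).toReal

theorem hk_nonneg {d : ℕ} (S : Finset (V d)) (x z : V d) : 0 ≤ hk S x z := ENNReal.toReal_nonneg

theorem hk_off {d : ℕ} (S : Finset (V d)) (x z : V d) (hx : x ∉ S) : hk S x z = if x = z then 1 else 0 := by
  have h : ∀ y, hitS S x y = x := by
    intro y
    rw [hitS_eq_iff S x x hx]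
    exact ⟨0, by simp [walkS], fun s hs => by omega⟩
  unfold hk
  simp_rw [h]
  split_ifs with hxz <;> simp [hxz]

theorem hk_harm {d : ℕ} (hd : 0 < d) (S : Finset (V d)) (x z : V d) (hx : x ∈ S) (hz : z ∉ S) :
    PP (fun x => hk S x z) x = hk S x z := by
  have hU : (unitVecs d).Nonempty := by rw [← Finset.card_pos, card_unitVecs]; omega
  have hm : ∀ x, MeasurableSet {y | hitS S x y = z} := fun x => measurable_hitS_eq S x z hz
  have h1 : ν {y | hitS S x y = z} = ∑ e ∈ unitVecs d, ((2 * d : ℕ) : ℝ≥0∞)⁻¹ * ν {y | hitS S (x + e) y = z} := by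
    rw [← lintegral_indicator_one (hm x), lintegral_nu _ (measurable_one.indicator (hm x))]
    have : ∀ u, ∫⁻ y, Set.indicator {y | hitS S x y = z} 1 (cons u y) ∂ν = ν {y | hitS S (x + pick (unitVecs d) u) y = z} := by
      intro u
      rw [← lintegral_indicator_one (hm _)]
      refine lintegral_congr fun y => ?_
      simp only [Set.indicator, Set.mem_ofPred_eq, hitS_cons S x z hx hz, Pi.one_apply]
    simp_rw [this]
    rw [lintegral_pick (unitVecs d) hU (fun e => ν {y | hitS S (x + e) y = z}), card_unitVecs]
  rw [PP_eq]
  simp only [hk]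
  rw [h1, ENNReal.toReal_sum (fun e _ => ENNReal.mul_ne_top (by simp; omega) (measure_ne_top _ _)), Finset.sum_div]
  refine Finset.sum_congr rfl fun e _ => ?_
  rw [ENNReal.toReal_mul, ENNReal.toReal_inv, ENNReal.toReal_natCast]
  push_cast
  field_simp

theorem hk_outb_sum {d : ℕ} (S : Finset (V d)) (w : V d) (hw : w ∈ outb S) (g : V d → ℝ) :
    ∑ z ∈ outb S, hk S w z * g z = g w := by
  classical
  have hw' : w ∉ S := ((mem_outb _ _).1 hw).1
  rw [Finset.sum_eq_single w]
  · rw [hk_off S w w hw']; simp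
  · intro z _ hz; rw [hk_off S w z hw', if_neg (Ne.symm hz), zero_mul]
  · intro h; exact absurd hw h

theorem hk_sum_harm {d : ℕ} (hd : 0 < d) (S : Finset (V d)) (g : V d → ℝ) (x : V d) (hx : x ∈ S) :
    PP (fun x => ∑ z ∈ outb S, hk S x z * g z) x = ∑ z ∈ outb S, hk S x z * g z := by
  rw [PP_sum (outb S) (fun z x => hk S x z * g z)]
  refine Finset.sum_congr rfl fun z hz => ?_
  have : (fun x => hk S x z * g z) = fun x => g z * hk S x z := by ext; ring
  rw [this, PP_smul, hk_harm hd S x z hx ((mem_outb _ _).1 hz).1, mul_comm]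

theorem hk_super {d : ℕ} (hd : 0 < d) (S : Finset (V d)) (u : V d → ℝ) (hu : ∀ y ∈ S, PP u y ≤ u y) :
    ∀ x ∈ S, ∑ z ∈ outb S, hk S x z * u z ≤ u x := by
  apply comparison hd S (fun x => ∑ z ∈ outb S, hk S x z * u z) u
  · intro y hy; rw [hk_sum_harm hd S u y hy]; linarith [hu y hy]
  · intro w hw; rw [hk_outb_sum S w hw]

theorem hk_total {d : ℕ} (hd : 0 < d) (S : Finset (V d)) (x : V d) (hx : x ∈ S) :
    ∑ z ∈ outb S, hk S x z = 1 := by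
  have h1 := hk_super hd S (fun _ => 1) (fun y _ => (PP_const hd _ _).le) x hx
  have h2 := hk_super hd S (fun _ => -1) (fun y _ => (PP_const hd _ _).le) x hx
  simp only [mul_one, mul_neg, Finset.sum_neg_distrib] at h1 h2
  linarith

theorem lintegral_hit {d : ℕ} (hd : 0 < d) (S : Finset (V d)) (x : V d) (hx : x ∈ S) (g : V d → ℝ≥0∞) :
    ∫⁻ ω, g (hitPt S x ω) ∂μ0 = ∑ z ∈ outb S, ENNReal.ofReal (hk S x z) * g z := by
  classical
  simp_rw [hitPt_eq]
  have hg : Measurable g := measurable_of_countable g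
  rw [lintegral_slices (fun y => g (hitS S x y)) (hg.comp (measurable_hitS S x))]
  have hae : ∀ᵐ y ∂ν, hitS S x y ∈ outb S := by
    have : ν {y | hitS S x y ∈ outb S} = 1 := by
      have e : {y | hitS S x y ∈ outb S} = ⋃ z ∈ outb S, {y | hitS S x y = z} := by ext; simp
      rw [e, measure_biUnion_finset]
      · have := hk_total hd S x hx
        rw [← ENNReal.ofReal_one, ← this, ENNReal.ofReal_sum_of_nonneg (fun z _ => hk_nonneg _ _ _)]
        exact Finset.sum_congr rfl fun z _ => (ENNReal.ofReal_toReal (measure_ne_top _ _)).symm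
      · intro a _ b _ hab
        simp only [Function.onFun]
        rw [Set.disjoint_left]; intro y h1 h2; exact hab (h1.symm.trans h2)
      · intro z hz; exact measurable_hitS_eq S x z ((mem_outb _ _).1 hz).1
    have hms : MeasurableSet {y | hitS S x y ∈ outb S} := measurable_hitS S x (Finset.measurableSet _)
    exact (prob_compl_eq_zero_iff hms).2 this
  have e : (fun y => g (hitS S x y)) =ᵐ[ν] fun y => ∑ z ∈ outb S, Set.indicator {y | hitS S x y = z} (fun _ => g z) y := by
    filter_upwards [hae] with y hy
    rw [Finset.sum_eq_single (hitS S x y)]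
    · simp
    · intro z _ hz; rw [Set.indicator_of_notMem]; intro h; exact hz h.symm
    · intro h; exact absurd hy h
  have hm : ∀ z ∈ outb S, MeasurableSet {y | hitS S x y = z} := fun z hz => measurable_hitS_eq S x z ((mem_outb _ _).1 hz).1
  rw [lintegral_congr_ae e, lintegral_finsetSum' _ (fun z hz => (measurable_const.indicator (hm z hz)).aemeasurable)]
  refine Finset.sum_congr rfl fun z hz => ?_
  rw [lintegral_indicator (hm z hz), setLIntegral_const, mul_comm]
  congr 1
  exact (ENNReal.ofReal_toReal (measure_ne_top _ _)).symm

theorem measurable_hitPt {d : ℕ} (S : Finset (V d)) (x : V d) : Measurable (hitPt S x) :=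
  (measurable_hitS S x).comp measurable_slices

instance instDM (d : ℕ) : DiscreteMeasurableSpace (Finset (V d)) := ⟨fun _ => trivial⟩

theorem measurable_step2 {d : ℕ} (S : Finset (V d)) :
    Measurable (fun p : ℝ × ℝ => hitPt S (pick S p.1) p.2) := by
  have : Measurable (fun p : V d × ℝ => hitPt S p.1 p.2) :=
    measurable_from_prod_countable_right fun x => measurable_hitPt S x
  exact this.comp (((measurable_pick S).comp measurable_fst).prodMk measurable_snd)

theorem measurable_uStep {d : ℕ} (S : Finset (V d)) : Measurable (uStep S) := by
  have h := (measurable_step2 S).comp ((measurable_uSlice 0).prodMk (measurable_uSlice 1))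
  have h2 := (measurable_of_countable (fun z : V d => insert z S)).comp h
  have e : uStep S = (fun z : V d => insert z S) ∘ ((fun p : ℝ × ℝ => hitPt S (pick S p.1) p.2) ∘ fun a => (uSlice a 0, uSlice a 1)) := by
    funext ω; rw [uStep, addPt]; rfl
  rw [e]; exact h2

theorem lintegral_two (F : ℝ × ℝ → ℝ≥0∞) (hF : Measurable F) :
    ∫⁻ ω, F (uSlice ω 0, uSlice ω 1) ∂μ0 = ∫⁻ u, ∫⁻ v, F (u, v) ∂μ0 ∂μ0 := by
  have h1 := lintegral_slices (fun y => F (y 0, y 1)) (hF.comp ((measurable_pi_apply 0).prodMk (measurable_pi_apply 1)))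
  refine Eq.trans h1 ?_
  rw [lintegral_nu (fun y => F (y 0, y 1)) (hF.comp ((measurable_pi_apply 0).prodMk (measurable_pi_apply 1)))]
  refine lintegral_congr fun u => ?_
  have hm : Measurable (fun v => F (u, v)) := hF.comp measurable_prodMk_left
  have h2 := lintegral_nu (fun y => F (u, y 0)) (hm.comp (measurable_pi_apply 0))
  refine Eq.trans h2 ?_
  refine lintegral_congr fun v => ?_
  show ∫⁻ y, F (u, v) ∂ν = _
  simp

theorem lintegral_uStep {d : ℕ} (hd : 0 < d) (S : Finset (V d)) (hS : S.Nonempty) (W : Finset (V d) → ℝ≥0∞) :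
    ∫⁻ ω, W (uStep S ω) ∂μ0 = ∑ x ∈ S, (S.card : ℝ≥0∞)⁻¹ * ∑ z ∈ outb S, ENNReal.ofReal (hk S x z) * W (insert z S) := by
  have hW : Measurable (fun z : V d => W (insert z S)) := measurable_of_countable _
  have hF := hW.comp (measurable_step2 S)
  have h1 := lintegral_two _ hF
  have h2 : ∫⁻ ω, W (uStep S ω) ∂μ0 = ∫⁻ u, ∫⁻ v, W (insert (hitPt S (pick S u) v) S) ∂μ0 ∂μ0 := by
    refine Eq.trans (lintegral_congr fun ω => ?_) h1
    rw [uStep, addPt, Function.comp]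
  rw [h2, lintegral_pick S hS (fun x => ∫⁻ v, W (insert (hitPt S x v) S) ∂μ0)]
  refine Finset.sum_congr rfl fun x hx => ?_
  rw [lintegral_hit hd S x hx (fun z => W (insert z S))]

end U11


namespace U11

noncomputable def AV {d : ℕ} (S : Finset (V d)) (W : Finset (V d) → ℝ≥0∞) : ℝ≥0∞ :=
  ∑ x ∈ S, (S.card : ℝ≥0∞)⁻¹ * ∑ z ∈ outb S, ENNReal.ofReal (hk S x z) * W (insert z S)

theorem AV_congr {d : ℕ} (S : Finset (V d)) (W W' : Finset (V d) → ℝ≥0∞)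
    (h : ∀ z ∈ outb S, W (insert z S) = W' (insert z S)) : AV S W = AV S W' := by
  unfold AV
  refine Finset.sum_congr rfl fun x _ => ?_
  congr 1
  exact Finset.sum_congr rfl fun z hz => by rw [h z hz]

theorem AV_le {d : ℕ} (S : Finset (V d)) (hS : S.Nonempty) (W : Finset (V d) → ℝ≥0∞) (F : V d → ℝ) (c : ℝ)
    (hF : ∀ z ∈ outb S, 0 ≤ F z) (hW : ∀ z ∈ outb S, W (insert z S) ≤ ENNReal.ofReal (F z))
    (hc : ∑ x ∈ S, ∑ z ∈ outb S, hk S x z * F z ≤ S.card * c) : AV S W ≤ ENNReal.ofReal c := by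
  have hpos : (0:ℝ) < S.card := by exact_mod_cast hS.card_pos
  have h1 : AV S W ≤ ENNReal.ofReal (∑ x ∈ S, (S.card : ℝ)⁻¹ * ∑ z ∈ outb S, hk S x z * F z) := by
    rw [ENNReal.ofReal_sum_of_nonneg]
    · unfold AV
      refine Finset.sum_le_sum fun x _ => ?_
      rw [ENNReal.ofReal_mul (by positivity), ENNReal.ofReal_inv_of_pos hpos, ENNReal.ofReal_natCast]
      gcongr
      rw [ENNReal.ofReal_sum_of_nonneg (fun z hz => mul_nonneg (hk_nonneg _ _ _) (hF z hz))]
      refine Finset.sum_le_sum fun z hz => ?_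
      rw [ENNReal.ofReal_mul (hk_nonneg _ _ _)]
      gcongr
      exact hW z hz
    · intro x _
      exact mul_nonneg (by positivity) (Finset.sum_nonneg fun z hz => mul_nonneg (hk_nonneg _ _ _) (hF z hz))
  refine h1.trans (ENNReal.ofReal_le_ofReal ?_)
  rw [← Finset.mul_sum, inv_mul_le_iff₀ hpos]
  exact hc

noncomputable def aggS {d : ℕ} (S : Finset (V d)) (y : ℕ → ℝ) : ℕ → Finset (V d)
  | 0 => S
  | k + 1 => uStep (aggS S y k) (y k)

theorem uAgg_eq {d : ℕ} (S : Finset (V d)) (ω : ℝ) (k : ℕ) : uAggFrom S ω k = aggS S (fun i => uSlice ω i) k := by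
  induction k with
  | zero => rfl
  | succ k ih => rw [uAggFrom, aggS, ih]

theorem aggS_cons {d : ℕ} (S : Finset (V d)) (u : ℝ) (y : ℕ → ℝ) (k : ℕ) :
    aggS S (cons u y) (k+1) = aggS (uStep S u) y k := by
  induction k with
  | zero => rfl
  | succ k ih => rw [aggS, ih, aggS]; rfl

theorem measurable_uStep2 {d : ℕ} : Measurable (fun p : Finset (V d) × ℝ => uStep p.1 p.2) :=
  measurable_from_prod_countable_right fun x => measurable_uStep x

theorem measurable_aggS {d : ℕ} (S : Finset (V d)) (k : ℕ) : Measurable (fun y => aggS S y k) := by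
  induction k with
  | zero => exact measurable_const
  | succ k ih =>
    have h := measurable_uStep2.comp (ih.prodMk (measurable_pi_apply k))
    have e : (fun y => aggS S y (k+1)) = (fun p : Finset (V d) × ℝ => uStep p.1 p.2) ∘ (fun y => (aggS S y k, y k)) := by
      funext y; rw [aggS, Function.comp]
    rw [e]; exact h

theorem chain_aux {d : ℕ} (hd : 0 < d) (T : ℕ) (W : ℕ → Finset (V d) → ℝ≥0∞)
    (h : ∀ t < T, ∀ S, W t S = ⊤ ∨ (S.Nonempty ∧ AV S (W (t+1)) ≤ W t S)) :
    ∀ k t, t + k = T → ∀ S, ∫⁻ y, W T (aggS S y k) ∂ν ≤ W t S := by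
  intro k
  induction k with
  | zero => intro t ht S; simp only [add_zero] at ht; subst ht; simp [aggS]
  | succ k ih =>
    intro t ht S
    rcases h t (by omega) S with h1 | ⟨hS, h1⟩
    · rw [h1]; exact le_top
    · have hm : Measurable (fun y => W T (aggS S y (k+1))) := measurable_from_top.comp (measurable_aggS S (k+1))
      rw [lintegral_nu _ hm]
      simp_rw [aggS_cons]
      calc _ ≤ ∫⁻ u, W (t+1) (uStep S u) ∂μ0 := lintegral_mono fun u => ih (t+1) (by omega) _
        _ = AV S (W (t+1)) := lintegral_uStep hd S hS _
        _ ≤ _ := h1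

theorem chain {d : ℕ} (hd : 0 < d) (T : ℕ) (W : ℕ → Finset (V d) → ℝ≥0∞) (Inv : ℕ → Finset (V d) → Prop)
    (hne : ∀ t S, Inv t S → S.Nonempty)
    (hInv : ∀ t S, Inv t S → ∀ z ∈ outb S, Inv (t+1) (insert z S))
    (hstep : ∀ t < T, ∀ S, Inv t S → AV S (W (t+1)) ≤ W t S)
    (S0 : Finset (V d)) (h0 : Inv 0 S0) (bad : Finset (V d) → Prop) (c : ℝ≥0∞)
    (hbad : ∀ S, Inv T S → bad S → c ≤ W T S) :
    c * μ0 {ω | bad (uAggFrom S0 ω T)} ≤ W 0 S0 := by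
  classical
  set W' : ℕ → Finset (V d) → ℝ≥0∞ := fun t S => if Inv t S then W t S else ⊤ with hW'
  have h1 := chain_aux hd T W' (by
    intro t ht S
    by_cases hI : Inv t S
    · right
      refine ⟨hne t S hI, ?_⟩
      have e1 : W' t S = W t S := if_pos hI
      rw [e1, AV_congr S _ (W (t+1))]
      · exact hstep t ht S hI
      · intro z hz; exact if_pos (hInv t S hI z hz)
    · left; exact if_neg hI) T 0 (by omega) S0
  have e0 : W' 0 S0 = W 0 S0 := if_pos h0
  rw [e0] at h1
  refine le_trans ?_ h1
  have hm : Measurable (fun y => W' T (aggS S0 y T)) := (measurable_from_top (f := W' T)).comp (measurable_aggS S0 T)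
  rw [← lintegral_slices _ hm]
  simp_rw [← uAgg_eq]
  have hms : Measurable (fun ω => W' T (uAggFrom S0 ω T)) := by
    simp_rw [uAgg_eq]; exact hm.comp measurable_slices
  refine le_trans ?_ (mul_meas_ge_le_lintegral hms c)
  refine mul_le_mul' le_rfl (measure_mono fun ω hω => ?_)
  show c ≤ W' T (uAggFrom S0 ω T)
  by_cases hI : Inv T (uAggFrom S0 ω T)
  · exact (hbad _ hI hω).trans (if_pos hI).ge
  · exact le_top.trans (if_neg hI).ge

end U11


namespace U11

theorem dirichlet {d : ℕ} (hd : 0 < d) (S : Finset (V d)) (g : V d → ℝ) :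
    ∃ f : V d → ℝ, (∀ y, y ∉ S → f y = 0) ∧ ∀ y ∈ S, f y - PP f y = g y := by
  classical
  let ext : (S → ℝ) → V d → ℝ := fun f y => if h : y ∈ S then f ⟨y, h⟩ else 0
  have ext_add : ∀ f g, ext (f + g) = fun y => ext f y + ext g y := by
    intro f g; funext y; simp only [ext]; split_ifs <;> simp
  have ext_smul : ∀ (c : ℝ) f, ext (c • f) = fun y => c * ext f y := by
    intro c f; funext y; simp only [ext]; split_ifs <;> simp
  let A : (S → ℝ) →ₗ[ℝ] (S → ℝ) :=
    { toFun := fun f y => ext f y - PP (ext f) y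
      map_add' := by
        intro f g; funext y
        rw [ext_add, PP_add, Pi.add_apply]; ring
      map_smul' := by
        intro c f; funext y
        rw [ext_smul, PP_smul]; simp only [RingHom.id_apply, Pi.smul_apply, smul_eq_mul]; ring }
  have hinj : Function.Injective A := by
    rw [injective_iff_map_eq_zero]
    intro f hf
    have h0 : ∀ y ∈ S, ext f y - PP (ext f) y = 0 := fun y hy => congrFun hf ⟨y, hy⟩
    have hz : ∀ y : V d, (0:ℝ) - PP (fun _ => 0) y = 0 := fun y => by rw [PP_const hd]; simp
    have hb : ∀ y ∈ outb S, ext f y = 0 := fun y hy => dif_neg ((mem_outb _ _).1 hy).1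
    have h1 := comparison hd S (ext f) (fun _ => 0) (fun y hy => by rw [h0 y hy, hz]) (fun y hy => (hb y hy).le)
    have h2 := comparison hd S (fun _ => 0) (ext f) (fun y hy => by rw [h0 y hy, hz]) (fun y hy => (hb y hy).ge)
    funext ⟨y, hy⟩
    have h3 := le_antisymm (h1 y hy) (h2 y hy)
    simpa [ext, hy] using h3
  obtain ⟨f, hf⟩ := (LinearMap.injective_iff_surjective.1 hinj) (fun y => g y)
  refine ⟨ext f, fun y hy => dif_neg hy, fun y hy => ?_⟩
  exact congrFun hf ⟨y, hy⟩

theorem sum_shift {d : ℕ} (S S' : Finset (V d)) (h W : V d → ℝ) (e : V d) (hS : ∀ y, y ∉ S → h y = 0)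
    (hS' : ∀ x ∈ S, x - e ∈ S') : ∑ y ∈ S', W y * h (y + e) = ∑ x ∈ S, h x * W (x - e) := by
  classical
  have h1 : ∑ y ∈ S', W y * h (y + e) = ∑ᶠ y, W y * h (y + e) := by
    rw [finsum_eq_sum_of_support_subset]
    intro y hy
    simp only [Function.mem_support] at hy
    have : y + e ∈ S := by
      by_contra hc; exact hy (by rw [hS _ hc, mul_zero])
    have := hS' _ this
    simpa using this
  have h2 : ∑ x ∈ S, h x * W (x - e) = ∑ᶠ x, h x * W (x - e) := by
    rw [finsum_eq_sum_of_support_subset]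
    intro y hy
    simp only [Function.mem_support] at hy
    by_contra hc; exact hy (by rw [hS _ hc, zero_mul])
  rw [h1, h2, ← finsum_comp_equiv (Equiv.addRight e) (f := fun x => h x * W (x - e))]
  congr 1; funext y; simp [mul_comm]

theorem sum_by_parts {d : ℕ} (S S' : Finset (V d)) (h W : V d → ℝ) (hS : ∀ y, y ∉ S → h y = 0)
    (h1 : S ⊆ S') (h2 : outb S ⊆ S') :
    ∑ y ∈ S, h y * (W y - PP W y) = ∑ y ∈ S', W y * (h y - PP h y) := by
  have hn : ∀ x ∈ S, ∀ i, x + ev i ∈ S' ∧ x - ev i ∈ S' := by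
    intro x hx i
    have := nbr_cases S hx i
    exact ⟨this.1.elim (fun h => h1 h) (fun h => h2 h), this.2.elim (fun h => h1 h) (fun h => h2 h)⟩
  have e1 : ∑ y ∈ S', W y * h y = ∑ y ∈ S, h y * W y := by
    rw [← Finset.sum_subset h1]
    · exact Finset.sum_congr rfl fun _ _ => mul_comm _ _
    · intro y _ hy; rw [hS y hy, mul_zero]
  have e2 : ∑ y ∈ S', W y * PP h y = ∑ y ∈ S, h y * PP W y := by
    simp only [PP, ← mul_div_assoc, ← Finset.sum_div, Finset.mul_sum]
    congr 1
    rw [Finset.sum_comm]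
    conv_rhs => rw [Finset.sum_comm]
    refine Finset.sum_congr rfl fun i _ => ?_
    simp only [mul_add, Finset.sum_add_distrib]
    rw [sum_shift S S' h W (ev i) hS (fun x hx => (hn x hx i).2)]
    have := sum_shift S S' h W (- ev i) hS (fun x hx => by rw [sub_neg_eq_add]; exact (hn x hx i).1)
    simp only [sub_neg_eq_add, ← sub_eq_add_neg] at this
    rw [this, add_comm]
  simp only [mul_sub, Finset.sum_sub_distrib, e1, e2]

/-! ### radial functions -/

noncomputable def nsq {d : ℕ} (y : V d) : ℝ := ∑ i, (y i : ℝ) ^ 2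

theorem nsq_nonneg {d : ℕ} (y : V d) : 0 ≤ nsq y := Finset.sum_nonneg fun _ _ => sq_nonneg _

theorem nsq_add_ev {d : ℕ} (y : V d) (i : Fin d) : nsq (y + ev i) = nsq y + 1 + 2 * y i := by
  classical
  unfold nsq
  rw [← Finset.add_sum_erase _ _ (Finset.mem_univ i), ← Finset.add_sum_erase (a := i) _ (fun i => (y i : ℝ)^2) (Finset.mem_univ i)]
  have : ∑ x ∈ Finset.univ.erase i, (((y + ev i) x : ℤ) : ℝ) ^ 2 = ∑ x ∈ Finset.univ.erase i, (y x : ℝ)^2 := by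
    refine Finset.sum_congr rfl fun j hj => ?_
    rw [Pi.add_apply, ev, Pi.single_eq_of_ne (Finset.ne_of_mem_erase hj), add_zero]
  rw [this, Pi.add_apply, ev, Pi.single_eq_same]; push_cast; ring

theorem nsq_sub_ev {d : ℕ} (y : V d) (i : Fin d) : nsq (y - ev i) = nsq y + 1 - 2 * y i := by
  classical
  unfold nsq
  rw [← Finset.add_sum_erase _ _ (Finset.mem_univ i), ← Finset.add_sum_erase (a := i) _ (fun i => (y i : ℝ)^2) (Finset.mem_univ i)]
  have : ∑ x ∈ Finset.univ.erase i, (((y - ev i) x : ℤ) : ℝ) ^ 2 = ∑ x ∈ Finset.univ.erase i, (y x : ℝ)^2 := by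
    refine Finset.sum_congr rfl fun j hj => ?_
    rw [Pi.sub_apply, ev, Pi.single_eq_of_ne (Finset.ne_of_mem_erase hj), sub_zero]
  rw [this, Pi.sub_apply, ev, Pi.single_eq_same]; push_cast; ring

theorem PP_radial {d : ℕ} (Φ : ℝ → ℝ) (y : V d) : PP (fun z => Φ (nsq z)) y =
    (∑ i, (Φ (nsq y + 1 + 2 * y i) + Φ (nsq y + 1 - 2 * y i))) / (2 * d) := by
  simp only [PP, nsq_add_ev, nsq_sub_ev]

theorem PP_nsq {d : ℕ} (hd : 0 < d) (y : V d) : PP nsq y = nsq y + 1 := by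
  have := PP_radial (fun q => q) y
  rw [show (fun z : V d => nsq z) = nsq from rfl] at this
  rw [this]
  have hd' : (d : ℝ) ≠ 0 := by positivity
  have : ∀ i, (nsq y + 1 + 2 * (y i : ℝ) + (nsq y + 1 - 2 * y i)) = 2 * (nsq y + 1) := fun i => by ring
  simp only [this, Finset.sum_const, Finset.card_univ, Fintype.card_fin, nsmul_eq_mul]
  field_simp

theorem abs_le_sqrt_nsq {d : ℕ} (y : V d) (i : Fin d) : |(y i : ℝ)| ≤ Real.sqrt (nsq y) := by
  apply Real.abs_le_sqrt
  exact Finset.single_le_sum (f := fun i => (y i : ℝ)^2) (fun _ _ => sq_nonneg _) (Finset.mem_univ i)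

theorem second_diff_lower (Φ g : ℝ → ℝ) (hΦ : ∀ t, HasDerivAt Φ (- g t) t) (c m σ : ℝ)
    (hg : ∀ s t, c - |σ| ≤ s → s ≤ t → t ≤ c + |σ| → m * (t - s) ≤ g s - g t) :
    2 * Φ c + m * σ ^ 2 ≤ Φ (c + σ) + Φ (c - σ) := by
  set k : ℝ → ℝ := fun s => Φ (c + s) + Φ (c - s) - m * s ^ 2 with hk
  have hder : ∀ s, HasDerivAt k (- g (c + s) + g (c - s) - m * (2 * s)) s := by
    intro s
    have h1 : HasDerivAt (fun s => Φ (c + s)) (- g (c + s)) s := by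
      exact HasDerivAt.comp_const_add c s (hΦ (c + s))
    have h2 : HasDerivAt (fun s => Φ (c - s)) (g (c - s)) s := by
      have := HasDerivAt.comp_const_sub c s (hΦ (c - s))
      rwa [neg_neg] at this
    have h3 : HasDerivAt (fun s : ℝ => m * s ^ 2) (m * (2 * s)) s := by
      simpa using (hasDerivAt_pow 2 s).const_mul m
    exact (h1.add h2).sub h3
  have hmono : MonotoneOn k (Set.Icc 0 |σ|) := by
    apply monotoneOn_of_deriv_nonneg (convex_Icc _ _)
    · exact fun s _ => (hder s).continuousAt.continuousWithinAt
    · exact fun s _ => (hder s).differentiableAt.differentiableWithinAt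
    · intro s hs
      rw [interior_Icc] at hs
      rw [(hder s).deriv]
      have := hg (c - s) (c + s) (by linarith [hs.2]) (by linarith [hs.1]) (by linarith [hs.2])
      linarith
  have := hmono (Set.left_mem_Icc.2 (abs_nonneg σ)) (Set.right_mem_Icc.2 (abs_nonneg σ)) (abs_nonneg σ)
  simp only [hk] at this
  rw [sq_abs] at this
  rcases abs_choice σ with h | h <;> rw [h] at this
  · simp at this; linarith
  · simp at this; rw [← sub_eq_add_neg] at this; linarith

theorem second_diff_upper (Φ g : ℝ → ℝ) (hΦ : ∀ t, HasDerivAt Φ (- g t) t) (c m σ : ℝ)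
    (hg : ∀ s t, c - |σ| ≤ s → s ≤ t → t ≤ c + |σ| → g s - g t ≤ m * (t - s)) :
    Φ (c + σ) + Φ (c - σ) ≤ 2 * Φ c + m * σ ^ 2 := by
  have := second_diff_lower (fun t => - Φ t) (fun t => - g t) (fun t => (hΦ t).neg) c (-m) σ
    (fun s t h1 h2 h3 => by have := hg s t h1 h2 h3; linarith)
  linarith

theorem first_diff (Φ g : ℝ → ℝ) (hΦ : ∀ t, HasDerivAt Φ (- g t) t) (hg : Antitone g) (q : ℝ) :
    Φ q - g q ≤ Φ (q + 1) ∧ Φ (q+1) ≤ Φ q - g (q+1) := by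
  obtain ⟨ξ, hξ, h⟩ := exists_hasDerivAt_eq_slope Φ (fun t => - g t) (show q < q+1 by linarith)
    (fun s _ => (hΦ s).continuousAt.continuousWithinAt) (fun s _ => hΦ s)
  rw [add_sub_cancel_left, div_one] at h
  have h1 := hg hξ.1.le
  have h2 := hg hξ.2.le
  constructor <;> linarith

theorem interval_incl {q s σ : ℝ} (hq : 0 ≤ q) (hσ : |σ| ≤ 2 * Real.sqrt q) :
    (q + 1 - |σ| ≤ s → (Real.sqrt q - 1) ^ 2 ≤ s) ∧ (s ≤ q + 1 + |σ| → s ≤ (Real.sqrt q + 1) ^ 2) := by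
  have := Real.sq_sqrt hq
  constructor <;> intro h <;> nlinarith

theorem radial_lower {d : ℕ} (hd : 0 < d) (Φ g : ℝ → ℝ) (hΦ : ∀ t, HasDerivAt Φ (- g t) t) (hg : Antitone g) (y : V d) (m : ℝ)
    (hm : ∀ s t, (Real.sqrt (nsq y) - 1)^2 ≤ s → s ≤ t → t ≤ (Real.sqrt (nsq y) + 1)^2 → m * (t - s) ≤ g s - g t) :
    Φ (nsq y) - g (nsq y) + 2 * nsq y / d * m ≤ PP (fun z => Φ (nsq z)) y := by
  have hd' : (0:ℝ) < d := by exact_mod_cast hd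
  rw [PP_radial, le_div_iff₀ (by positivity)]
  have h1 : ∀ i, 2 * (Φ (nsq y) - g (nsq y)) + m * (4 * (y i : ℝ)^2) ≤ Φ (nsq y + 1 + 2 * y i) + Φ (nsq y + 1 - 2 * y i) := by
    intro i
    have hσ : |2 * (y i : ℝ)| ≤ 2 * Real.sqrt (nsq y) := by
      rw [abs_mul, abs_of_pos (by norm_num : (0:ℝ) < 2)]; linarith [abs_le_sqrt_nsq y i]
    have := second_diff_lower Φ g hΦ (nsq y + 1) m (2 * y i) (fun s t a b c =>
      hm s t ((interval_incl (nsq_nonneg y) hσ).1 a) b ((interval_incl (nsq_nonneg y) hσ).2 c))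
    have h2 := (first_diff Φ g hΦ hg (nsq y)).1
    nlinarith
  have h2 := Finset.sum_le_sum (fun i (_ : i ∈ Finset.univ) => h1 i)
  have e : ∑ i : Fin d, (2 * (Φ (nsq y) - g (nsq y)) + m * (4 * (y i : ℝ)^2)) = d * (2 * (Φ (nsq y) - g (nsq y))) + m * (4 * ∑ i, (y i : ℝ)^2) := by
    rw [Finset.sum_add_distrib, ← Finset.mul_sum, ← Finset.mul_sum]
    simp only [Finset.sum_const, Finset.card_univ, Fintype.card_fin, nsmul_eq_mul]
    rw [← Finset.mul_sum]; ring
  rw [e] at h2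
  refine le_trans (le_of_eq ?_) h2
  rw [show ∑ i, (y i : ℝ)^2 = nsq y from rfl]
  field_simp; ring

theorem radial_upper {d : ℕ} (hd : 0 < d) (Φ g : ℝ → ℝ) (hΦ : ∀ t, HasDerivAt Φ (- g t) t) (hg : Antitone g) (y : V d) (m : ℝ)
    (hm : ∀ s t, (Real.sqrt (nsq y) - 1)^2 ≤ s → s ≤ t → t ≤ (Real.sqrt (nsq y) + 1)^2 → g s - g t ≤ m * (t - s)) :
    PP (fun z => Φ (nsq z)) y ≤ Φ (nsq y) - g (nsq y + 1) + 2 * nsq y / d * m := by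
  have hd' : (0:ℝ) < d := by exact_mod_cast hd
  rw [PP_radial, div_le_iff₀ (by positivity)]
  have h1 : ∀ i, Φ (nsq y + 1 + 2 * y i) + Φ (nsq y + 1 - 2 * y i) ≤ 2 * (Φ (nsq y) - g (nsq y + 1)) + m * (4 * (y i : ℝ)^2) := by
    intro i
    have hσ : |2 * (y i : ℝ)| ≤ 2 * Real.sqrt (nsq y) := by
      rw [abs_mul, abs_of_pos (by norm_num : (0:ℝ) < 2)]; linarith [abs_le_sqrt_nsq y i]
    have := second_diff_upper Φ g hΦ (nsq y + 1) m (2 * y i) (fun s t a b c =>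
      hm s t ((interval_incl (nsq_nonneg y) hσ).1 a) b ((interval_incl (nsq_nonneg y) hσ).2 c))
    have h2 := (first_diff Φ g hΦ hg (nsq y)).2
    nlinarith
  have h2 := Finset.sum_le_sum (fun i (_ : i ∈ Finset.univ) => h1 i)
  have e : ∑ i : Fin d, (2 * (Φ (nsq y) - g (nsq y + 1)) + m * (4 * (y i : ℝ)^2)) = d * (2 * (Φ (nsq y) - g (nsq y + 1))) + m * (4 * ∑ i, (y i : ℝ)^2) := by
    rw [Finset.sum_add_distrib, ← Finset.mul_sum, ← Finset.mul_sum]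
    simp only [Finset.sum_const, Finset.card_univ, Fintype.card_fin, nsmul_eq_mul]
    rw [← Finset.mul_sum]; ring
  rw [e] at h2
  refine le_trans h2 (le_of_eq ?_)
  rw [show ∑ i, (y i : ℝ)^2 = nsq y from rfl]
  field_simp; ring

/-! ### balls -/

theorem mem_ball {d : ℕ} (r : ℝ) (y : V d) : y ∈ ball d r ↔ Real.sqrt (nsq y) ≤ r := by
  unfold ball
  rw [Finset.mem_filter]
  constructor
  · exact fun h => h.2
  · intro h
    refine ⟨?_, h⟩
    have hi : ∀ i, |(y i : ℝ)| ≤ ⌈r⌉ := fun i => ((abs_le_sqrt_nsq y i).trans h).trans (Int.le_ceil r)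
    rw [Finset.mem_Icc, Pi.le_def, Pi.le_def]
    constructor
    · intro i; have := (abs_le.1 (hi i)).1; exact_mod_cast this
    · intro i; have := (abs_le.1 (hi i)).2; exact_mod_cast this

theorem mem_ball' {d : ℕ} {r : ℝ} (hr : 0 ≤ r) (y : V d) : y ∈ ball d r ↔ nsq y ≤ r ^ 2 := by
  rw [mem_ball, Real.sqrt_le_left hr]

theorem sqrt_nsq_nbr {d : ℕ} (y : V d) (i : Fin d) :
    (Real.sqrt (nsq (y + ev i)) ≤ Real.sqrt (nsq y) + 1 ∧ Real.sqrt (nsq (y - ev i)) ≤ Real.sqrt (nsq y) + 1) ∧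
    (Real.sqrt (nsq y) - 1 ≤ Real.sqrt (nsq (y + ev i)) ∧ Real.sqrt (nsq y) - 1 ≤ Real.sqrt (nsq (y - ev i))) := by
  have h1 := abs_le.1 (abs_le_sqrt_nsq y i)
  have h2 := Real.sq_sqrt (nsq_nonneg y)
  have h3 := Real.sqrt_nonneg (nsq y)
  rw [nsq_add_ev, nsq_sub_ev]
  refine ⟨⟨?_, ?_⟩, ⟨?_, ?_⟩⟩
  · rw [Real.sqrt_le_left (by positivity)]; nlinarith
  · rw [Real.sqrt_le_left (by positivity)]; nlinarith
  · apply Real.le_sqrt_of_sq_le; nlinarith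
  · apply Real.le_sqrt_of_sq_le; nlinarith

theorem outb_norm {d : ℕ} {S : Finset (V d)} {R : ℝ} (hS : S ⊆ ball d R) {z : V d} (hz : z ∈ outb S) :
    Real.sqrt (nsq z) ≤ R + 1 := by
  obtain ⟨-, x, hx, i, rfl | rfl⟩ := (mem_outb _ _).1 hz
  · linarith [(sqrt_nsq_nbr x i).1.1, (mem_ball R x).1 (hS hx)]
  · linarith [(sqrt_nsq_nbr x i).1.2, (mem_ball R x).1 (hS hx)]

end U11


namespace U11

theorem exp_neg_le {z : ℝ} (hz : 0 ≤ z) : Real.exp (-z) ≤ 1 - z + z ^ 2 / 2 := by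
  set k : ℝ → ℝ := fun s => 1 - s + s ^ 2 / 2 - Real.exp (-s) with hk
  have hder : ∀ s, HasDerivAt k (-1 + s + Real.exp (-s)) s := by
    intro s
    have h1 : HasDerivAt (fun s : ℝ => 1 - s) (-1) s := by simpa using (hasDerivAt_id s).const_sub 1
    have h2 : HasDerivAt (fun s : ℝ => s ^ 2 / 2) s s := by
      have := (hasDerivAt_pow 2 s).div_const 2
      simpa using this
    have h3 : HasDerivAt (fun s : ℝ => Real.exp (-s)) (- Real.exp (-s)) s := by
      simpa using (hasDerivAt_neg s).exp
    have := (h1.add h2).sub h3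
    rw [sub_neg_eq_add] at this
    exact this
  have hmono : Monotone k := by
    apply monotone_of_deriv_nonneg (fun s => (hder s).differentiableAt)
    intro s; rw [(hder s).deriv]; linarith [Real.add_one_le_exp (-s)]
  have := hmono hz
  simp only [hk] at this
  simp at this
  linarith

theorem theta_step (θ b m0 mT t T : ℝ) (hθ : 0 ≤ θ) (hb : 0 ≤ b) (hθb : θ * b ≤ 1) (hm0 : 0 < m0) (ht : 0 ≤ t)
    (htT : t + 1 ≤ T) (hT : T ≤ m0) (hmT : mT = m0 + T) (θt θs : ℝ)
    (e1 : θt = θ * (mT / (m0 + t)) * (1 - θ * b * (T - t) / m0))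
    (e2 : θs = θ * (mT / (m0 + (t + 1))) * (1 - θ * b * (T - (t + 1)) / m0)) :
    0 ≤ θs ∧ θs ≤ 2 * θ ∧ θt ≤ θs * (1 + (1 - θs * b / 2) / (m0 + t)) := by
  have hκ : 0 ≤ θ * b := mul_nonneg hθ hb
  have hmt : 0 < m0 + t := by linarith
  have hms : 0 < m0 + (t + 1) := by linarith
  have hu0 : 0 ≤ 1 - θ * b * (T - (t + 1)) / m0 := by
    rw [sub_nonneg, div_le_one hm0]; nlinarith
  have hu1 : 1 - θ * b * (T - (t + 1)) / m0 ≤ 1 := by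
    have : 0 ≤ θ * b * (T - (t + 1)) / m0 := by apply div_nonneg _ hm0.le; apply mul_nonneg hκ; linarith
    linarith
  have hmT0 : 0 ≤ mT := by rw [hmT]; linarith
  have hs0 : 0 ≤ θs := by rw [e2]; positivity
  have hs2 : θs ≤ 2 * θ := by
    rw [e2]
    have h1 : mT / (m0 + (t+1)) ≤ 2 := by rw [div_le_iff₀ hms]; linarith
    have h2 : 0 ≤ mT / (m0 + (t+1)) := by positivity
    calc θ * (mT / (m0 + (t + 1))) * (1 - θ * b * (T - (t + 1)) / m0) ≤ θ * (mT / (m0 + (t + 1))) * 1 := by gcongr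
      _ ≤ 2 * θ := by nlinarith
  refine ⟨hs0, hs2, ?_⟩
  have h3 : θs * (1 + (1 - θ * b) / (m0 + t)) ≤ θs * (1 + (1 - θs * b / 2) / (m0 + t)) := by
    gcongr; nlinarith
  refine le_trans ?_ h3
  have h4 : θs * (1 + (1 - θ * b) / (m0 + t)) = θ * mT / (m0 + t) * ((1 - θ * b * (T - (t + 1)) / m0) * (1 - θ * b / (m0 + (t+1)))) := by
    rw [e2]; field_simp; ring
  have h5 : θt = θ * mT / (m0 + t) * (1 - θ * b * (T - t) / m0) := by rw [e1]; field_simp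
  rw [h4, h5]
  have h6 : 0 ≤ θ * mT / (m0 + t) := by positivity
  refine mul_le_mul_of_nonneg_left ?_ h6
  have h7 : θ * b / (m0 + (t + 1)) ≤ θ * b / m0 := by gcongr; linarith
  have h8 : 0 ≤ θ * b / (m0 + (t + 1)) := by positivity
  have h9 : 1 - θ * b * (T - t) / m0 = (1 - θ * b * (T - (t+1)) / m0) - θ * b / m0 := by field_simp; ring
  rw [h9]
  nlinarith

theorem inner_mart {d : ℕ} (hd : 0 < d) (S0 : Finset (V d)) (hS0 : S0.Nonempty) (x : V d) (h : V d → ℝ) (b Mstar θ : ℝ) (T : ℕ)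
    (h0 : ∀ y, 0 ≤ h y) (hb : ∀ y, h y ≤ b) (hsub : ∀ y, y ≠ x → h y ≤ PP h y)
    (hM : ∀ S : Finset (V d), ∑ y ∈ S, h y ≤ Mstar) (hT : T ≤ S0.card) (hθ : 0 ≤ θ) (hθb : θ * b ≤ 1) :
    μ0 {ω | x ∉ uAggFrom S0 ω T} ≤ ENNReal.ofReal (Real.exp (θ * Mstar -
      θ * (((S0.card : ℝ) + T) / S0.card) * (1 - θ * b) * ∑ y ∈ S0, h y)) := by
  classical
  have hb0 : 0 ≤ b := (h0 0).trans (hb 0)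
  set m0 : ℝ := ((S0.card : ℕ) : ℝ) with hm0
  have hm0p : 0 < m0 := by rw [hm0]; exact_mod_cast hS0.card_pos
  have hTm : (T : ℝ) ≤ m0 := by rw [hm0]; exact_mod_cast hT
  set Θ : ℕ → ℝ := fun t => θ * ((m0 + T) / (m0 + t)) * (1 - θ * b * (T - t) / m0) with hΘ
  set W : ℕ → Finset (V d) → ℝ≥0∞ := fun t S => if x ∈ S then 0 else ENNReal.ofReal (Real.exp (- Θ t * ∑ y ∈ S, h y)) with hW
  have key := chain hd T W (fun t S => S.card = S0.card + t)
    (fun t S hS => by rw [← Finset.card_pos]; have := hS0.card_pos; omega)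
    (fun t S hS z hz => by rw [Finset.card_insert_of_notMem ((mem_outb _ _).1 hz).1, hS]; omega)
    (by
      intro t ht S hcard
      have hSne : S.Nonempty := by rw [← Finset.card_pos]; have := hS0.card_pos; omega
      by_cases hx : x ∈ S
      · have : AV S (W (t+1)) = AV S (fun _ => 0) := AV_congr S _ _ fun z _ => by simp [hW, hx]
        rw [this]; simp [AV]
      · have hWt : W t S = ENNReal.ofReal (Real.exp (- Θ t * ∑ y ∈ S, h y)) := by simp [hW, hx]
        rw [hWt]
        set M := ∑ y ∈ S, h y with hMdef
        have hM0 : 0 ≤ M := Finset.sum_nonneg fun y _ => h0 y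
        clear_value M
        obtain ⟨hs0, hs2, hstep⟩ := theta_step θ b m0 (m0 + T) t T hθ hb0 hθb hm0p (by positivity)
          (by exact_mod_cast ht) hTm rfl (Θ t) (Θ (t+1)) rfl (by simp only [hΘ]; push_cast; rfl)
        set s := Θ (t+1) with hs
        have hcardR : (S.card : ℝ) = m0 + t := by rw [hcard, hm0]; push_cast; ring
        have hmt : 0 < m0 + t := by positivity
        have hsb : s * b ≤ 2 := by nlinarith
        refine AV_le S hSne _ (fun z => Real.exp (- s * (M + h z))) _ (fun z _ => (Real.exp_pos _).le) ?_ ?_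
        · intro z hz
          have hz' := ((mem_outb _ _).1 hz).1
          simp only [hW]
          split_ifs
          · exact zero_le
          · rw [Finset.sum_insert hz', add_comm (h z), ← hMdef]
        · have hF : ∀ z, Real.exp (- s * (M + h z)) ≤ Real.exp (- s * M) * (1 - s * (1 - s * b / 2) * h z) := by
            intro z
            rw [mul_add, Real.exp_add]
            gcongr
            have h1 := exp_neg_le (mul_nonneg hs0 (h0 z))
            rw [neg_mul]
            refine h1.trans ?_
            have : h z ^ 2 ≤ b * h z := by nlinarith [h0 z, hb z]
            nlinarith [sq_nonneg s]
          have hsup : ∀ y ∈ S, h y ≤ ∑ z ∈ outb S, hk S y z * h z := by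
            intro y hy
            have := hk_super hd S (fun y => -1 * h y) (fun y hy => by
              rw [PP_smul]; have := hsub y (fun e => hx (e ▸ hy)); linarith) y hy
            have e : ∑ z ∈ outb S, hk S y z * (-1 * h z) = - ∑ z ∈ outb S, hk S y z * h z := by
              rw [← Finset.sum_neg_distrib]; exact Finset.sum_congr rfl fun z _ => by ring
            rw [e] at this; linarith
          have hin : ∀ y ∈ S, ∑ z ∈ outb S, hk S y z * Real.exp (- s * (M + h z)) ≤
              Real.exp (- s * M) * (1 - s * (1 - s * b / 2) * h y) := by
            intro y hy
            calc _ ≤ ∑ z ∈ outb S, hk S y z * (Real.exp (- s * M) * (1 - s * (1 - s * b / 2) * h z)) :=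
                  Finset.sum_le_sum fun z _ => mul_le_mul_of_nonneg_left (hF z) (hk_nonneg _ _ _)
              _ = Real.exp (- s * M) * (∑ z ∈ outb S, hk S y z - s * (1 - s * b / 2) * ∑ z ∈ outb S, hk S y z * h z) := by
                  rw [Finset.mul_sum, ← Finset.sum_sub_distrib, Finset.mul_sum]
                  exact Finset.sum_congr rfl fun z _ => by ring
              _ ≤ _ := by
                  rw [hk_total hd S y hy]
                  have : 0 ≤ s * (1 - s * b / 2) := mul_nonneg hs0 (by linarith)
                  gcongr
                  exact hsup y hy
          refine (Finset.sum_le_sum hin).trans ?_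
          rw [← Finset.mul_sum, Finset.sum_sub_distrib, ← Finset.mul_sum]
          simp only [Finset.sum_const, nsmul_eq_mul, mul_one]
          rw [hcardR, ← hMdef]
          have e3 : Real.exp (- s * M) * (m0 + t - s * (1 - s * b / 2) * M) = (m0 + t) * (Real.exp (-s * M) * (1 - s * (1 - s * b / 2) * M / (m0 + t))) := by
            field_simp
          rw [e3]
          gcongr
          have h4 : 1 - s * (1 - s * b / 2) * M / (m0 + t) ≤ Real.exp (- (s * (1 - s * b / 2) * M / (m0 + t))) := by
            linarith [Real.add_one_le_exp (- (s * (1 - s * b / 2) * M / (m0 + t)))]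
          calc _ ≤ Real.exp (-s * M) * Real.exp (- (s * (1 - s * b / 2) * M / (m0 + t))) := by gcongr
            _ = Real.exp (- (s * (1 + (1 - s * b / 2) / (m0 + t))) * M) := by
                rw [← Real.exp_add]; congr 1; field_simp; ring
            _ ≤ _ := by
                apply Real.exp_le_exp.2; nlinarith)
    S0 (by simp) (fun S => x ∉ S) (ENNReal.ofReal (Real.exp (- θ * Mstar)))
    (by
      intro S _ hx
      simp only [hW]
      rw [if_neg hx]
      apply ENNReal.ofReal_le_ofReal
      apply Real.exp_le_exp.2
      have : Θ T = θ := by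
        simp only [hΘ]; rw [sub_self, mul_zero, zero_div, sub_zero, mul_one, div_self (by positivity), mul_one]
      rw [this]
      have := hM S
      nlinarith)
  have hW0 : W 0 S0 ≤ ENNReal.ofReal (Real.exp (- (θ * ((m0 + T) / m0) * (1 - θ * b)) * ∑ y ∈ S0, h y)) := by
    simp only [hW]
    split_ifs
    · exact zero_le
    · apply ENNReal.ofReal_le_ofReal
      apply Real.exp_le_exp.2
      have hs : 0 ≤ ∑ y ∈ S0, h y := Finset.sum_nonneg fun y _ => h0 y
      have : θ * ((m0 + T) / m0) * (1 - θ * b) ≤ Θ 0 := by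
        simp only [hΘ, Nat.cast_zero, add_zero, sub_zero]
        have h1 : 0 ≤ θ * ((m0 + T) / m0) := by positivity
        have h2 : θ * b * T / m0 ≤ θ * b := by
          rw [div_le_iff₀ hm0p]; have := mul_nonneg hθ hb0; nlinarith
        gcongr
      nlinarith
  have h5 := key.trans hW0
  have h6 : μ0 {ω | x ∉ uAggFrom S0 ω T} = ENNReal.ofReal (Real.exp (θ * Mstar)) * (ENNReal.ofReal (Real.exp (- θ * Mstar)) * μ0 {ω | x ∉ uAggFrom S0 ω T}) := by
    rw [← mul_assoc, ← ENNReal.ofReal_mul (Real.exp_pos _).le, ← Real.exp_add]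
    simp
  rw [h6]
  calc _ ≤ ENNReal.ofReal (Real.exp (θ * Mstar)) * ENNReal.ofReal (Real.exp (- (θ * ((m0 + T) / m0) * (1 - θ * b)) * ∑ y ∈ S0, h y)) := by
        gcongr
    _ = _ := by
        rw [← ENNReal.ofReal_mul (Real.exp_pos _).le, ← Real.exp_add]
        congr 2; ring

end U11


namespace U11

theorem PP_abs_coord {d : ℕ} (hd : 0 < d) (x y : V d) (i0 : Fin d) :
    PP (fun z : V d => |((z i0 - x i0 : ℤ) : ℝ)|) y = |((y i0 - x i0 : ℤ) : ℝ)| + (if y i0 = x i0 then 1 else 0) / d := by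
  classical
  have hd' : (0:ℝ) < d := by exact_mod_cast hd
  have h1 : ∀ i : Fin d, (|(((y + ev i) i0 - x i0 : ℤ) : ℝ)| + |(((y - ev i) i0 - x i0 : ℤ) : ℝ)|) =
      2 * |((y i0 - x i0 : ℤ) : ℝ)| + (if i = i0 then (if y i0 = x i0 then 2 else 0) else 0) := by
    intro i
    by_cases hi : i = i0
    · subst hi
      simp only [Pi.add_apply, Pi.sub_apply, ev, Pi.single_eq_same, if_true]
      rw [← Int.cast_abs, ← Int.cast_abs, ← Int.cast_abs]
      split_ifs with h
      · rw [h]; norm_num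
      · have : |y i + 1 - x i| + |y i - 1 - x i| = 2 * |y i - x i| := by
          rcases lt_or_gt_of_ne h with h | h
          · rw [abs_of_nonpos (by omega), abs_of_nonpos (by omega), abs_of_nonpos (by omega)]; ring
          · rw [abs_of_nonneg (by omega), abs_of_nonneg (by omega), abs_of_nonneg (by omega)]; ring
        rw [add_zero]; exact_mod_cast this
    · have : i0 ≠ i := fun h => hi h.symm
      simp only [Pi.add_apply, Pi.sub_apply, ev, Pi.single_eq_of_ne this, add_zero, sub_zero, if_neg hi]; ring
  rw [PP, Finset.sum_congr rfl (fun i _ => h1 i), Finset.sum_add_distrib, Finset.sum_ite_eq' Finset.univ i0]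
  simp only [Finset.sum_const, Finset.card_univ, Fintype.card_fin, nsmul_eq_mul, Finset.mem_univ, if_true]
  split_ifs <;> field_simp <;> ring

theorem green {d : ℕ} (hd : 0 < d) (r : ℝ) (hr : 0 ≤ r) (x : V d) (hx : x ∈ ball d r) :
    ∃ h : V d → ℝ, (∀ y, 0 ≤ h y) ∧ (∀ y, h y ≤ d * (2 * r + 3)) ∧ (∀ y, y ∉ ball d r → h y = 0) ∧
      (∀ y, y ∈ ball d r → y ≠ x → h y - PP h y = 0) ∧ (h x - PP h x = 1) := by
  classical
  obtain ⟨h, hoff, hon⟩ := dirichlet hd (ball d r) (fun y => if y = x then 1 else 0)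
  have hd' : (0:ℝ) < d := by exact_mod_cast hd
  have hz : ∀ y : V d, (0:ℝ) - PP (fun _ => 0) y = 0 := fun y => by rw [PP_const hd]; simp
  have hob : ∀ y ∈ outb (ball d r), h y = 0 := fun y hy => hoff y ((mem_outb _ _).1 hy).1
  have hpos : ∀ y ∈ ball d r, 0 ≤ h y := comparison hd (ball d r) (fun _ => 0) h
    (fun y hy => by rw [hz, hon y hy]; split_ifs <;> norm_num) (fun y hy => (hob y hy).ge)
  let i0 : Fin d := ⟨0, hd⟩
  have hle : ∀ y ∈ ball d r, h y ≤ d * (2 * r + 3) - d * |((y i0 - x i0 : ℤ) : ℝ)| := by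
    apply comparison hd (ball d r) h (fun y => d * (2 * r + 3) - d * |((y i0 - x i0 : ℤ) : ℝ)|)
    · intro y hy
      rw [hon y hy, PP_sub, PP_const hd, PP_smul, PP_abs_coord hd]
      have : (d : ℝ) * ((if y i0 = x i0 then 1 else 0) / d) = if y i0 = x i0 then 1 else 0 := by field_simp
      rw [mul_add (d:ℝ) (|((y i0 - x i0 : ℤ) : ℝ)|) _, this]
      by_cases hyx : y = x
      · subst hyx; simp
      · rw [if_neg hyx]; split_ifs <;> linarith
    · intro y hy
      rw [hob y hy, ← mul_sub]
      apply mul_nonneg hd'.le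
      have h1 := outb_norm (Finset.Subset.refl _) hy
      have h2 := (mem_ball r x).1 hx
      have h3 := abs_le_sqrt_nsq y i0
      have h4 := abs_le_sqrt_nsq x i0
      have h5 : |((y i0 - x i0 : ℤ) : ℝ)| ≤ |(y i0 : ℝ)| + |(x i0 : ℝ)| := by push_cast; exact abs_sub _ _
      linarith
  refine ⟨h, fun y => ?_, fun y => ?_, hoff, fun y hy hyx => by rw [hon y hy, if_neg hyx], by rw [hon x hx, if_pos rfl]⟩
  · by_cases hy : y ∈ ball d r
    · exact hpos y hy
    · rw [hoff y hy]
  · by_cases hy : y ∈ ball d r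
    · refine (hle y hy).trans ?_
      have := mul_nonneg hd'.le (abs_nonneg ((y i0 - x i0 : ℤ) : ℝ))
      linarith
    · rw [hoff y hy]; positivity

theorem PP_nonneg {d : ℕ} {h : V d → ℝ} (h0 : ∀ y, 0 ≤ h y) (y : V d) : 0 ≤ PP h y := by
  unfold PP
  exact div_nonneg (Finset.sum_nonneg fun i _ => add_nonneg (h0 _) (h0 _)) (by positivity)

theorem green_rep {d : ℕ} (Ω : Finset (V d)) (x : V d) (hx : x ∈ Ω) (h w : V d → ℝ)
    (hoff : ∀ y, y ∉ Ω → h y = 0) (hon : ∀ y, y ∈ Ω → y ≠ x → h y - PP h y = 0) (hxx : h x - PP h x = 1) :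
    ∑ y ∈ Ω, h y * (w y - PP w y) = w x - ∑ y ∈ outb Ω, w y * PP h y := by
  classical
  rw [sum_by_parts Ω (Ω ∪ outb Ω) h w hoff Finset.subset_union_left Finset.subset_union_right]
  rw [Finset.sum_union]
  · rw [Finset.sum_eq_single x]
    · rw [hxx, mul_one, sub_eq_add_neg, ← Finset.sum_neg_distrib]
      congr 1
      refine Finset.sum_congr rfl fun y hy => ?_
      rw [hoff y ((mem_outb _ _).1 hy).1]; ring
    · intro y hy hyx; rw [hon y hy hyx, mul_zero]
    · intro h; exact absurd hx h
  · rw [Finset.disjoint_left]; intro y hy hy2; exact ((mem_outb _ _).1 hy2).1 hy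

theorem PP_quad {d : ℕ} (hd : 0 < d) (R : ℝ) (y : V d) : PP (fun z => R - nsq z) y = R - nsq y - 1 := by
  rw [PP_sub, PP_const hd, PP_nsq hd]; ring

theorem green_total {d : ℕ} (hd : 0 < d) (r : ℝ) (hr : 0 ≤ r) (x : V d) (hx : x ∈ ball d r) (h : V d → ℝ)
    (h0 : ∀ y, 0 ≤ h y)
    (hoff : ∀ y, y ∉ ball d r → h y = 0) (hon : ∀ y, y ∈ ball d r → y ≠ x → h y - PP h y = 0) (hxx : h x - PP h x = 1)
    (S : Finset (V d)) : ∑ y ∈ S, h y ≤ (r + 1)^2 - nsq x := by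
  classical
  have h1 : ∑ y ∈ S, h y ≤ ∑ y ∈ ball d r, h y := by
    calc ∑ y ∈ S, h y ≤ ∑ y ∈ S ∪ ball d r, h y :=
          Finset.sum_le_sum_of_subset_of_nonneg Finset.subset_union_left fun y _ _ => h0 y
      _ = _ := (Finset.sum_subset Finset.subset_union_right fun y _ hy => hoff y hy).symm
  refine h1.trans ?_
  have h2 := green_rep (ball d r) x hx h (fun y => (r+1)^2 - nsq y) hoff hon hxx
  have h3 : ∑ y ∈ ball d r, h y = ∑ y ∈ ball d r, h y * ((r+1)^2 - nsq y - PP (fun z => (r+1)^2 - nsq z) y) := by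
    refine Finset.sum_congr rfl fun y _ => ?_
    rw [PP_quad hd]; ring
  rw [h3, h2]
  have : 0 ≤ ∑ y ∈ outb (ball d r), ((r+1)^2 - nsq y) * PP h y := by
    refine Finset.sum_nonneg fun y hy => mul_nonneg ?_ (PP_nonneg h0 y)
    have h4 := outb_norm (Finset.Subset.refl _) hy
    have h5 := Real.sq_sqrt (nsq_nonneg y)
    have h6 := Real.sqrt_nonneg (nsq y)
    nlinarith
  linarith

/-! ### the comparison function for the starting ball -/

theorem bern_neg {x p : ℝ} (hx : 0 < x) (hp : 0 ≤ p) : 1 + p * (1 - x) ≤ x ^ (-p) := by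
  rw [Real.rpow_def_of_pos hx]
  have h1 := Real.add_one_le_exp (Real.log x * -p)
  have h2 := Real.log_le_sub_one_of_pos hx
  nlinarith

theorem rpow_diff_lower {s t p : ℝ} (hs : 0 < s) (hst : s ≤ t) (hp : 0 ≤ p) :
    p * t ^ (-p - 1) * (t - s) ≤ s ^ (-p) - t ^ (-p) := by
  have ht : 0 < t := hs.trans_le hst
  have h1 := bern_neg (div_pos hs ht) hp
  rw [Real.div_rpow hs.le ht.le] at h1
  have h2 : 0 < t ^ (-p) := Real.rpow_pos_of_pos ht _
  rw [le_div_iff₀ h2] at h1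
  have h3 : t ^ (-p - 1) = t ^ (-p) / t := by rw [Real.rpow_sub ht, Real.rpow_one]
  rw [h3]
  have : p * (t ^ (-p) / t) * (t - s) = p * (1 - s / t) * t ^ (-p) := by field_simp
  rw [this]; linarith

noncomputable def gg (N p : ℝ) (τ : ℝ) : ℝ := N ^ p * (max τ N) ^ (-p)

theorem gg_anti {N p : ℝ} (hN : 0 < N) (hp : 0 ≤ p) : Antitone (gg N p) := by
  intro s t hst
  unfold gg
  have : 0 < max s N := lt_max_of_lt_right hN
  refine mul_le_mul_of_nonneg_left ?_ (Real.rpow_nonneg hN.le _)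
  exact Real.rpow_le_rpow_of_nonpos this (max_le_max_right N hst) (by linarith)

theorem gg_cont {N p : ℝ} (hN : 0 < N) : Continuous (gg N p) := by
  unfold gg
  refine continuous_const.mul (Continuous.rpow_const (continuous_id.max continuous_const) fun τ => Or.inl ?_)
  exact (lt_max_of_lt_right hN : 0 < max τ N).ne'

theorem gg_pos {N p : ℝ} (hN : 0 < N) (τ : ℝ) : 0 < gg N p τ := by
  have : 0 < max τ N := lt_max_of_lt_right hN
  unfold gg; positivity

theorem gg_le_one {N p : ℝ} (hN : 0 < N) (hp : 0 ≤ p) (τ : ℝ) : gg N p τ ≤ 1 := by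
  have : gg N p τ ≤ gg N p (min τ N) := gg_anti hN hp (min_le_left _ _)
  refine this.trans (le_of_eq ?_)
  unfold gg
  rw [max_eq_right (min_le_right _ _), ← Real.rpow_add hN]; simp

theorem hasDeriv_int (g : ℝ → ℝ) (hg : Continuous g) (R : ℝ) (t : ℝ) :
    HasDerivAt (fun q => ∫ τ in q..R, g τ) (- g t) t :=
  intervalIntegral.integral_hasDerivAt_left (hg.intervalIntegrable _ _)
    hg.aestronglyMeasurable.stronglyMeasurableAtFilter hg.continuousAt

theorem gg_outer {d : ℕ} (hd : 2 ≤ d) (n : ℝ) (hn : 3 ≤ n) (R : ℝ) (y : V d) (hy : n < Real.sqrt (nsq y)) :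
    (∫ τ in (nsq y)..R, gg ((n-2)^2) (d/2) τ) - 2 * (d + 2) / n ≤ PP (fun z => ∫ τ in (nsq z)..R, gg ((n-2)^2) (d/2) τ) y := by
  have hN : 0 < (n-2)^2 := by have : 0 < n - 2 := by linarith
                              positivity
  set N := (n-2)^2 with hNdef
  have hdp : (2:ℝ) ≤ d := by exact_mod_cast hd
  set p : ℝ := d/2 with hp
  have hp0 : 0 ≤ p := by positivity
  set u := Real.sqrt (nsq y) with hu
  have hu2 : u ^ 2 = nsq y := Real.sq_sqrt (nsq_nonneg y)
  have hu0 : 0 < u := by linarith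
  set m : ℝ := N ^ p * (p * ((u+1)^2) ^ (-p - 1)) with hm
  have h1 := radial_lower (by omega : 0 < d) (fun q => ∫ τ in q..R, gg N p τ) (gg N p) (hasDeriv_int _ (gg_cont hN) R)
    (gg_anti hN hp0) y m (by
      intro s t hs hst ht
      rw [← hu] at hs ht
      have hsN : N ≤ s := by rw [hNdef]; nlinarith
      have htN : N ≤ t := hsN.trans hst
      have hs0 : 0 < s := hN.trans_le hsN
      have ht0 : 0 < t := hN.trans_le htN
      unfold gg
      rw [max_eq_left hsN, max_eq_left htN, ← mul_sub, hm, mul_assoc]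
      refine mul_le_mul_of_nonneg_left ?_ (Real.rpow_nonneg hN.le _)
      refine le_trans ?_ (rpow_diff_lower hs0 hst hp0)
      have : ((u+1)^2) ^ (-p - 1) ≤ t ^ (-p - 1) := Real.rpow_le_rpow_of_nonpos ht0 ht (by linarith)
      have h0 : 0 ≤ t - s := by linarith
      gcongr)
  refine le_trans ?_ h1
  have hqN : N ≤ nsq y := by rw [← hu2, hNdef]; nlinarith
  have hq0 : 0 < nsq y := hN.trans_le hqN
  have e1 : 2 * nsq y / d * m = gg N p (nsq y) * (((u+1)^2 / nsq y) ^ (-(p+1))) := by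
    rw [hm, gg, max_eq_left hqN, Real.div_rpow (by positivity) hq0.le, show -(p+1) = -p - 1 by ring,
      Real.rpow_sub hq0 (-p) 1, Real.rpow_one]
    have : 0 < nsq y ^ (-p) := Real.rpow_pos_of_pos hq0 _
    rw [show (d:ℝ) = 2 * p by rw [hp]; ring]
    have hp1 : 0 < p := by rw [hp]; positivity
    field_simp
  rw [e1]
  have h3 := bern_neg (x := (u+1)^2 / nsq y) (p := p + 1) (by positivity) (by linarith)
  have h4 : -(3 * (p+1) / n) ≤ (p+1) * (1 - (u+1)^2 / nsq y) := by
    rw [← hu2]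
    have : 1 - (u+1)^2 / u^2 = - (2 / u + 1 / u^2) := by field_simp; ring
    rw [this]
    have h5 : 1 / u ^ 2 ≤ 1 / u := by apply one_div_le_one_div_of_le hu0; nlinarith
    have h6 : 1 / u ≤ 1 / n := by apply one_div_le_one_div_of_le (by linarith) hy.le
    have h7 : 2 / u + 1 / u^2 ≤ 3 / n := by
      have : 2 / u = 2 * (1 / u) := by ring
      have e3 : 3 / n = 3 * (1 / n) := by ring
      rw [this, e3]; linarith
    have : 3 * (p+1) / n = (p+1) * (3 / n) := by ring
    rw [this]; nlinarith
  have h8 := gg_pos (p := p) hN (nsq y)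
  have h9 := gg_le_one hN hp0 (nsq y)
  have h10 : 3 * (p+1) / n ≤ 2 * (d + 2) / n := by
    have hn0 : 0 < n := by linarith
    apply div_le_div_of_nonneg_right _ hn0.le; rw [hp]; linarith
  have h11 : 0 ≤ 3 * (p+1) / n := by
    have hn0 : 0 < n := by linarith
    positivity
  nlinarith

theorem M0_lower {d : ℕ} (hd : 2 ≤ d) (n : ℕ) (hn : 3 ≤ n) (r : ℝ) (hr : (n:ℝ) ≤ r) (x : V d) (hx : x ∈ ball d r) (h : V d → ℝ)
    (h0 : ∀ y, 0 ≤ h y)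
    (hoff : ∀ y, y ∉ ball d r → h y = 0) (hon : ∀ y, y ∈ ball d r → y ≠ x → h y - PP h y = 0) (hxx : h x - PP h x = 1) :
    (∫ τ in (nsq x)..(r^2), gg (((n:ℝ)-2)^2) (d/2) τ) - 2 * (d + 2) / n * ((r+1)^2 - nsq x) ≤ ∑ y ∈ ball d n, h y := by
  classical
  have hn3 : (3:ℝ) ≤ n := by exact_mod_cast hn
  have hd0 : 0 < d := by omega
  have hN : 0 < ((n:ℝ)-2)^2 := by have : (0:ℝ) < n - 2 := by linarith
                                  positivity
  have hp0 : (0:ℝ) ≤ d / 2 := by positivity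
  have hr0 : 0 ≤ r := by linarith
  set Φ : ℝ → ℝ := fun q => ∫ τ in q..(r^2), gg (((n:ℝ)-2)^2) (d/2) τ with hΦ
  set c : ℝ := 2 * (d + 2) / n with hc
  have hc0 : 0 ≤ c := by positivity
  set w : V d → ℝ := fun y => Φ (nsq y) - c * ((r+1)^2 - nsq y) with hw
  have hPPw : ∀ y, PP w y = PP (fun z => Φ (nsq z)) y - c * ((r+1)^2 - nsq y - 1) := by
    intro y; rw [hw, PP_sub, PP_smul, PP_quad hd0]
  have hsupp : ∀ y, w y - PP w y ≤ if y ∈ ball d n then 1 else 0 := by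
    intro y
    rw [hPPw]
    split_ifs with hy
    · have := radial_lower hd0 Φ _ (hasDeriv_int _ (gg_cont hN) (r^2)) (gg_anti hN hp0) y 0 (by
        intro s t _ hst _
        have := gg_anti hN hp0 hst
        rw [zero_mul]; linarith)
      have h2 := gg_le_one hN hp0 (nsq y)
      simp only [hw]; linarith
    · rw [mem_ball, not_le] at hy
      have := gg_outer hd n hn3 (r^2) y hy
      simp only [hw, hΦ]; linarith
  have hrep := green_rep (ball d r) x hx h w hoff hon hxx
  have hneg : ∑ y ∈ outb (ball d r), w y * PP h y ≤ 0 := by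
    refine Finset.sum_nonpos fun y hy => mul_nonpos_of_nonpos_of_nonneg ?_ (PP_nonneg h0 y)
    have h4 := outb_norm (Finset.Subset.refl _) hy
    have h7 := ((mem_outb _ _).1 hy).1
    rw [mem_ball' hr0, not_le] at h7
    have h5 := Real.sq_sqrt (nsq_nonneg y)
    have h6 := Real.sqrt_nonneg (nsq y)
    have h8 : Φ (nsq y) ≤ 0 := by
      simp only [hΦ]
      rw [intervalIntegral.integral_symm]
      have := intervalIntegral.integral_nonneg (μ := volume) h7.le (fun τ _ => (gg_pos (p := (d:ℝ)/2) hN τ).le)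
      linarith
    have h9 : 0 ≤ (r+1)^2 - nsq y := by nlinarith
    simp only [hw]
    have := mul_nonneg hc0 h9
    linarith
  have hup : ∑ y ∈ ball d r, h y * (w y - PP w y) ≤ ∑ y ∈ ball d n, h y := by
    calc _ ≤ ∑ y ∈ ball d r, (if y ∈ ball d n then h y else 0) := by
          refine Finset.sum_le_sum fun y _ => ?_
          have := mul_le_mul_of_nonneg_left (hsupp y) (h0 y)
          refine this.trans (le_of_eq ?_)
          split_ifs <;> simp
      _ = ∑ y ∈ (ball d r).filter (fun y => y ∈ ball d n), h y := (Finset.sum_filter _ _).symm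
      _ ≤ _ := Finset.sum_le_sum_of_subset_of_nonneg (fun y hy => (Finset.mem_filter.1 hy).2) fun y _ _ => h0 y
  have : w x ≤ ∑ y ∈ ball d n, h y := by linarith
  exact this

theorem Phi_lower {d : ℕ} (hd : 2 ≤ d) (n r q : ℝ) (hn : 3 ≤ n) (hq : n^2 ≤ q) (hqr : q ≤ r^2) (hr : 0 < r) :
    (1 - 2 * d / n) * ((r^2 - q) + (r^2 - q)^2 / (2 * r^2)) ≤ (r/n)^d * ∫ τ in q..(r^2), gg ((n-2)^2) (d/2) τ := by
  have hN : 0 < (n-2)^2 := by have : 0 < n - 2 := by linarith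
                              positivity
  have hn0 : 0 < n := by linarith
  have hdp : (2:ℝ) ≤ d := by exact_mod_cast hd
  set c := (1 - 2 * d / n) with hc
  have hg : ∀ τ, q ≤ τ → τ ≤ r^2 → c * (1 + (r^2 - τ)/r^2) ≤ (r/n)^d * gg ((n-2)^2) (d/2) τ := by
    intro τ h1 h2
    have hτN : (n-2)^2 ≤ τ := by nlinarith
    have hτ0 : 0 < τ := hN.trans_le hτN
    have e1 : (r/n)^d * gg ((n-2)^2) (d/2) τ = ((n-2)/n)^d * (r^2/τ)^((d:ℝ)/2) := by
      have hpw : ∀ z : ℝ, 0 ≤ z → (z^2) ^ ((d:ℝ)/2) = z ^ d := by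
        intro z hz
        rw [← Real.rpow_natCast z 2, ← Real.rpow_mul hz, ← Real.rpow_natCast z d]; congr 1; push_cast; ring
      rw [gg, max_eq_left hτN, hpw _ (by linarith), Real.div_rpow (by positivity) hτ0.le, hpw _ hr.le, Real.rpow_neg hτ0.le,
        div_pow, div_pow]
      have : 0 < τ ^ ((d:ℝ)/2) := Real.rpow_pos_of_pos hτ0 _
      field_simp
    rw [e1]
    have hA : c ≤ ((n-2)/n)^d := by
      have := one_add_mul_le_pow (a := -(2/n)) (by
        have : 2 / n ≤ 2 := by rw [div_le_iff₀ hn0]; linarith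
        linarith) d
      have e : (n-2)/n = 1 + -(2/n) := by field_simp; ring
      rw [e]
      refine le_trans (le_of_eq ?_) this
      rw [hc]; ring
    have hA0 : 0 ≤ ((n-2)/n)^d := by apply pow_nonneg; apply div_nonneg <;> linarith
    have hB1 : 1 ≤ r^2/τ := by rw [le_div_iff₀ hτ0]; linarith
    have hB : 1 + (r^2 - τ)/r^2 ≤ (r^2/τ)^((d:ℝ)/2) := by
      calc 1 + (r^2 - τ)/r^2 ≤ 1 + (r^2 - τ)/τ := by
            gcongr
        _ = r^2/τ := by field_simp; ring
        _ = (r^2/τ)^(1:ℝ) := (Real.rpow_one _).symm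
        _ ≤ _ := Real.rpow_le_rpow_of_exponent_le hB1 (by linarith)
    have hE : 0 ≤ 1 + (r^2 - τ)/r^2 := by
      have : 0 ≤ (r^2 - τ)/r^2 := div_nonneg (by linarith) (by positivity)
      linarith
    exact mul_le_mul hA hB hE hA0
  set Φ : ℝ → ℝ := fun q => ∫ τ in q..(r^2), gg ((n-2)^2) (d/2) τ with hΦ
  set k : ℝ → ℝ := fun τ => (r/n)^d * Φ τ - c * ((r^2 - τ) + (r^2 - τ)^2 / (2 * r^2)) with hk
  have hder : ∀ τ, HasDerivAt k ((r/n)^d * (- gg ((n-2)^2) (d/2) τ) - c * (-1 + (2 * (r^2 - τ) * (-1)) / (2 * r^2))) τ := by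
    intro τ
    have h1 : HasDerivAt (fun τ : ℝ => r^2 - τ) (-1) τ := by simpa using (hasDerivAt_id τ).const_sub (r^2)
    have h2 : HasDerivAt (fun τ : ℝ => (r^2 - τ)^2) (2 * (r^2 - τ) * (-1)) τ := by
      have := h1.fun_pow 2
      have e : 2 * (r^2 - τ) * (-1) = ((2:ℕ):ℝ) * (r^2 - τ)^(2-1) * (-1) := by norm_num
      rw [e]; exact this
    exact ((hasDeriv_int _ (gg_cont hN) (r^2) τ).const_mul _).sub ((h1.add (h2.div_const _)).const_mul _)
  have hanti : AntitoneOn k (Set.Icc q (r^2)) := by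
    apply antitoneOn_of_deriv_nonpos (convex_Icc _ _)
    · exact fun s _ => (hder s).continuousAt.continuousWithinAt
    · exact fun s _ => (hder s).differentiableAt.differentiableWithinAt
    · intro s hs
      rw [interior_Icc] at hs
      rw [(hder s).deriv]
      have h3 := hg s hs.1.le hs.2.le
      have e : (2 * (r^2 - s) * (-1)) / (2 * r^2) = - ((r^2 - s)/r^2) := by field_simp
      rw [e]; linarith
  have h5 := hanti (Set.left_mem_Icc.2 hqr) (Set.right_mem_Icc.2 hqr) hqr
  have h6 : k (r^2) = 0 := by simp [hk, hΦ]
  rw [h6] at h5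
  simp only [hk] at h5
  linarith

end U11


namespace U11

theorem subset_uAgg {d : ℕ} (S : Finset (V d)) (ω : ℝ) (T : ℕ) : S ⊆ uAggFrom S ω T := by
  induction T with
  | zero => exact Finset.Subset.refl _
  | succ k ih =>
    refine ih.trans ?_
    rw [uAggFrom, uStep, addPt]
    exact Finset.subset_insert _ _

theorem ball_nonempty (d : ℕ) (n : ℕ) : (ball d n).Nonempty := by
  refine ⟨0, (mem_ball _ _).2 ?_⟩
  have : nsq (0 : V d) = 0 := by simp [nsq]
  rw [this]; simp

theorem inner_num (d n q r a ε T m0 b θ M J : ℝ) (hdp : 2 ≤ d) (hn3 : 3 ≤ n) (ha1 : 1 ≤ a) (ha2 : a ≤ 2) (hε0 : 0 < ε) (hε1 : ε ≤ 1)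
    (hr : n ≤ r) (hr2 : r ≤ 2 * n) (hεn : 4 * (38 * d + 53) ≤ ε^2 * n) (hqn : n^2 ≤ q) (hqr : q ≤ r^2 * (1 - ε)^2)
    (hm1 : 1 ≤ m0) (hTle : T ≤ (a-1) * m0) (hTge : (a-1) * m0 - 1 ≤ T) (hT0 : 0 ≤ T) (hθ : θ = ε^2 / (640 * d * n)) (hb5 : b ≤ 5 * d * n)
    (hb0 : 0 ≤ b) (hMb : M ≤ m0 * b) (hMM : M ≤ (r+1)^2 - q) (hMnn : 0 ≤ M)
    (hM0 : J - 2 * (d + 2) / n * ((r+1)^2 - q) ≤ M)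
    (hPhi : (1 - 2 * d / n) * ((r^2 - q) + (r^2 - q)^2 / (2 * r^2)) ≤ a * J) :
    θ * ((r + 1)^2 - q) - θ * ((m0 + T)/m0) * (1 - θ * b) * M ≤ -(ε^4 * n / (5120 * d)) := by
  have hr0 : 0 < r := by linarith
  have hn0 : 0 < n := by linarith
  have hd0 : 0 < d := by linarith
  have hθ0 : 0 < θ := by rw [hθ]; positivity
  have hθn : θ * (640 * d * n) = ε^2 := by rw [hθ]; field_simp
  set D := r^2 - q with hD
  have hDlow : r^2 * ε ≤ D := by
    have : (1-ε)^2 = 1 - 2*ε + ε*ε := by ring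
    have h3 : ε * ε ≤ ε := by nlinarith
    have h4 : r^2 * (1-ε)^2 ≤ r^2 * (1 - ε) := mul_le_mul_of_nonneg_left (by linarith) (sq_nonneg r)
    rw [hD]; linarith
  have hr24 : r^2 ≤ 4 * n^2 := by
    have := pow_le_pow_left₀ hr0.le hr2 2
    linarith
  have hn2 : 3 * n ≤ n^2 := by nlinarith only [hn3]
  have hDup : D ≤ 3 * n^2 := by rw [hD]; linarith
  have hD0 : 0 ≤ D := le_trans (by positivity) hDlow
  set E := D^2 / (2 * r^2) with hE
  have hElow : n^2 * ε^2 / 2 ≤ E := by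
    rw [hE, le_div_iff₀ (by positivity)]
    have h1 : (r^2*ε)^2 ≤ D^2 := pow_le_pow_left₀ (by positivity) hDlow 2
    have h2 : (n:ℝ)^2 ≤ r^2 := pow_le_pow_left₀ hn0.le hr 2
    have h3 : n^2 * ε^2 / 2 * (2 * r^2) ≤ r^2 * ε^2 / 2 * (2 * r^2) := by gcongr
    have h4 : r^2 * ε^2 / 2 * (2 * r^2) = (r^2*ε)^2 := by ring
    linarith
  have hEup : E ≤ D / 2 := by
    rw [hE, div_le_iff₀ (by positivity)]
    have : D ≤ r^2 := by rw [hD]; linarith [sq_nonneg n]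
    have h2 := mul_le_mul_of_nonneg_left this hD0
    linarith
  have hnn : (n:ℝ) / n = 1 := by field_simp
  have hPhi2 : D + E - 9 * d * n ≤ a * J := by
    refine le_trans ?_ hPhi
    have : 2 * d / (n:ℝ) * (D + E) ≤ 9 * d * n := by
      rw [div_mul_eq_mul_div, div_le_iff₀ (by linarith)]
      have h1 : D + E ≤ 9 / 2 * n^2 := by linarith
      have h2 := mul_le_mul_of_nonneg_left h1 hd0.le
      linarith
    linarith
  have hMs : (r+1)^2 - q ≤ D + 5 * n := by rw [hD]; linarith
  have hMs0 : 0 ≤ (r+1)^2 - q := by rw [hD] at hD0; linarith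
  have hstar : a * (2 * (d + 2) / n * ((r+1)^2 - q)) ≤ (24 * d + 48) * n := by
    have h1 : (r+1)^2 - q ≤ 6 * n^2 := by linarith
    have h2 : 2 * (d + 2) / (n:ℝ) * ((r+1)^2 - q) ≤ 12 * (d+2) * n := by
      rw [div_mul_eq_mul_div, div_le_iff₀ (by linarith)]
      have h4 := mul_le_mul_of_nonneg_left h1 (by linarith : 0 ≤ 2 * (d + 2))
      linarith
    have h3 : 0 ≤ 2 * (d + 2) / (n:ℝ) * ((r+1)^2 - q) := mul_nonneg (by positivity) hMs0
    calc _ ≤ 2 * (2 * (d + 2) / n * ((r+1)^2 - q)) := mul_le_mul_of_nonneg_right ha2 h3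
      _ ≤ 2 * (12 * (d+2) * n) := by linarith
      _ = _ := by ring
  have haM : D + E - (33 * d + 48) * n ≤ a * M := by
    have := mul_le_mul_of_nonneg_left hM0 (by linarith : 0 ≤ a)
    rw [mul_sub] at this; linarith
  set G := (m0 + T)/m0 * M with hG
  have hGlow : a * M - b ≤ G := by
    rw [hG, div_mul_eq_mul_div, le_div_iff₀ (by linarith)]
    have h1 : (a * m0 - 1) * M ≤ (m0 + T) * M := mul_le_mul_of_nonneg_right (by linarith) hMnn
    linarith
  have hGup : G ≤ 16 * n^2 := by
    have : G ≤ 2 * M := by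
      rw [hG]; apply mul_le_mul_of_nonneg_right _ hMnn
      rw [div_le_iff₀ (by linarith)]
      have : (a - 1) * m0 ≤ 1 * m0 := mul_le_mul_of_nonneg_right (by linarith) (by linarith)
      linarith
    linarith
  have hG0 : 0 ≤ G := by rw [hG]; positivity
  have hgap : n^2 * ε^2 / 4 ≤ G - ((r+1)^2 - q) := by
    have h1 := mul_le_mul_of_nonneg_right hεn hn0.le
    linarith
  have e1 : θ * ((m0 + T)/m0) * (1 - θ * b) * M = θ * G - θ * (θ * (b * G)) := by rw [hG]; ring
  rw [e1]
  have hbG : b * G ≤ 5 * d * n * (16 * n^2) := mul_le_mul hb5 hGup hG0 (by positivity)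
  have h5 : θ * (b * G) ≤ n^2 * ε^2 / 8 := by
    calc θ * (b*G) ≤ θ * (5 * d * n * (16 * n^2)) := mul_le_mul_of_nonneg_left hbG hθ0.le
      _ = (θ * (640 * d * n)) * n^2 / 8 := by ring
      _ = _ := by rw [hθn]; ring
  have h6 : ε^4 * n / (5120 * d) = θ * (n^2 * ε^2 / 8) := by
    rw [hθ]; field_simp; norm_num
  rw [h6]
  have h7 := mul_le_mul_of_nonneg_left hgap hθ0.le
  have h8 := mul_le_mul_of_nonneg_left h5 hθ0.le
  linarith

theorem inner_pt {d : ℕ} (hd : 2 ≤ d) (n : ℕ) (hn : 3 ≤ n) (a ε r : ℝ) (ha1 : 1 ≤ a) (ha2 : a ≤ 2) (hε0 : 0 < ε) (hε1 : ε ≤ 1)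
    (hr : (n:ℝ) ≤ r) (hr2 : r ≤ 2 * n) (hra : (r/n)^d = a) (hεn : 4 * (38 * d + 53) ≤ ε^2 * n) (x : V d)
    (hx : Real.sqrt (nsq x) ≤ r * (1 - ε)) :
    μ0 {ω | x ∉ uAggFrom (ball d n) ω ⌊(a - 1) * bn d n⌋₊} ≤ ENNReal.ofReal (Real.exp (-(ε^4 * n / (5120 * d)))) := by
  have hd0 : 0 < d := by omega
  have hdp : (2:ℝ) ≤ d := by exact_mod_cast hd
  have hn3 : (3:ℝ) ≤ n := by exact_mod_cast hn
  by_cases hxn : x ∈ ball d n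
  · have : {ω | x ∉ uAggFrom (ball d n) ω ⌊(a - 1) * bn d n⌋₊} = ∅ := by
      ext ω; simp only [Set.mem_ofPred_eq, Set.mem_empty_iff_false, iff_false, not_not]
      exact subset_uAgg _ _ _ hxn
    rw [this]; simp
  have hr0 : 0 < r := by linarith
  have hqn : (n:ℝ)^2 ≤ nsq x := by
    rw [mem_ball' (by linarith), not_le] at hxn; exact hxn.le
  have hs0 := Real.sqrt_nonneg (nsq x)
  have hss := Real.sq_sqrt (nsq_nonneg x)
  have hqr : nsq x ≤ r^2 * (1 - ε)^2 := by
    rw [← hss, ← mul_pow]; exact pow_le_pow_left₀ hs0 hx 2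
  have hxr : x ∈ ball d r := by
    rw [mem_ball' hr0.le]
    refine hqr.trans ?_
    have : (1-ε)^2 ≤ 1 := by nlinarith
    nlinarith [sq_nonneg r]
  set q := nsq x with hq
  clear_value q
  obtain ⟨h, h0, hb, hoff, hon, hxx⟩ := green hd0 r hr0.le x hxr
  have hM := green_total hd0 r hr0.le x hxr h h0 hoff hon hxx
  have hM0 := M0_lower hd n hn r hr x hxr h h0 hoff hon hxx
  rw [← hq] at hM hM0
  have hPhi := Phi_lower hd n r q hn3 hqn (((mem_ball' hr0.le x).1 hxr).trans_eq' hq.symm) hr0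
  rw [hra] at hPhi
  set m0 : ℝ := ((bn d n : ℕ) : ℝ) with hm0
  have hm1 : 1 ≤ m0 := by
    have : 1 ≤ bn d n := Finset.card_pos.2 (ball_nonempty d n)
    rw [hm0]; exact_mod_cast this
  set T := ⌊(a - 1) * m0⌋₊ with hT
  have hTle : (T:ℝ) ≤ (a-1) * m0 := Nat.floor_le (mul_nonneg (by linarith) (by linarith))
  have hTge : (a-1) * m0 - 1 ≤ T := (Nat.sub_one_lt_floor _).le
  have hTm : T ≤ (ball d n).card := by
    have : (T:ℝ) ≤ m0 := by nlinarith
    rw [hm0] at this; exact_mod_cast this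
  set θ : ℝ := ε^2 / (640 * d * n) with hθ
  have hθ0 : 0 < θ := by positivity
  set b : ℝ := d * (2 * r + 3) with hbdef
  have hb5 : b ≤ 5 * d * n := by
    have : 2 * r + 3 ≤ 5 * n := by linarith
    have := mul_le_mul_of_nonneg_left this (by linarith : (0:ℝ) ≤ d)
    rw [hbdef]; linarith
  have hb0 : 0 ≤ b := by positivity
  have hθn : θ * (640 * d * n) = ε^2 := by rw [hθ]; field_simp
  have hε2 : ε^2 ≤ 1 := by nlinarith
  have hθb : θ * b ≤ 1 := by
    have h1 : θ * b ≤ θ * (5 * d * n) := mul_le_mul_of_nonneg_left hb5 hθ0.le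
    have h2 : θ * (5 * d * n) = (θ * (640 * d * n)) / 128 := by ring
    rw [hθn] at h2; linarith
  have key := inner_mart hd0 (ball d n) (ball_nonempty d n) x h b ((r+1)^2 - q) θ T h0 hb (by
    intro y hy
    by_cases hyb : y ∈ ball d r
    · linarith [hon y hyb hy]
    · rw [hoff y hyb]; exact PP_nonneg h0 y) hM hTm hθ0.le hθb
  refine key.trans (ENNReal.ofReal_le_ofReal (Real.exp_le_exp.2 ?_))
  have hMb : ∑ y ∈ ball d n, h y ≤ m0 * b := by
    calc _ ≤ ∑ y ∈ ball d n, b := Finset.sum_le_sum fun y _ => hb y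
      _ = _ := by rw [Finset.sum_const, nsmul_eq_mul]; rfl
  exact inner_num d n q r a ε T m0 b θ _ _ hdp hn3 ha1 ha2 hε0 hε1 hr hr2 hεn hqn hqr hm1 hTle hTge (Nat.cast_nonneg _) hθ hb5 hb0 hMb
    (hM _) (Finset.sum_nonneg fun y _ => h0 y) hM0 hPhi

theorem inner_ball {d : ℕ} (hd : 2 ≤ d) (n : ℕ) (hn : 3 ≤ n) (a ε r : ℝ) (ha1 : 1 ≤ a) (ha2 : a ≤ 2) (hε0 : 0 < ε) (hε1 : ε ≤ 1)
    (hr : (n:ℝ) ≤ r) (hr2 : r ≤ 2 * n) (hra : (r/n)^d = a) (hεn : 4 * (38 * d + 53) ≤ ε^2 * n) :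
    μ0 {ω | ¬ ball d (r * (1 - ε)) ⊆ uAggFrom (ball d n) ω ⌊(a - 1) * bn d n⌋₊} ≤
      ENNReal.ofReal ((ball d (r * (1 - ε))).card * Real.exp (-(ε^4 * n / (5120 * d)))) := by
  have h1 : {ω | ¬ ball d (r * (1 - ε)) ⊆ uAggFrom (ball d n) ω ⌊(a - 1) * bn d n⌋₊} ⊆
      ⋃ x ∈ ball d (r * (1 - ε)), {ω | x ∉ uAggFrom (ball d n) ω ⌊(a - 1) * bn d n⌋₊} := by
    intro ω hω
    simp only [Set.mem_ofPred_eq, Finset.not_subset] at hω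
    obtain ⟨x, hx, hx2⟩ := hω
    simp only [Set.mem_iUnion]
    exact ⟨x, hx, hx2⟩
  refine (measure_mono h1).trans ((measure_biUnion_finset_le _ _).trans ?_)
  refine (Finset.sum_le_sum fun x hx => inner_pt hd n hn a ε r ha1 ha2 hε0 hε1 hr hr2 hra hεn x ((mem_ball _ _).1 hx)).trans ?_
  rw [Finset.sum_const, nsmul_eq_mul, ENNReal.ofReal_mul (by positivity), ENNReal.ofReal_natCast]

end U11


namespace U11

open scoped Pointwise

/-- Euclidean norm on `Fin d → ℝ`. -/
noncomputable def en {d : ℕ} (z : Fin d → ℝ) : ℝ := ‖WithLp.toLp 2 z‖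

theorem en_eq {d : ℕ} (z : Fin d → ℝ) : en z = Real.sqrt (∑ i, z i ^ 2) := by
  rw [en, EuclideanSpace.norm_eq]; simp

theorem en_add {d : ℕ} (z w : Fin d → ℝ) : en (z + w) ≤ en z + en w := by
  rw [en, en, en, WithLp.toLp_add]; exact norm_add_le _ _

theorem en_neg {d : ℕ} (z : Fin d → ℝ) : en (-z) = en z := by
  rw [en, en, WithLp.toLp_neg, norm_neg]

theorem en_smul {d : ℕ} (c : ℝ) (z : Fin d → ℝ) : en (c • z) = |c| * en z := by
  rw [en, en, WithLp.toLp_smul, norm_smul, Real.norm_eq_abs]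

theorem en_cont {d : ℕ} : Continuous (en : (Fin d → ℝ) → ℝ) := by
  have : (en : (Fin d → ℝ) → ℝ) = fun z => Real.sqrt (∑ i, z i ^ 2) := funext en_eq
  rw [this]; fun_prop

theorem en_unit {d : ℕ} (z : Fin d → ℝ) (h : ∀ i, |z i| ≤ 1) : en z ≤ Real.sqrt d := by
  rw [en_eq]
  apply Real.sqrt_le_sqrt
  calc ∑ i, z i ^ 2 ≤ ∑ i : Fin d, (1:ℝ) := Finset.sum_le_sum fun i _ => by
        rw [← sq_abs]; exact pow_le_one₀ (abs_nonneg _) (h i)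
    _ = d := by simp

theorem card_bounds {d : ℕ} (hd : 0 < d) : ∃ w : ℝ, 0 ≤ w ∧ ∀ ρ : ℝ,
    (Real.sqrt d < ρ → w * (ρ - Real.sqrt d)^d ≤ (ball d ρ).card) ∧
    (0 < ρ → ((ball d ρ).card : ℝ) ≤ w * (ρ + Real.sqrt d)^d) := by
  classical
  let K : ℝ → Set (Fin d → ℝ) := fun ρ => {z | en z ≤ ρ}
  let Q : V d → Set (Fin d → ℝ) := fun y => Set.pi Set.univ fun i => Set.Ico (y i : ℝ) (y i + 1)
  have hd' : (0:ℝ) < d := by exact_mod_cast hd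
  have hsd := Real.sqrt_nonneg (d:ℝ)
  have hQv : ∀ y, volume (Q y) = 1 := by
    intro y
    simp only [Q, Real.volume_pi_Ico]; simp
  have hQm : ∀ y, MeasurableSet (Q y) := fun y => MeasurableSet.univ_pi fun i => measurableSet_Ico
  have hKscale : ∀ ρ, 0 < ρ → volume (K ρ) = ENNReal.ofReal (ρ^d) * volume (K 1) := by
    intro ρ hρ
    have : K ρ = ρ • K 1 := by
      ext z
      rw [Set.mem_smul_set_iff_inv_smul_mem₀ hρ.ne']
      simp only [K, Set.mem_ofPred_eq, en_smul, abs_inv, abs_of_pos hρ]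
      rw [inv_mul_le_iff₀ hρ, mul_one]
    rw [this, Measure.addHaar_smul]; simp [abs_of_pos hρ]
  have hK1 : volume (K 1) ≠ ⊤ := by
    have : K 1 ⊆ Metric.closedBall 0 1 := by
      intro z hz
      rw [mem_closedBall_zero_iff, pi_norm_le_iff_of_nonneg zero_le_one]
      intro i
      have h1 : en z ≤ 1 := hz
      refine le_trans ?_ h1
      rw [en_eq, Real.norm_eq_abs]
      apply Real.abs_le_sqrt
      exact Finset.single_le_sum (f := fun i => z i ^ 2) (fun j _ => sq_nonneg _) (Finset.mem_univ i)
    exact ((measure_mono this).trans_lt measure_closedBall_lt_top).ne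
  have hKr : ∀ ρ, 0 < ρ → volume (K ρ) = ENNReal.ofReal ((volume (K 1)).toReal * ρ^d) := by
    intro ρ hρ
    rw [hKscale ρ hρ, mul_comm, ENNReal.ofReal_mul ENNReal.toReal_nonneg, ENNReal.ofReal_toReal hK1]
  have hdist : ∀ (y : V d) (z : Fin d → ℝ), z ∈ Q y → en (z - fun i => (y i : ℝ)) ≤ Real.sqrt d := by
    intro y z hz
    apply en_unit
    intro i
    have := hz i (Set.mem_univ i)
    rw [abs_le]
    simp only [Pi.sub_apply]
    constructor <;> linarith [this.1, this.2]
  have hny : ∀ y : V d, en (fun i => (y i : ℝ)) = Real.sqrt (nsq y) := fun y => en_eq _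
  refine ⟨(volume (K 1)).toReal, ENNReal.toReal_nonneg, fun ρ => ⟨fun hρ => ?_, fun hρ => ?_⟩⟩
  · have hsub : K (ρ - Real.sqrt d) ⊆ ⋃ y ∈ ball d ρ, Q y := by
      intro z hz
      have hzQ : z ∈ Q (fun i => ⌊z i⌋) := by
        intro i _
        exact ⟨Int.floor_le _, Int.lt_floor_add_one _⟩
      have h1 := hdist _ _ hzQ
      simp only [Set.mem_iUnion]
      refine ⟨fun i => ⌊z i⌋, ?_, hzQ⟩
      rw [mem_ball, ← hny]
      have h2 := en_add z (-(z - fun i => ((⌊z i⌋:ℤ):ℝ)))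
      rw [en_neg] at h2
      have h3 : z + -(z - fun i => ((⌊z i⌋:ℤ):ℝ)) = fun i => ((⌊z i⌋:ℤ):ℝ) := by abel
      rw [h3] at h2
      have h4 : en z ≤ ρ - Real.sqrt d := hz
      linarith
    have h5 := (measure_mono hsub).trans (measure_biUnion_finset_le (μ := volume) (ball d ρ) Q)
    simp only [hQv, Finset.sum_const, nsmul_eq_mul, mul_one] at h5
    rw [hKr _ (by linarith), ← ENNReal.ofReal_natCast, ENNReal.ofReal_le_ofReal_iff (by positivity)] at h5
    exact h5
  · have hsub : (⋃ y ∈ ball d ρ, Q y) ⊆ K (ρ + Real.sqrt d) := by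
      intro z hz
      simp only [Set.mem_iUnion] at hz
      obtain ⟨y, hy, hzQ⟩ := hz
      rw [mem_ball, ← hny] at hy
      have h1 := hdist _ _ hzQ
      have h2 := en_add (fun i => (y i : ℝ)) (z - fun i => (y i : ℝ))
      rw [add_sub_cancel] at h2
      change en z ≤ _
      linarith
    have hdisj : Set.PairwiseDisjoint (↑(ball d ρ)) Q := by
      intro y _ y' _ hyy
      rw [Function.onFun, Set.disjoint_left]
      intro z hz hz'
      apply hyy
      funext i
      have h1 := hz i (Set.mem_univ i)
      have h2 := hz' i (Set.mem_univ i)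
      have e1 : ⌊z i⌋ = y i := Int.floor_eq_iff.2 h1
      have e2 : ⌊z i⌋ = y' i := Int.floor_eq_iff.2 h2
      rw [← e1, ← e2]
    have h5 := measure_mono (μ := volume) hsub
    rw [measure_biUnion_finset hdisj (fun y _ => hQm y)] at h5
    simp only [hQv, Finset.sum_const, nsmul_eq_mul, mul_one] at h5
    rw [hKr _ (by linarith), ← ENNReal.ofReal_natCast, ENNReal.ofReal_le_ofReal_iff (by positivity)] at h5
    exact h5

theorem pow_sub_le (d : ℕ) (x y : ℝ) (hy : 0 ≤ y) (hxy : y ≤ x) : x^d - y^d ≤ d * x^(d-1) * (x - y) := by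
  have hx : 0 ≤ x := hy.trans hxy
  rw [← Commute.mul_geom_sum₂ (Commute.all x y)]
  rw [mul_comm (x - y)]
  refine mul_le_mul_of_nonneg_right ?_ (by linarith)
  calc _ ≤ ∑ i ∈ Finset.range d, x^(d-1) := by
        refine Finset.sum_le_sum fun i hi => ?_
        have : i < d := Finset.mem_range.1 hi
        calc x^i * y^(d-1-i) ≤ x^i * x^(d-1-i) := by gcongr
          _ = x^(d-1) := by rw [← pow_add]; congr 1; omega
    _ = _ := by simp

theorem excess {d : ℕ} (hd : 0 < d) : ∃ C : ℝ, 1 ≤ C ∧ ∀ n : ℕ, 1 ≤ n → ((bn d n : ℝ) ≤ C * n^d ∧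
    ∀ a ε r : ℝ, 1 ≤ a → 0 < ε → ε ≤ 1 → (n:ℝ) ≤ r → r ≤ 2 * n → (r/n)^d = a → 1 ≤ ε * n → Real.sqrt d < r * (1 - ε) →
      a * bn d n - (ball d (r * (1 - ε))).card ≤ C * ε * n^d) := by
  obtain ⟨w, hw0, hw⟩ := card_bounds hd
  set s := Real.sqrt d with hs
  have hs0 : 0 ≤ s := Real.sqrt_nonneg _
  set C1 := w * (1 + s)^d with hC1
  set C2 := w * (d * (2 + 2 * s)^(d-1) * (2 + 3 * s)) with hC2
  have hC10 : 0 ≤ C1 := by positivity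
  have hC20 : 0 ≤ C2 := by positivity
  refine ⟨1 + C1 + C2, by linarith, fun n hn => ?_⟩
  have hn1 : (1:ℝ) ≤ n := by exact_mod_cast hn
  have hn0 : (0:ℝ) < n := by linarith
  constructor
  · have h1 := (hw n).2 hn0
    have h2 : (n + s)^d ≤ ((1 + s) * n)^d := by
      apply pow_le_pow_left₀ (by positivity); nlinarith
    calc ((bn d n : ℕ) : ℝ) ≤ w * (n + s)^d := h1
      _ ≤ w * ((1+s)*n)^d := mul_le_mul_of_nonneg_left h2 hw0
      _ = C1 * n^d := by rw [hC1, mul_pow]; ring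
      _ ≤ (1 + C1 + C2) * n^d := by gcongr; linarith
  · intro a ε r ha hε0 hε1 hr hr2 hra hεn hsr
    have h1 := (hw n).2 hn0
    have h2 := (hw (r * (1-ε))).1 hsr
    have hrn : r / n ≤ 2 := by rw [div_le_iff₀ hn0]; linarith
    have hrn0 : 0 ≤ r / n := by apply div_nonneg <;> linarith
    have h3 : a * bn d n ≤ w * (r + 2 * s)^d := by
      calc a * bn d n ≤ a * (w * (n + s)^d) := mul_le_mul_of_nonneg_left h1 (by linarith)
        _ = w * ((r/n) * (n + s))^d := by rw [mul_pow, hra]; ring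
        _ ≤ w * (r + 2 * s)^d := by
          have e : r/n * (n+s) = r + r/n * s := by field_simp
          rw [e]
          have : 0 ≤ r + r / n * s := by have := mul_nonneg hrn0 hs0; linarith
          gcongr
    have h4 := pow_sub_le d (r + 2 * s) (r * (1 - ε) - s) (by linarith) (by nlinarith)
    have h5 : (r + 2*s)^(d-1) ≤ ((2 + 2 * s) * n)^(d-1) := by
      apply pow_le_pow_left₀ (by linarith); nlinarith
    have h6 : r + 2 * s - (r * (1-ε) - s) ≤ (2 + 3 * s) * (ε * n) := by
      have h7 : r * ε ≤ 2 * n * ε := mul_le_mul_of_nonneg_right hr2 hε0.le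
      have h8 : s * 1 ≤ s * (ε * n) := mul_le_mul_of_nonneg_left hεn hs0
      linarith
    have h6' : 0 ≤ r + 2 * s - (r * (1-ε) - s) := by nlinarith
    have h9 : (d:ℝ) * (r + 2*s)^(d-1) * (r + 2 * s - (r * (1-ε) - s)) ≤ d * ((2+2*s)*n)^(d-1) * ((2+3*s)*(ε*n)) := by
      gcongr
    have h10 : w * (d * ((2+2*s)*n)^(d-1) * ((2+3*s)*(ε*n))) = C2 * ε * n^d := by
      have : (n:ℝ)^d = n^(d-1) * n := by rw [← pow_succ]; congr 1; omega
      rw [hC2, mul_pow, this]; ring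
    calc _ ≤ w * (r + 2 * s)^d - w * (r * (1 - ε) - s)^d := by linarith
      _ = w * ((r + 2 * s)^d - (r * (1 - ε) - s)^d) := by ring
      _ ≤ w * (d * ((2+2*s)*n)^(d-1) * ((2+3*s)*(ε*n))) := mul_le_mul_of_nonneg_left (h4.trans h9) hw0
      _ = C2 * ε * n^d := h10
      _ ≤ _ := by gcongr; linarith

end U11


namespace U11

theorem rpow_diff_upper {s t p : ℝ} (hs : 0 < s) (hst : s ≤ t) (hp : 0 ≤ p) :
    s ^ (-p) - t ^ (-p) ≤ p * s ^ (-p - 1) * (t - s) := by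
  have ht : 0 < t := hs.trans_le hst
  have h1 := bern_neg (div_pos ht hs) hp
  rw [Real.div_rpow ht.le hs.le] at h1
  have h2 : 0 < s ^ (-p) := Real.rpow_pos_of_pos hs _
  rw [le_div_iff₀ h2] at h1
  have h3 : s ^ (-p - 1) = s ^ (-p) / s := by rw [Real.rpow_sub hs, Real.rpow_one]
  rw [h3]
  have : p * (s ^ (-p) / s) * (t - s) = - (p * (1 - t / s) * s ^ (-p)) := by field_simp; ring
  rw [this]; linarith

/-- truncated power profile -/
noncomputable def kg (L p Λ : ℝ) (τ : ℝ) : ℝ := max 0 ((max τ 0 + L) ^ (-p) - Λ)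

theorem kg_anti {L p Λ : ℝ} (hL : 0 < L) (hp : 0 ≤ p) : Antitone (kg L p Λ) := by
  intro s t hst
  unfold kg
  have : 0 < max s 0 + L := by have := le_max_right s 0; linarith
  have h2 : (max t 0 + L) ^ (-p) ≤ (max s 0 + L) ^ (-p) :=
    Real.rpow_le_rpow_of_nonpos this (by linarith [max_le_max_right 0 hst]) (by linarith)
  exact max_le_max_left 0 (by linarith)

theorem kg_cont {L p Λ : ℝ} (hL : 0 < L) : Continuous (kg L p Λ) := by
  unfold kg
  refine continuous_const.max (Continuous.sub (Continuous.rpow_const ((continuous_id.max continuous_const).add continuous_const)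
    fun τ => Or.inl ?_) continuous_const)
  have := le_max_right τ 0
  exact (by linarith : (0:ℝ) < max τ 0 + L).ne'

theorem kg_nonneg (L p Λ τ : ℝ) : 0 ≤ kg L p Λ τ := le_max_left _ _

theorem kg_lip {L p Λ σ s t : ℝ} (hL : 0 < L) (hp : 0 ≤ p) (hσ : 0 ≤ σ) (hs : σ ≤ s) (hst : s ≤ t) :
    kg L p Λ s - kg L p Λ t ≤ (p * (σ + L) ^ (-p - 1)) * (t - s) := by
  have hs0 : 0 ≤ s := hσ.trans hs
  have ht0 : 0 ≤ t := hs0.trans hst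
  unfold kg
  rw [max_eq_left hs0, max_eq_left ht0]
  have h1 := rpow_diff_upper (s := s + L) (t := t + L) (by linarith) (by linarith) hp
  have h2 : (s + L) ^ (-p-1) ≤ (σ + L) ^ (-p-1) := Real.rpow_le_rpow_of_nonpos (by linarith) (by linarith) (by linarith)
  have h3 : p * (s + L) ^ (-p-1) * (t + L - (s + L)) ≤ (p * (σ + L) ^ (-p - 1)) * (t - s) := by
    rw [show t + L - (s + L) = t - s by ring]
    have : 0 ≤ t - s := by linarith
    gcongr
  have h4 : 0 ≤ (p * (σ + L) ^ (-p - 1)) * (t - s) :=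
    mul_nonneg (mul_nonneg hp (Real.rpow_nonneg (by linarith) _)) (by linarith)
  rcases le_total 0 ((s+L)^(-p) - Λ) with h | h
  · rw [max_eq_right h]
    have := le_max_right 0 ((t+L)^(-p) - Λ)
    linarith
  · rw [max_eq_left h]
    have := le_max_left 0 ((t+L)^(-p) - Λ)
    linarith

theorem kg_key {L p η q D : ℝ} (hL : 0 < L) (hp : 0 < p) (hη0 : 0 < η) (hη1 : η < 1) (hLη : 1 ≤ L * η^2) (hq : 0 ≤ q) (hD : 0 < D)
    (hκ : 2 * p / D ≤ (1 - η) ^ (p + 1)) :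
    2 * q / D * (p * ((Real.sqrt q - 1)^2 + L) ^ (-p - 1)) ≤ (q + 1 + L) ^ (-p) := by
  set u := Real.sqrt q with hu
  have hu2 : u ^ 2 = q := Real.sq_sqrt hq
  have hu0 : 0 ≤ u := Real.sqrt_nonneg _
  have hX : 0 < q + 1 + L := by linarith
  have h1 : (1 - η) * (q + 1 + L) ≤ (u - 1)^2 + L := by
    have h2 : 2 * u ≤ η * (q + L) := by
      have h3 : 0 ≤ (η * u - 1)^2 := sq_nonneg _
      have h4 : 0 ≤ η * (η * (q + L) - 2 * u) := by nlinarith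
      have := nonneg_of_mul_nonneg_right h4 hη0
      linarith
    nlinarith
  have hpos : 0 < (1 - η) * (q + 1 + L) := mul_pos (by linarith) hX
  have h5 : ((u - 1)^2 + L) ^ (-p - 1) ≤ ((1 - η) * (q + 1 + L)) ^ (-p - 1) :=
    Real.rpow_le_rpow_of_nonpos hpos h1 (by linarith)
  rw [Real.mul_rpow (by linarith) hX.le] at h5
  have h6 : (1 - η) ^ (-p - 1) = ((1 - η) ^ (p + 1))⁻¹ := by
    rw [← Real.rpow_neg (by linarith)]; congr 1; ring
  have h7 : 0 < (1 - η) ^ (p + 1) := Real.rpow_pos_of_pos (by linarith) _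
  have h8 : (q + 1 + L) ^ (-p - 1) = (q + 1 + L) ^ (-p) / (q + 1 + L) := by rw [Real.rpow_sub hX, Real.rpow_one]
  have h9 : 0 < (q + 1 + L) ^ (-p) := Real.rpow_pos_of_pos hX _
  have h10 : 2 * p / D * (1 - η) ^ (-p - 1) ≤ 1 := by
    rw [h6, ← div_eq_mul_inv, div_le_one h7]; exact hκ
  calc 2 * q / D * (p * ((u - 1)^2 + L) ^ (-p - 1)) ≤ 2 * q / D * (p * ((1 - η) ^ (-p - 1) * (q + 1 + L) ^ (-p - 1))) := by gcongr
    _ = (2 * p / D * (1 - η) ^ (-p - 1)) * (q / (q + 1 + L)) * (q + 1 + L) ^ (-p) := by rw [h8]; field_simp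
    _ ≤ 1 * 1 * (q + 1 + L) ^ (-p) := by
      have h11 : q / (q + 1 + L) ≤ 1 := by rw [div_le_one hX]; linarith
      have h12 : 0 ≤ q / (q + 1 + L) := by positivity
      gcongr
    _ = _ := by ring

theorem sparse0 {d : ℕ} (hd : 2 ≤ d) (η' : ℝ) (h0 : 0 < η') (h1 : η' < 1) :
    ∃ c C ρ0 : ℝ, 0 < c ∧ 0 < C ∧ 1 ≤ ρ0 ∧ ∀ ρ : ℝ, ρ0 ≤ ρ → ∀ (f : V d → ℝ) (B : ℝ), (∀ y, 0 ≤ f y) →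
      (∀ S : Finset (V d), ∑ y ∈ S, f y ≤ B) → (∀ y, f y - PP f y ≤ 1) →
      c * f 0 ≤ ρ ^ (-((d:ℝ) - η')) * (B + C * ρ ^ (d + 2)) := by
  classical
  have hd0 : 0 < d := by omega
  have hdp : (2:ℝ) ≤ d := by exact_mod_cast hd
  obtain ⟨w, hw0, hw⟩ := card_bounds hd0
  set p : ℝ := (d - η') / 2 with hp
  have hp0 : 0 < p := by rw [hp]; linarith
  set η : ℝ := η' / (d * (p + 1)) with hη
  have hη0 : 0 < η := by rw [hη]; positivity
  have hη1 : η < 1 := by rw [hη, div_lt_one (by positivity)]; nlinarith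
  set L : ℝ := 1 / η^2 with hL
  have hL0 : 0 < L := by positivity
  have hLη : 1 ≤ L * η^2 := by rw [hL]; apply le_of_eq; field_simp
  have hκ : 2 * p / d ≤ (1 - η) ^ (p + 1) := by
    have := one_add_mul_self_le_rpow_one_add (s := -η) (by linarith) (p := p + 1) (by linarith)
    rw [← sub_eq_add_neg] at this
    refine le_trans (le_of_eq ?_) this
    have : (p + 1) * η = η' / d := by rw [hη]; field_simp
    rw [mul_neg, this, hp]; field_simp; ring
  set c : ℝ := (1 + L) ^ (-p) / 2 with hc
  have hc0 : 0 < c := by positivity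
  set ρ0 : ℝ := 1 + 2 ^ (1/p) * (1 + L) with hρ0
  have hρ01 : 1 ≤ ρ0 := by rw [hρ0]; linarith [show 0 < (2:ℝ) ^ (1/p) * (1 + L) by positivity]
  refine ⟨c, 4 * w * (2 + Real.sqrt d)^d + 1, ρ0, hc0, by positivity, hρ01, fun ρ hρ f B hf hB hsub => ?_⟩
  have hρ1 : 1 ≤ ρ := hρ01.trans hρ
  have hρp : 0 < ρ := by linarith
  set Λ : ℝ := (ρ^2 + L) ^ (-p) with hΛ
  have hΛ0 : 0 < Λ := by positivity
  have hΛc : Λ ≤ c := by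
    have h2 : 2 ^ (1/p) * (1 + L) ≤ ρ^2 + L := by nlinarith
    have h3 : Λ ≤ (2 ^ (1/p) * (1 + L)) ^ (-p) := Real.rpow_le_rpow_of_nonpos (by positivity) h2 (by linarith)
    rw [Real.mul_rpow (by positivity) (by positivity), ← Real.rpow_mul (by norm_num), show 1 / p * -p = -1 by field_simp,
      Real.rpow_neg_one] at h3
    rw [hc]; linarith
  have hΛρ : Λ ≤ ρ ^ (-((d:ℝ) - η')) := by
    have h2 : Λ ≤ (ρ^2) ^ (-p) := Real.rpow_le_rpow_of_nonpos (by positivity) (by linarith) (by linarith)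
    refine h2.trans (le_of_eq ?_)
    rw [← Real.rpow_natCast ρ 2, ← Real.rpow_mul hρp.le]; congr 1; rw [hp]; push_cast; ring
  have hgan := kg_anti (Λ := Λ) hL0 hp0.le
  set Ψ : ℝ → ℝ := fun q => ∫ τ in q..(ρ^2), kg L p Λ τ with hΨ
  have hder := hasDeriv_int _ (kg_cont (p := p) (Λ := Λ) hL0) (ρ^2)
  have hgz : ∀ τ, ρ^2 ≤ τ → kg L p Λ τ = 0 := by
    intro τ hτ
    unfold kg
    apply max_eq_left
    rw [max_eq_left ((sq_nonneg ρ).trans hτ)]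
    have : (τ + L) ^ (-p) ≤ Λ := Real.rpow_le_rpow_of_nonpos (by positivity) (by linarith) (by linarith)
    linarith
  have hΨz : ∀ q, ρ^2 ≤ q → Ψ q = 0 := by
    intro q hq
    simp only [hΨ]
    rw [intervalIntegral.integral_symm, neg_eq_zero]
    apply intervalIntegral.integral_zero_ae
    refine Filter.Eventually.of_forall fun τ hτ => ?_
    rw [Set.uIoc_of_le hq] at hτ
    exact hgz τ hτ.1.le
  have hΨ0 : ∀ q, 0 ≤ Ψ q := by
    intro q
    rcases le_total q (ρ^2) with h | h
    · exact intervalIntegral.integral_nonneg (μ := volume) h fun τ _ => kg_nonneg _ _ _ _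
    · rw [hΨz q h]
  set ψ : V d → ℝ := fun y => Ψ (nsq y) with hψ
  have hglow : ∀ y : V d, (nsq y + 1 + L) ^ (-p) - Λ ≤ kg L p Λ (nsq y + 1) := by
    intro y
    unfold kg
    rw [max_eq_left (by linarith [nsq_nonneg y] : (0:ℝ) ≤ nsq y + 1)]
    exact le_max_right _ _
  have hrad : ∀ y : V d, PP ψ y ≤ ψ y - kg L p Λ (nsq y + 1) + 2 * nsq y / d * (p * ((Real.sqrt (nsq y) - 1)^2 + L) ^ (-p - 1)) := by
    intro y
    exact radial_upper hd0 Ψ _ hder hgan y _ fun s t hs hst _ => kg_lip hL0 hp0.le (sq_nonneg _) hs hst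
  have hLap : ∀ y, -Λ ≤ ψ y - PP ψ y := by
    intro y
    have h2 := hrad y
    have h3 := kg_key (D := d) hL0 hp0 hη0 hη1 hLη (nsq_nonneg y) (by linarith) hκ
    have h4 := hglow y
    linarith
  have hLap0 : c ≤ ψ 0 - PP ψ 0 := by
    have hz : nsq (0 : V d) = 0 := by simp [nsq]
    have h2 := hrad 0
    have h4 := hglow 0
    rw [hz] at h2 h4
    have e : 2 * c = (0 + 1 + L) ^ (-p) := by rw [hc, zero_add]; ring
    rw [← e] at h4
    simp only [mul_zero, zero_div, zero_mul, add_zero] at h2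
    linarith
  set F : V d → ℝ := fun y => f y + nsq y with hF
  have hF0 : ∀ y, 0 ≤ F y := fun y => add_nonneg (hf y) (nsq_nonneg y)
  have hFs : ∀ y, F y - PP F y ≤ 0 := by
    intro y
    have : PP F y = PP f y + (nsq y + 1) := by
      rw [hF, PP_add]; congr 1; exact PP_nsq hd0 y
    rw [this]; simp only [hF]; linarith [hsub y]
  have hsupp : ∀ y, y ∉ ball d ρ → ψ y = 0 := by
    intro y hy
    rw [mem_ball' hρp.le, not_le] at hy
    exact hΨz _ hy.le
  have hsb := sum_by_parts (ball d ρ) (ball d (ρ + 1)) ψ F hsupp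
    (fun y hy => (mem_ball _ _).2 (by linarith [(mem_ball _ _).1 hy]))
    (fun y hy => (mem_ball _ _).2 (outb_norm (Finset.Subset.refl _) hy))
  have hle : ∑ y ∈ ball d ρ, ψ y * (F y - PP F y) ≤ 0 :=
    Finset.sum_nonpos fun y _ => mul_nonpos_of_nonneg_of_nonpos (hΨ0 _) (hFs y)
  have h0mem : (0 : V d) ∈ ball d (ρ + 1) := by
    rw [mem_ball]; have hz : nsq (0 : V d) = 0 := by simp [nsq]
    rw [hz, Real.sqrt_zero]; linarith
  have hge : c * f 0 - Λ * ∑ y ∈ ball d (ρ+1), F y ≤ ∑ y ∈ ball d (ρ+1), F y * (ψ y - PP ψ y) := by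
    have hz : nsq (0 : V d) = 0 := by simp [nsq]
    have e1 : f 0 = F 0 := by simp only [hF]; rw [hz, add_zero]
    rw [← Finset.add_sum_erase _ (fun y => F y * (ψ y - PP ψ y)) h0mem, e1, Finset.mul_sum]
    have h2 : ∑ y ∈ (ball d (ρ+1)).erase 0, -(Λ * F y) ≤ ∑ y ∈ (ball d (ρ+1)).erase 0, F y * (ψ y - PP ψ y) := by
      refine Finset.sum_le_sum fun y _ => ?_
      have := mul_le_mul_of_nonneg_left (hLap y) (hF0 y)
      linarith
    rw [Finset.sum_neg_distrib] at h2
    have h3 : ∑ y ∈ (ball d (ρ+1)).erase 0, Λ * F y ≤ ∑ y ∈ ball d (ρ+1), Λ * F y :=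
      Finset.sum_le_sum_of_subset_of_nonneg (Finset.erase_subset _ _) fun y _ _ => mul_nonneg hΛ0.le (hF0 y)
    have h4 : c * F 0 ≤ F 0 * (ψ 0 - PP ψ 0) := by
      have := mul_le_mul_of_nonneg_left hLap0 (hF0 0)
      linarith
    linarith
  have hFsum : ∑ y ∈ ball d (ρ+1), F y ≤ B + (4 * w * (2 + Real.sqrt d)^d + 1) * ρ ^ (d+2) := by
    simp only [hF]
    rw [Finset.sum_add_distrib]
    have h2 : ∑ y ∈ ball d (ρ+1), nsq y ≤ (ball d (ρ+1)).card * (ρ+1)^2 := by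
      calc _ ≤ ∑ y ∈ ball d (ρ+1), (ρ+1)^2 := Finset.sum_le_sum fun y hy => (mem_ball' (by linarith) y).1 hy
        _ = _ := by rw [Finset.sum_const, nsmul_eq_mul]
    have h3 := (hw (ρ+1)).2 (by linarith)
    have hs0 := Real.sqrt_nonneg (d:ℝ)
    have h4 : (ρ + 1 + Real.sqrt d)^d ≤ ((2 + Real.sqrt d) * ρ)^d := by
      apply pow_le_pow_left₀ (by linarith); nlinarith
    have h5 : (ρ+1)^2 ≤ 4 * ρ^2 := by nlinarith
    have h6 : ((ball d (ρ+1)).card : ℝ) * (ρ+1)^2 ≤ (w * ((2 + Real.sqrt d) * ρ)^d) * (4 * ρ^2) :=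
      mul_le_mul (h3.trans (mul_le_mul_of_nonneg_left h4 hw0)) h5 (sq_nonneg _) (by positivity)
    have h7 : (w * ((2 + Real.sqrt d) * ρ)^d) * (4 * ρ^2) = 4 * w * (2 + Real.sqrt d)^d * ρ^(d+2) := by
      rw [mul_pow, pow_add]; ring
    have h8 : 0 ≤ ρ^(d+2) := by positivity
    have := hB (ball d (ρ+1))
    linarith
  have hB0 : 0 ≤ ∑ y ∈ ball d (ρ+1), F y := Finset.sum_nonneg fun y _ => hF0 y
  calc c * f 0 ≤ Λ * ∑ y ∈ ball d (ρ+1), F y := by linarith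
    _ ≤ ρ ^ (-((d:ℝ) - η')) * ∑ y ∈ ball d (ρ+1), F y := mul_le_mul_of_nonneg_right hΛρ hB0
    _ ≤ _ := mul_le_mul_of_nonneg_left hFsum (Real.rpow_nonneg hρp.le _)

theorem sparse {d : ℕ} (hd : 2 ≤ d) (η' : ℝ) (h0 : 0 < η') (h1 : η' < 1) :
    ∃ C : ℝ, 1 ≤ C ∧ ∀ ρ : ℝ, C ≤ ρ → ∀ A : Finset (V d), C * A.card ≤ ρ ^ ((d:ℝ) - η') →
      ∃ f : V d → ℝ, (∀ y, y ∉ A → f y = 0) ∧ (∀ y, 0 ≤ f y) ∧ (∀ y, f y ≤ C * ρ ^ (2 + η')) ∧ ∀ y ∈ A, f y - PP f y = 1 := by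
  classical
  have hd0 : 0 < d := by omega
  obtain ⟨c, C0, ρ0, hc, hC0, hρ0, hmain⟩ := sparse0 hd η' h0 h1
  refine ⟨ρ0 + 2 / c + 2 * C0 / c, by linarith [show 0 < 2 / c by positivity, show 0 < 2 * C0 / c by positivity], fun ρ hρ A hA => ?_⟩
  have hc2 : 0 < 2 / c := by positivity
  have hc3 : 0 < 2 * C0 / c := by positivity
  have hρ1 : 1 ≤ ρ := by linarith
  have hρp : 0 < ρ := by linarith
  obtain ⟨f, hoff, hon⟩ := dirichlet hd0 A (fun _ => 1)
  have hob : ∀ y ∈ outb A, f y = 0 := fun y hy => hoff y ((mem_outb _ _).1 hy).1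
  have hpos : ∀ y, 0 ≤ f y := by
    intro y
    by_cases hy : y ∈ A
    · exact comparison hd0 A (fun _ => 0) f (fun y hy => by rw [PP_const hd0, hon y hy]; norm_num) (fun y hy => (hob y hy).ge) y hy
    · rw [hoff y hy]
  refine ⟨f, hoff, hpos, ?_, hon⟩
  have hKnn : 0 ≤ (ρ0 + 2 / c + 2 * C0 / c) * ρ ^ (2 + η') := by positivity
  rcases A.eq_empty_or_nonempty with rfl | hne
  · intro y; rw [hoff y (by simp)]; exact hKnn
  obtain ⟨v, hv, hmax⟩ := Finset.exists_max_image A f hne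
  have hfle : ∀ y, f y ≤ f v := by
    intro y
    by_cases hy : y ∈ A
    · exact hmax y hy
    · rw [hoff y hy]; exact hpos v
  have hsumle : ∀ S : Finset (V d), ∑ y ∈ S, f y ≤ A.card * f v := by
    intro S
    calc ∑ y ∈ S, f y ≤ ∑ y ∈ S ∪ A, f y := Finset.sum_le_sum_of_subset_of_nonneg Finset.subset_union_left fun y _ _ => hpos y
      _ = ∑ y ∈ A, f y := (Finset.sum_subset Finset.subset_union_right fun y _ hy => hoff y hy).symm
      _ ≤ ∑ y ∈ A, f v := Finset.sum_le_sum fun y _ => hfle y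
      _ = _ := by rw [Finset.sum_const, nsmul_eq_mul]
  have hPPt : ∀ y, PP (fun z => f (z + v)) y = PP f (y + v) := by
    intro y
    unfold PP
    congr 1
    refine Finset.sum_congr rfl fun i _ => ?_
    change f (y + ev i + v) + f (y - ev i + v) = _
    rw [add_right_comm, sub_add_eq_add_sub]
  have key := hmain ρ (by linarith) (fun z => f (z + v)) (A.card * f v) (fun y => hpos _) (by
    intro S
    have := hsumle (S.map ⟨fun z => z + v, add_left_injective v⟩)
    rw [Finset.sum_map] at this
    exact this) (by
    intro y
    rw [hPPt]
    by_cases hy : y + v ∈ A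
    · rw [hon _ hy]
    · rw [hoff _ hy]; linarith [PP_nonneg hpos (y + v)])
  simp only [zero_add] at key
  set P : ℝ := ρ ^ ((d:ℝ) - η') with hP
  have hP0 : 0 < P := Real.rpow_pos_of_pos hρp _
  have hPn : ρ ^ (-((d:ℝ) - η')) = P⁻¹ := Real.rpow_neg hρp.le _
  have hA2 : P⁻¹ * A.card ≤ c / 2 := by
    have h3 : 2 / c * A.card ≤ P := by
      refine le_trans ?_ hA
      gcongr; linarith
    rw [inv_mul_le_iff₀ hP0]
    rw [div_mul_eq_mul_div, div_le_iff₀ hc] at h3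
    linarith
  have hpow : P⁻¹ * ρ ^ (d + 2) = ρ ^ (2 + η') := by
    rw [← hPn, ← Real.rpow_natCast, ← Real.rpow_add hρp]; congr 1; push_cast; ring
  rw [hPn, mul_add] at key
  have h5 : P⁻¹ * (A.card * f v) ≤ c / 2 * f v := by
    rw [← mul_assoc]; exact mul_le_mul_of_nonneg_right hA2 (hpos v)
  have h6 : P⁻¹ * (C0 * ρ^(d+2)) = C0 * ρ ^ (2 + η') := by rw [← hpow]; ring
  rw [h6] at key
  have h7 : f v ≤ 2 * C0 / c * ρ ^ (2 + η') := by
    rw [div_mul_eq_mul_div, le_div_iff₀ hc]; linarith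
  intro y
  refine (hfle y).trans (h7.trans ?_)
  have : 0 ≤ ρ ^ (2 + η') := by positivity
  gcongr
  linarith

end U11


namespace U11

theorem sqrt_upper {q h : ℝ} (hq : 0 < q) (hh : 0 ≤ q + h) : Real.sqrt (q + h) ≤ Real.sqrt q + h / (2 * Real.sqrt q) := by
  have hs : 0 < Real.sqrt q := Real.sqrt_pos.2 hq
  have h2 := Real.sq_sqrt hq.le
  have e : Real.sqrt q + h / (2 * Real.sqrt q) = (2 * q + h) / (2 * Real.sqrt q) := by
    field_simp; linarith
  rw [e, le_div_iff₀ (by positivity)]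
  have h3 := Real.sq_sqrt hh
  have h4 := sq_nonneg (Real.sqrt (q + h) - Real.sqrt q)
  nlinarith

/-- exponential weight -/
noncomputable def ph {d : ℕ} (l r : ℝ) (y : V d) : ℝ := Real.exp (l * (Real.sqrt (nsq y) - r))

theorem ph_pos {d : ℕ} (l r : ℝ) (y : V d) : 0 < ph l r y := Real.exp_pos _

theorem PP_ph_sq {d : ℕ} (hd : 0 < d) (l r : ℝ) (hl : 0 < l) (y : V d) (hy : 1 ≤ 2 * l * Real.sqrt (nsq y)) :
    PP (fun z => ph l r z ^ 2) y ≤ Real.exp (4 * l^2) * ph l r y ^ 2 := by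
  have hd' : (0:ℝ) < d := by exact_mod_cast hd
  set u := Real.sqrt (nsq y) with hu
  have hu0 : 0 < u := by
    by_contra hcon
    push Not at hcon
    have : 2 * l * u ≤ 0 := mul_nonpos_of_nonneg_of_nonpos (by linarith) hcon
    linarith
  have hq0 : 0 < nsq y := Real.sqrt_pos.1 hu0
  have hu2 : u^2 = nsq y := Real.sq_sqrt hq0.le
  have hbase : ph l r y ^ 2 = Real.exp (2 * l * (u - r)) := by
    rw [ph, ← Real.exp_nat_mul]; congr 1; push_cast; rw [← hu]; ring
  have hone : ∀ z : V d, ∀ σ : ℝ, nsq z = nsq y + (1 + 2 * σ) →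
      ph l r z ^ 2 ≤ Real.exp (2 * l * (u - r)) * (Real.exp (l / u) * Real.exp (2 * l * σ / u)) := by
    intro z σ hz
    rw [ph, ← Real.exp_nat_mul, ← Real.exp_add, ← Real.exp_add, Real.exp_le_exp, hz]
    have h1 := sqrt_upper hq0 (h := 1 + 2 * σ) (by rw [← hz]; exact nsq_nonneg z)
    rw [← hu] at h1
    have h2 := mul_le_mul_of_nonneg_left h1 (by linarith : 0 ≤ 2 * l)
    have e : 2 * l * (u + (1 + 2 * σ) / (2 * u)) = 2 * l * u + (l / u + 2 * l * σ / u) := by field_simp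
    rw [e] at h2
    push_cast
    linarith
  have hlu : l / u ≤ 2 * l^2 := by
    rw [div_le_iff₀ hu0]
    have := mul_le_mul_of_nonneg_left hy hl.le
    linarith
  have hpair : ∀ i : Fin d, ph l r (y + ev i) ^ 2 + ph l r (y - ev i) ^ 2 ≤ 2 * (Real.exp (4 * l^2) * ph l r y ^ 2) := by
    intro i
    have h1 := hone (y + ev i) (y i) (by rw [nsq_add_ev]; ring)
    have h2 := hone (y - ev i) (-(y i : ℝ)) (by rw [nsq_sub_ev]; ring)
    set x : ℝ := 2 * l * (y i) / u with hx
    have e2 : 2 * l * (-(y i : ℝ)) / u = -x := by rw [hx]; ring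
    rw [e2] at h2
    have h3 := Real.cosh_le_exp_half_sq x
    rw [Real.cosh_eq] at h3
    have h4 : x^2 / 2 ≤ 2 * l^2 := by
      have h5 : (y i : ℝ)^2 ≤ u^2 := by
        rw [← sq_abs]; exact pow_le_pow_left₀ (abs_nonneg _) (abs_le_sqrt_nsq y i) 2
      rw [hx, div_pow, mul_pow, div_div, div_le_iff₀ (by positivity)]
      have := mul_le_mul_of_nonneg_left h5 (by positivity : 0 ≤ 4 * l^2)
      linarith
    have h6 : Real.exp (l/u) * Real.exp (x^2/2) ≤ Real.exp (4 * l^2) := by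
      rw [← Real.exp_add, Real.exp_le_exp]; linarith
    rw [hbase]
    have hE := Real.exp_pos (2 * l * (u - r))
    have hEl := Real.exp_pos (l/u)
    have h7 : Real.exp (l/u) * (Real.exp x + Real.exp (-x)) ≤ 2 * Real.exp (4 * l^2) := by
      have := mul_le_mul_of_nonneg_left h3 hEl.le
      linarith
    have h8 := mul_le_mul_of_nonneg_left h7 hE.le
    linarith
  unfold PP
  rw [div_le_iff₀ (by positivity)]
  calc _ ≤ ∑ i : Fin d, 2 * (Real.exp (4 * l^2) * ph l r y ^ 2) := Finset.sum_le_sum fun i _ => hpair i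
    _ = _ := by simp; ring

theorem outer_step {d : ℕ} (hd : 0 < d) (S : Finset (V d)) (R r K : ℝ) (hR : 1 ≤ R) (hS : S ⊆ ball d (R - 1)) (hK : 1 ≤ K)
    (hKr : 2 * Real.sqrt K ≤ r) (f : V d → ℝ) (hoff : ∀ y, y ∉ S \ ball d r → f y = 0) (hf0 : ∀ y, 0 ≤ f y) (hfK : ∀ y, f y ≤ K)
    (hon : ∀ y ∈ S \ ball d r, f y - PP f y = 1) :
    ∀ x ∈ S, ∑ z ∈ outb S, hk S x z * ph (1 / (4 * Real.sqrt K)) r z ≤ 2 * ph (1 / (4 * Real.sqrt K)) r x + 4 * R^2 := by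
  classical
  set k := Real.sqrt K with hk'
  have hk1 : 1 ≤ k := by rw [hk']; exact Real.one_le_sqrt.2 hK
  have hk2 : k^2 = K := Real.sq_sqrt (by linarith)
  set l := 1 / (4 * k) with hl
  have hl0 : 0 < l := by positivity
  have hl4 : l ≤ 1/4 := by rw [hl]; apply one_div_le_one_div_of_le <;> linarith
  have hK0 : 0 < K := by linarith
  set v : V d → ℝ := fun y => 1 + f y / K with hv
  have hv1 : ∀ y, 1 ≤ v y := fun y => by simp only [hv]; have := div_nonneg (hf0 y) hK0.le; linarith
  have hv2 : ∀ y, v y ≤ 2 := fun y => by simp only [hv]; have := (div_le_one hK0).2 (hfK y); linarith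
  set u : V d → ℝ := fun y => Real.sqrt (v y) * ph l r y with hu
  have hu0 : ∀ y, 0 ≤ u y := fun y => mul_nonneg (Real.sqrt_nonneg _) (ph_pos _ _ _).le
  have hsv : ∀ y, Real.sqrt (v y) ≤ 2 := fun y => by
    rw [Real.sqrt_le_left (by norm_num)]; linarith [hv2 y]
  have hutot : ∀ y ∈ S, PP (fun z => u z + 4 * (R^2 - nsq z)) y ≤ u y + 4 * (R^2 - nsq y) := by
    intro y hy
    rw [PP_add, PP_smul, PP_quad hd]
    suffices PP u y ≤ u y + 4 by
      linarith
    by_cases hyb : y ∈ ball d r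
    · have h1 : ∀ z : V d, Real.sqrt (nsq z) ≤ Real.sqrt (nsq y) + 1 → u z ≤ 4 := by
        intro z hz
        have h2 := (mem_ball _ _).1 hyb
        have h3 : ph l r z ≤ Real.exp 0.5 := by
          rw [ph, Real.exp_le_exp]
          have : l * (Real.sqrt (nsq z) - r) ≤ l * 1 := mul_le_mul_of_nonneg_left (by linarith) hl0.le
          norm_num at hl4 ⊢; linarith
        have h4 : Real.exp (0.5:ℝ) ≤ 2 := by
          have h5 : Real.exp (0.5:ℝ) ^ 2 = Real.exp 1 := by rw [← Real.exp_nat_mul]; norm_num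
          have h6 := Real.exp_one_lt_d9
          have h7 := Real.exp_pos (0.5:ℝ)
          nlinarith
        have := mul_le_mul (hsv z) (h3.trans h4) (ph_pos l r z).le (by norm_num)
        simp only [hu]; linarith
      have h2 : PP u y ≤ PP (fun _ => 4) y := PP_mono fun i => ⟨h1 _ (sqrt_nsq_nbr y i).1.1, h1 _ (sqrt_nsq_nbr y i).1.2⟩
      rw [PP_const hd] at h2
      linarith [hu0 y]
    · have hyA : y ∈ S \ ball d r := Finset.mem_sdiff.2 ⟨hy, hyb⟩
      have hsvy : 0 < Real.sqrt (v y) := Real.sqrt_pos.2 (by linarith [hv1 y])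
      have hvy := Real.sq_sqrt (by linarith [hv1 y] : 0 ≤ v y)
      set s := ph l r y / Real.sqrt (v y) with hs
      have hs0 : 0 < s := div_pos (ph_pos _ _ _) hsvy
      have h1 : ∀ z, u z ≤ s / 2 * v z + 1 / (2 * s) * ph l r z ^ 2 := by
        intro z
        have h2 := Real.sq_sqrt (by linarith [hv1 z] : 0 ≤ v z)
        have h3 := sq_nonneg (s * Real.sqrt (v z) - ph l r z)
        have e : s / 2 * v z + 1 / (2 * s) * ph l r z ^ 2 - u z = (s * Real.sqrt (v z) - ph l r z)^2 / (2 * s) := by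
          simp only [hu]
          rw [← h2]; field_simp
          rw [Real.sqrt_sq (Real.sqrt_nonneg _)]; ring
        have := div_nonneg h3 (by linarith : 0 ≤ 2 * s)
        linarith
      have h2 : PP u y ≤ s / 2 * PP v y + 1 / (2 * s) * PP (fun z => ph l r z ^ 2) y := by
        rw [← PP_smul, ← PP_smul, ← PP_add]
        exact PP_mono fun i => ⟨h1 _, h1 _⟩
      have h3 : PP v y = v y - 1 / K := by
        have e : v = fun z => 1 + K⁻¹ * f z := by funext z; simp only [hv]; rw [div_eq_inv_mul]
        have e2 : PP v y = 1 + K⁻¹ * PP f y := by rw [e, PP_add, PP_const hd, PP_smul]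
        have := hon y hyA
        rw [e2]; simp only [hv]
        rw [show PP f y = f y - 1 by linarith]; ring
      have hry : r < Real.sqrt (nsq y) := by rw [mem_ball, not_le] at hyb; exact hyb
      have h4 := PP_ph_sq hd l r hl0 y (by
        have : 2 * l * (2 * k) = 1 := by rw [hl]; field_simp; norm_num
        rw [← this]; gcongr; linarith)
      have h5 : Real.exp (4 * l^2) ≤ 1 + 1 / (2 * K) := by
        have e : 4 * l^2 = 1 / (4 * K) := by rw [hl, ← hk2]; field_simp
        rw [e]
        set x := 1 / (4 * K) with hx
        have hx0 : 0 < x := by positivity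
        have hx1 : x ≤ 1/4 := by rw [hx]; apply one_div_le_one_div_of_le <;> linarith
        have e2 : 1 / (2 * K) = 2 * x := by rw [hx]; field_simp; norm_num
        rw [e2]
        have h6 := Real.add_one_le_exp (-x)
        rw [Real.exp_neg] at h6
        have h7 := Real.exp_pos x
        have h8 : (-x + 1) * Real.exp x ≤ 1 := by
          calc _ ≤ (Real.exp x)⁻¹ * Real.exp x := mul_le_mul_of_nonneg_right h6 h7.le
            _ = 1 := inv_mul_cancel₀ h7.ne'
        nlinarith
      have h6 : s / 2 * v y = u y / 2 := by
        rw [hs]; simp only [hu]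
        nth_rewrite 2 [← hvy]; field_simp
      have h7 : 1 / (2 * s) * ph l r y ^ 2 = u y / 2 := by
        have := ph_pos l r y
        rw [hs]; simp only [hu]; field_simp
      have h8 : s / 2 * (1 / K) = (s / 2 * v y) * (1 / (K * v y)) := by
        have := hv1 y
        have : v y ≠ 0 := by linarith
        field_simp
      have h9 : 1 / (2 * K) ≤ 1 / (K * v y) := by
        have h10 := hv1 y
        apply one_div_le_one_div_of_le
        · exact mul_pos hK0 (by linarith)
        · have := mul_le_mul_of_nonneg_left (hv2 y) hK0.le; linarith
      have h10 : 1 / (2 * s) * PP (fun z => ph l r z ^ 2) y ≤ (1 + 1 / (2 * K)) * (u y / 2) := by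
        calc _ ≤ 1 / (2 * s) * (Real.exp (4 * l^2) * ph l r y ^ 2) := mul_le_mul_of_nonneg_left h4 (by positivity)
          _ = Real.exp (4 * l^2) * (1 / (2 * s) * ph l r y ^ 2) := by ring
          _ ≤ _ := by rw [h7]; exact mul_le_mul_of_nonneg_right h5 (by linarith [hu0 y])
      have h11 : u y / 2 * (1 / (2 * K)) ≤ u y / 2 * (1 / (K * v y)) := mul_le_mul_of_nonneg_left h9 (by linarith [hu0 y])
      rw [h3, mul_sub, h8, h6] at h2
      linarith
  intro x hx
  have hmain := hk_super hd S (fun z => u z + 4 * (R^2 - nsq z)) hutot x hx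
  calc _ ≤ ∑ z ∈ outb S, hk S x z * (u z + 4 * (R^2 - nsq z)) := by
        refine Finset.sum_le_sum fun z hz => mul_le_mul_of_nonneg_left ?_ (hk_nonneg _ _ _)
        have h1 : f z = 0 := hoff z fun hz2 => ((mem_outb _ _).1 hz).1 (Finset.mem_sdiff.1 hz2).1
        have h2 : u z = ph l r z := by simp only [hu, hv]; rw [h1]; simp
        have h3 := outb_norm hS hz
        have h4 : nsq z ≤ R^2 := (mem_ball' (by linarith) z).1 ((mem_ball _ _).2 (by linarith))
        rw [h2]; linarith
    _ ≤ u x + 4 * (R^2 - nsq x) := hmain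
    _ ≤ _ := by
      have := mul_le_mul_of_nonneg_right (hsv x) (ph_pos l r x).le
      have := nsq_nonneg x
      simp only [hu]; linarith

end U11


namespace U11

set_option maxHeartbeats 2000000 in
theorem outer {d : ℕ} (hd : 0 < d) (n : ℕ) (r K N δ : ℝ) (T : ℕ) (hnr : (n:ℝ) ≤ r) (hK : 1 ≤ K)
    (hKr : 2 * Real.sqrt K ≤ r)
    (hN : ∀ A : Finset (V d), (A.card : ℝ) ≤ N → ∃ f : V d → ℝ, (∀ y, y ∉ A → f y = 0) ∧ (∀ y, 0 ≤ f y) ∧ (∀ y, f y ≤ K) ∧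
      ∀ y ∈ A, f y - PP f y = 1) (hT : T ≤ bn d n) :
    μ0 {ω | (((uAggFrom (ball d n) ω T) \ ball d r).card : ℝ) ≤ N ∧ ¬ uAggFrom (ball d n) ω T ⊆ ball d (r * (1 + δ))} ≤
      ENNReal.ofReal (Real.exp 2 * bn d n * (1 + 4 * ((n:ℝ) + T + 1)^2) * Real.exp (-(r * δ / (4 * Real.sqrt K)))) := by
  classical
  set m0 : ℝ := ((bn d n : ℕ) : ℝ) with hm0
  have hbpos : 0 < bn d n := (ball_nonempty d n).card_pos
  have hm0p : 0 < m0 := by rw [hm0]; exact_mod_cast hbpos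
  have hTm : (T : ℝ) ≤ m0 := by rw [hm0]; exact_mod_cast hT
  have hsK : 0 < Real.sqrt K := Real.sqrt_pos.2 (by linarith)
  set l : ℝ := 1 / (4 * Real.sqrt K) with hl
  have hl0 : 0 < l := by positivity
  set R : ℝ := (n:ℝ) + T + 1 with hR
  have hR1 : 1 ≤ R := by rw [hR]; have : (0:ℝ) ≤ n := Nat.cast_nonneg _; have : (0:ℝ) ≤ T := Nat.cast_nonneg _; linarith
  set D : ℝ := 4 * R^2 with hD
  have hD0 : 0 ≤ D := by positivity
  set q : ℝ := 1 + 2 / m0 with hq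
  have hq0 : 0 < q := by positivity
  set W : ℕ → Finset (V d) → ℝ≥0∞ := fun t S => if ((S \ ball d r).card : ℝ) ≤ N then
    ENNReal.ofReal (q ^ (T - t) * (∑ y ∈ S, ph l r y + ((T - t : ℕ) : ℝ) * D)) else 0 with hW
  have key := chain hd T W (fun t S => S.card = bn d n + t ∧ S ⊆ ball d ((n:ℝ) + t))
    (fun t S hS => by rw [← Finset.card_pos]; have := hS.1; omega)
    (fun t S hS z hz => by
      refine ⟨by rw [Finset.card_insert_of_notMem ((mem_outb _ _).1 hz).1, hS.1]; omega, ?_⟩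
      intro y hy
      rw [mem_ball]
      push_cast
      rcases Finset.mem_insert.1 hy with h | h
      · rw [h]; have := outb_norm hS.2 hz; linarith
      · have := (mem_ball _ _).1 (hS.2 h); linarith)
    (by
      intro t ht S ⟨hcard, hSb⟩
      have hSne : S.Nonempty := by rw [← Finset.card_pos]; omega
      obtain ⟨k, hk'⟩ : ∃ k, T = t + (k + 1) := ⟨T - t - 1, by omega⟩
      have e1 : T - t = k + 1 := by omega
      have e2 : T - (t + 1) = k := by omega
      by_cases hg : ((S \ ball d r).card : ℝ) ≤ N
      · have hWt : W t S = ENNReal.ofReal (q ^ (k+1) * (∑ y ∈ S, ph l r y + ((k + 1 : ℕ) : ℝ) * D)) := by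
          simp only [hW, if_pos hg, e1]
        rw [hWt]
        obtain ⟨f, hf1, hf2, hf3, hf4⟩ := hN _ hg
        have hstep := outer_step hd S R r K hR1 (fun y hy => by
          have h1 := (mem_ball _ _).1 (hSb hy)
          rw [mem_ball]
          have h2 : (t:ℝ) ≤ T := by exact_mod_cast ht.le
          linarith) hK hKr f hf1 hf2 hf3 hf4
        rw [← hl, ← hD] at hstep

        have htot := hk_total hd S
        set M := ∑ y ∈ S, ph l r y with hM
        have hM0 : 0 ≤ M := Finset.sum_nonneg fun y _ => (ph_pos l r y).le
        have hcR : m0 ≤ (S.card : ℝ) := by rw [hm0]; exact_mod_cast (by omega : bn d n ≤ S.card)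
        have hsum : ∑ x ∈ S, ∑ z ∈ outb S, hk S x z * ph l r z ≤ 2 * M + S.card * D := by
          refine (Finset.sum_le_sum hstep).trans ?_
          rw [Finset.sum_add_distrib, ← Finset.mul_sum, Finset.sum_const, nsmul_eq_mul, ← hM]
        refine AV_le S hSne _ (fun z => q^k * (M + ph l r z + (k:ℝ) * D)) _ (fun z _ => by have := (ph_pos l r z).le; positivity) ?_ ?_
        · intro z hz
          have hz' := ((mem_outb _ _).1 hz).1
          simp only [hW]
          split_ifs
          · rw [Finset.sum_insert hz', add_comm (ph l r z), ← hM, e2]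
          · exact zero_le
        · have e3 : ∑ x ∈ S, ∑ z ∈ outb S, hk S x z * (q^k * (M + ph l r z + (k:ℝ) * D)) =
              q^k * (S.card * (M + k * D) + ∑ x ∈ S, ∑ z ∈ outb S, hk S x z * ph l r z) := by
            have : ∀ x ∈ S, ∑ z ∈ outb S, hk S x z * (q^k * (M + ph l r z + (k:ℝ) * D)) =
                q^k * ((M + k * D) + ∑ z ∈ outb S, hk S x z * ph l r z) := by
              intro x hx
              calc _ = ∑ z ∈ outb S, (q^k * (M + k * D) * hk S x z + q^k * (hk S x z * ph l r z)) :=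
                    Finset.sum_congr rfl fun z _ => by ring
                _ = _ := by rw [Finset.sum_add_distrib, ← Finset.mul_sum, ← Finset.mul_sum, htot x hx]; ring
            rw [Finset.sum_congr rfl this, ← Finset.mul_sum, Finset.sum_add_distrib, Finset.sum_const, nsmul_eq_mul]
          rw [e3]
          clear_value M
          have hqc : (S.card:ℝ) + 2 ≤ S.card * q := by
            rw [hq, mul_add, mul_one]
            have : 2 ≤ (S.card:ℝ) * (2 / m0) := by
              rw [mul_div_assoc', le_div_iff₀ hm0p]; linarith
            linarith
          have hq1 : 1 ≤ q := by rw [hq]; have : 0 ≤ 2 / m0 := by positivity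
                                 linarith
          have h5 : S.card * (M + k * D) + ∑ x ∈ S, ∑ z ∈ outb S, hk S x z * ph l r z ≤ S.card * (q * (M + ((k+1:ℕ):ℝ) * D)) := by
            have h6 := mul_le_mul_of_nonneg_right hqc hM0
            have h7 : (S.card:ℝ) * (((k+1:ℕ):ℝ) * D) ≤ (S.card:ℝ) * (q * (((k+1:ℕ):ℝ) * D)) := by
              refine mul_le_mul_of_nonneg_left ?_ (by positivity)
              exact le_mul_of_one_le_left (by positivity) hq1
            push_cast at h7 ⊢
            linarith
          calc _ ≤ q^k * (S.card * (q * (M + ((k+1:ℕ):ℝ) * D))) := mul_le_mul_of_nonneg_left h5 (by positivity)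
            _ = _ := by rw [pow_succ]; ring
      · have : AV S (W (t+1)) = AV S (fun _ => 0) := AV_congr S _ _ fun z _ => by
          simp only [hW]
          rw [if_neg]
          intro h
          refine hg (le_trans ?_ h)
          exact_mod_cast Finset.card_le_card (Finset.sdiff_subset_sdiff (Finset.subset_insert z S) subset_rfl)
        rw [this]; simp [AV])
    (ball d n) ⟨by rw [bn]; rfl, by simp⟩
    (fun S => ((S \ ball d r).card : ℝ) ≤ N ∧ ¬ S ⊆ ball d (r * (1 + δ))) (ENNReal.ofReal (Real.exp (r * δ / (4 * Real.sqrt K))))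
    (by
      intro S _ ⟨h1, h2⟩
      obtain ⟨y, hyS, hy⟩ := Finset.not_subset.1 h2
      simp only [hW, if_pos h1, Nat.sub_self, pow_zero, one_mul, Nat.cast_zero, zero_mul, add_zero]
      refine ENNReal.ofReal_le_ofReal ?_
      refine le_trans ?_ (Finset.single_le_sum (fun y _ => (ph_pos l r y).le) hyS)
      rw [ph, Real.exp_le_exp]
      rw [mem_ball, not_le] at hy
      have e : r * δ / (4 * Real.sqrt K) = l * (r * δ) := by rw [hl]; ring
      rw [e]
      exact mul_le_mul_of_nonneg_left (by linarith) hl0.le)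
  have hW0 : W 0 (ball d n) ≤ ENNReal.ofReal (Real.exp 2 * m0 * (1 + D)) := by
    simp only [hW]
    split_ifs
    · refine ENNReal.ofReal_le_ofReal ?_
      rw [Nat.sub_zero]
      have h1 : ∑ y ∈ ball d n, ph l r y ≤ m0 := by
        have : ∀ y ∈ ball d (n:ℝ), ph l r y ≤ 1 := by
          intro y hy
          rw [mem_ball] at hy
          rw [ph, Real.exp_le_one_iff]
          exact mul_nonpos_of_nonneg_of_nonpos hl0.le (by linarith)
        refine (Finset.sum_le_sum this).trans ?_
        rw [Finset.sum_const, nsmul_eq_mul, mul_one]; rfl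
      have h2 : q ^ T ≤ Real.exp 2 := by
        have h3 : q ≤ Real.exp (2 / m0) := by rw [hq, add_comm]; exact Real.add_one_le_exp _
        calc q^T ≤ Real.exp (2 / m0) ^ T := by gcongr
          _ = Real.exp (T * (2 / m0)) := by rw [← Real.exp_nat_mul]
          _ ≤ _ := by
            rw [Real.exp_le_exp, mul_div_assoc', div_le_iff₀ hm0p]; linarith
      have h4 : (T:ℝ) * D ≤ m0 * D := mul_le_mul_of_nonneg_right hTm hD0
      have h5 : 0 ≤ ∑ y ∈ ball d n, ph l r y := Finset.sum_nonneg fun y _ => (ph_pos l r y).le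
      calc _ ≤ Real.exp 2 * (m0 + m0 * D) := by
            refine mul_le_mul h2 (by linarith) (by positivity) (Real.exp_pos _).le
        _ = _ := by ring
    · exact zero_le
  have hfin := key.trans hW0
  have hE : 0 < Real.exp (r * δ / (4 * Real.sqrt K)) := Real.exp_pos _
  have hne : ENNReal.ofReal (Real.exp (r * δ / (4 * Real.sqrt K))) ≠ 0 := by
    rw [Ne, ENNReal.ofReal_eq_zero, not_le]; exact hE
  have h8 := (ENNReal.mul_le_iff_le_inv hne ENNReal.ofReal_ne_top).1 hfin
  refine h8.trans (le_of_eq ?_)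
  rw [← ENNReal.ofReal_inv_of_pos hE, ← ENNReal.ofReal_mul (by positivity), Real.exp_neg, mul_comm]

end U11


namespace U11

theorem card_uAgg {d : ℕ} (S : Finset (V d)) (ω : ℝ) (T : ℕ) : (uAggFrom S ω T).card ≤ S.card + T := by
  induction T with
  | zero => rw [uAggFrom]; omega
  | succ T ih =>
    rw [uAggFrom, uStep, addPt]
    refine (Finset.card_insert_le _ _).trans ?_
    omega

theorem exps (d : ℝ) (hd : 2 ≤ d) : ∃ η β : ℝ, 0 < η ∧ η < 1 ∧ 0 < β ∧ β * (d - η) = d - 17/80 ∧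
    β * (1 + η / 2) + 1 / (5 * d) < 1 := by
  set η : ℝ := 1 / (80 * (d + 2)) with hη
  have h0 : 0 < η := by positivity
  have h1 : η < 1 := by rw [hη, div_lt_one (by positivity)]; linarith
  have h2 : η * (1 + d / 2) = 1 / 160 := by rw [hη]; field_simp; ring
  have h3 : 0 < d - η := by linarith
  refine ⟨η, (d - 17/80) / (d - η), h0, h1, div_pos (by linarith) h3, div_mul_cancel₀ _ h3.ne', ?_⟩
  set e := 1 / (5 * d) with he
  have he0 : 0 < e := by positivity
  have hed : d * e = 1 / 5 := by rw [he]; field_simp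
  have h4 : (d - 17/80) / (d - η) * (1 + η / 2) < 1 - e := by
    rw [div_mul_eq_mul_div, div_lt_iff₀ h3]
    have : 0 < η * e := by positivity
    nlinarith
  linarith

theorem combine {d : ℕ} (hd : 2 ≤ d) (n : ℕ) (a r ε δ N K : ℝ) (T : ℕ) (hT : T = ⌊(a - 1) * bn d n⌋₊) (ha1 : 1 ≤ a)
    (hexc : a * bn d n - ((ball d (r * (1 - ε))).card : ℝ) ≤ N) (hr : 0 ≤ r) (hε : 0 ≤ ε) :
    {ω | ¬ uAggFrom (ball d n) ω T ⊆ ball d (r * (1 + δ))} ⊆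
      {ω | ¬ ball d (r * (1-ε)) ⊆ uAggFrom (ball d n) ω T} ∪
      {ω | (((uAggFrom (ball d n) ω T) \ ball d r).card : ℝ) ≤ N ∧ ¬ uAggFrom (ball d n) ω T ⊆ ball d (r * (1 + δ))} := by
  classical
  intro ω hω
  by_cases h : ball d (r * (1-ε)) ⊆ uAggFrom (ball d n) ω T
  · right
    refine ⟨?_, hω⟩
    have h1 : (uAggFrom (ball d n) ω T \ ball d r).card ≤ (uAggFrom (ball d n) ω T \ ball d (r * (1-ε))).card := by
      refine Finset.card_le_card (Finset.sdiff_subset_sdiff subset_rfl ?_)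
      intro y hy
      rw [mem_ball] at hy ⊢
      have : 0 ≤ r * ε := mul_nonneg hr hε
      linarith
    have h2 := Finset.card_sdiff_add_card_eq_card h
    have h3 := card_uAgg (ball d n) ω T
    have h4 : (T:ℝ) ≤ (a - 1) * bn d n := by
      rw [hT]; exact Nat.floor_le (mul_nonneg (by linarith) (Nat.cast_nonneg _))
    have h1' : ((uAggFrom (ball d n) ω T \ ball d r).card : ℝ) ≤ (uAggFrom (ball d n) ω T \ ball d (r * (1-ε))).card := by exact_mod_cast h1
    have h2' : ((uAggFrom (ball d n) ω T \ ball d (r * (1-ε))).card : ℝ) + (ball d (r * (1-ε))).card = (uAggFrom (ball d n) ω T).card := by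
      exact_mod_cast h2
    have h3' : ((uAggFrom (ball d n) ω T).card : ℝ) ≤ bn d n + T := by
      rw [bn]; exact_mod_cast h3
    linarith
  · left; exact h

theorem main_bound (d : ℕ) (hd : 2 ≤ d) : ∃ A c σ : ℝ, 0 < A ∧ 0 < c ∧ 0 < σ ∧ ∀ᶠ n : ℕ in atTop, ∀ a : ℝ, 1 ≤ a → a ≤ 2 →
    μ0 {ω | ¬ uAggFrom (ball d n) ω ⌊(a - 1) * bn d n⌋₊ ⊆
            ball d ((n : ℝ) * a ^ ((1 : ℝ)/d) *
              (1 + 1 * (n : ℝ) ^ (-(1 / (5 * (d : ℝ))))))} ≤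
      ENNReal.ofReal (A * (n:ℝ)^((3 * d : ℕ) : ℝ) * Real.exp (-(c * (n:ℝ)^((1:ℝ)/10)))) + 
      ENNReal.ofReal (A * (n:ℝ)^((3 * d : ℕ) : ℝ) * Real.exp (-(c * (n:ℝ)^σ))) := by
  have hdR : (2:ℝ) ≤ d := by exact_mod_cast hd
  obtain ⟨η, β, hη0, hη1, hβ0, hβ, hσ'⟩ := exps d hdR
  obtain ⟨Cs, hCs, hsp⟩ := sparse hd η hη0 hη1
  obtain ⟨Ce, hCe, hex⟩ := excess (d := d) (by omega)
  set σ : ℝ := 1 - 1 / (5 * (d:ℝ)) - β * (1 + η / 2) with hσ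
  have hσ0 : 0 < σ := by rw [hσ]; linarith
  have hsC : 1 ≤ Real.sqrt Cs := Real.one_le_sqrt.2 hCs
  set A : ℝ := Real.exp 2 * (37 * Ce^3) + Ce * 2^d with hA
  set c : ℝ := min (1 / (5120 * d)) (1 / (4 * Real.sqrt Cs)) with hc
  have hc0 : 0 < c := lt_min (by positivity) (by positivity)
  have hten : ∀ p : ℝ, 0 < p → ∀ B : ℝ, ∀ᶠ n : ℕ in atTop, B ≤ (n:ℝ)^p := fun p hp B =>
    ((tendsto_rpow_atTop hp).comp tendsto_natCast_atTop_atTop).eventually_ge_atTop B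
  refine ⟨A, c, σ, by positivity, hc0, hσ0, ?_⟩
  filter_upwards [eventually_ge_atTop 3, hten (9/40) (by norm_num) 2, hten (11/20) (by norm_num) (4*(38*d+53)),
    hten (31/40) (by norm_num) 1, hten 1 (by norm_num) (2 * Real.sqrt d + 1), hten β hβ0 Cs, hten (1/80) (by norm_num) (Cs * Ce),
    hten (1 - β * (1 + η/2)) (by have : 0 < 1 / (5 * (d:ℝ)) := by positivity
                                 linarith) (2 * Real.sqrt Cs), hten β hβ0 1] with n hn3 e1 e2 e3 e4 e5 e6 e7 e8 a ha1 ha2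
  have hb2 := (hex (2 * n) (by omega)).1
  obtain ⟨hbn, hex⟩ := hex n (by omega)
  have hn0 : (0:ℝ) < n := by exact_mod_cast (by omega : 0 < n)
  have hn1 : (1:ℝ) ≤ n := by exact_mod_cast (by omega : 1 ≤ n)
  set x : ℝ := (n:ℝ) with hx
  set r : ℝ := x * a ^ ((1:ℝ)/d) with hr
  set ε : ℝ := x ^ (-(9/40) : ℝ) with hε
  set δ : ℝ := x ^ (-(1 / (5 * (d : ℝ)))) with hδ
  have ha0 : 0 < a := by linarith
  have hp1 : 1 ≤ a ^ ((1:ℝ)/d) := Real.one_le_rpow ha1 (by positivity)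
  have hp2 : a ^ ((1:ℝ)/d) ≤ 2 := by
    calc a ^ ((1:ℝ)/d) ≤ a ^ (1:ℝ) := Real.rpow_le_rpow_of_exponent_le ha1 (by rw [div_le_one (by linarith)]; linarith)
      _ ≤ 2 := by rw [Real.rpow_one]; exact ha2
  have hra : (r / x)^d = a := by
    rw [hr, mul_div_cancel_left₀ _ hn0.ne', ← Real.rpow_natCast, ← Real.rpow_mul ha0.le, one_div_mul_cancel (by positivity), Real.rpow_one]
  have hr1 : x ≤ r := by rw [hr]; exact le_mul_of_one_le_right hn0.le hp1
  have hr2 : r ≤ 2 * x := by rw [hr]; have := mul_le_mul_of_nonneg_left hp2 hn0.le; linarith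
  have hε0 : 0 < ε := Real.rpow_pos_of_pos hn0 _
  have hε2 : ε ≤ 1 / 2 := by
    rw [hε, Real.rpow_neg hn0.le, ← one_div]
    exact one_div_le_one_div_of_le (by norm_num) e1
  have hεn : ε * x = x ^ (31/40 : ℝ) := by
    rw [hε]; nth_rewrite 2 [← Real.rpow_one x]; rw [← Real.rpow_add hn0]; norm_num
  have hεn2 : ε^2 * x = x ^ (11/20 : ℝ) := by
    rw [hε]; nth_rewrite 2 [← Real.rpow_one x]; rw [← Real.rpow_natCast, ← Real.rpow_mul hn0.le, ← Real.rpow_add hn0]; norm_num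
  have hεn4 : ε^4 * x = x ^ ((1:ℝ)/10) := by
    rw [hε]; nth_rewrite 2 [← Real.rpow_one x]; rw [← Real.rpow_natCast, ← Real.rpow_mul hn0.le, ← Real.rpow_add hn0]; norm_num
  have hball := inner_ball hd n hn3 a ε r ha1 ha2 hε0 (by linarith) hr1 hr2 hra (by rw [← hx, hεn2]; exact e2)
  have hexc := hex a ε r ha1 hε0 (by linarith) hr1 hr2 hra (by rw [hεn]; exact e3) (by
    rw [Real.rpow_one] at e4
    have h1 : r * (1/2) ≤ r * (1 - ε) := mul_le_mul_of_nonneg_left (by linarith) (by linarith)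
    linarith)
  set N : ℝ := Ce * ε * x^d with hN
  set T : ℕ := ⌊(a - 1) * bn d n⌋₊ with hT
  have hTb : T ≤ bn d n := by
    refine Nat.floor_le_of_le ?_
    exact mul_le_of_le_one_left (Nat.cast_nonneg _) (by linarith)
  set ρ : ℝ := x ^ β with hρ
  set K : ℝ := Cs * ρ ^ (2 + η) with hK
  have hρ0 : 0 < ρ := Real.rpow_pos_of_pos hn0 _
  have hK1 : 1 ≤ K := by
    rw [hK]; exact one_le_mul_of_one_le_of_one_le hCs (Real.one_le_rpow e8 (by linarith))
  have hsK : Real.sqrt K = Real.sqrt Cs * x ^ (β * (1 + η/2)) := by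
    rw [hK, Real.sqrt_mul (by linarith), hρ, ← Real.rpow_mul hn0.le, Real.sqrt_eq_rpow (x ^ _), ← Real.rpow_mul hn0.le]
    congr 2; ring
  have hKr : 2 * Real.sqrt K ≤ r := by
    rw [hsK]
    refine le_trans ?_ hr1
    have h1 : 0 < x ^ (β * (1 + η/2)) := Real.rpow_pos_of_pos hn0 _
    calc 2 * (Real.sqrt Cs * x ^ (β * (1 + η/2))) = 2 * Real.sqrt Cs * x ^ (β * (1 + η/2)) := by ring
      _ ≤ x ^ (1 - β * (1 + η/2)) * x ^ (β * (1 + η/2)) := mul_le_mul_of_nonneg_right e7 h1.le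
      _ = x := by rw [← Real.rpow_add hn0, sub_add_cancel, Real.rpow_one]
  have hNs : Cs * N ≤ ρ ^ ((d:ℝ) - η) := by
    rw [hρ, ← Real.rpow_mul hn0.le, hβ, hN]
    calc Cs * (Ce * ε * x^d) = Cs * Ce * (ε * x^d) := by ring
      _ ≤ x ^ (1/80:ℝ) * (ε * x^d) := mul_le_mul_of_nonneg_right e6 (by positivity)
      _ = _ := by
        rw [hε, ← Real.rpow_natCast x d, ← Real.rpow_add hn0, ← Real.rpow_add hn0]; congr 1; ring
  have hout := outer (by omega : 0 < d) n r K N δ T hr1 hK1 hKr (by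
    intro B hB
    exact hsp ρ e5 B (le_trans (mul_le_mul_of_nonneg_left hB (by linarith)) hNs)) hTb
  have hsub := combine hd n a r ε δ N K T hT ha1 hexc (by linarith) hε0.le
  rw [one_mul]
  refine (measure_mono hsub).trans ((measure_union_le _ _).trans (add_le_add (hball.trans ?_) (hout.trans ?_)))
  · refine ENNReal.ofReal_le_ofReal ?_
    have h1 : ((ball d (r * (1-ε))).card : ℝ) ≤ A * x ^ ((3 * d : ℕ) : ℝ) := by
      have h2 : (ball d (r * (1-ε))).card ≤ bn d (2 * n) := by
        rw [bn]
        refine Finset.card_le_card fun y hy => ?_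
        rw [mem_ball] at hy ⊢
        push_cast
        have : 0 ≤ r * ε := mul_nonneg (by linarith) hε0.le
        linarith
      have h3 : ((ball d (r * (1-ε))).card : ℝ) ≤ bn d (2 * n) := by exact_mod_cast h2
      refine h3.trans (hb2.trans ?_)
      rw [Real.rpow_natCast]
      push_cast
      rw [mul_pow, ← mul_assoc]
      refine mul_le_mul ?_ (pow_le_pow_right₀ hn1 (by omega)) (by positivity) (by positivity)
      rw [hA]
      have : 0 ≤ Real.exp 2 * (37 * Ce^3) := by positivity
      linarith
    refine mul_le_mul h1 ?_ (Real.exp_pos _).le (by positivity)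
    rw [Real.exp_le_exp, hεn4]
    have h2 : c * x ^ ((1:ℝ)/10) ≤ 1 / (5120 * d) * x ^ ((1:ℝ)/10) := mul_le_mul_of_nonneg_right (min_le_left _ _) (by positivity)
    have e : x ^ ((1:ℝ)/10) / (5120 * d) = 1 / (5120 * d) * x ^ ((1:ℝ)/10) := by ring
    rw [e]; linarith
  · refine ENNReal.ofReal_le_ofReal ?_
    have h1 : Real.exp 2 * (bn d n) * (1 + 4 * (x + T + 1)^2) ≤ A * x ^ ((3 * d : ℕ) : ℝ) := by
      rw [Real.rpow_natCast, mul_comm 3 d, pow_mul]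
      set y := x^d with hy
      have hy1 : x ≤ y := le_self_pow₀ hn1 (by omega)
      have hy2 : 1 ≤ y := hn1.trans hy1
      have hT' : (T:ℝ) ≤ Ce * y := le_trans (by exact_mod_cast hTb) hbn
      have hCy : y ≤ Ce * y := le_mul_of_one_le_left (by linarith) hCe
      have h2 : (x + T + 1)^2 ≤ (3 * (Ce * y))^2 := by
        refine pow_le_pow_left₀ (by positivity) ?_ 2
        linarith
      have h3 : 1 ≤ (Ce * y)^2 := one_le_pow₀ (by linarith)
      have h4 : 1 + 4 * (x + T + 1)^2 ≤ 37 * (Ce * y)^2 := by nlinarith only [h2, h3]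
      calc Real.exp 2 * (bn d n) * (1 + 4 * (x + T + 1)^2) ≤ Real.exp 2 * (Ce * y) * (37 * (Ce * y)^2) := by
            refine mul_le_mul (mul_le_mul_of_nonneg_left hbn (Real.exp_pos _).le) h4 (by positivity) (by positivity)
        _ = Real.exp 2 * (37 * Ce^3) * y^3 := by ring
        _ ≤ A * y^3 := by
          refine mul_le_mul_of_nonneg_right ?_ (by positivity)
          rw [hA]; have : 0 ≤ Ce * 2^d := by positivity
          linarith
    refine mul_le_mul h1 ?_ (Real.exp_pos _).le (by positivity)
    rw [Real.exp_le_exp]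
    have h2 : c * x ^ σ ≤ 1 / (4 * Real.sqrt Cs) * x ^ σ := mul_le_mul_of_nonneg_right (min_le_right _ _) (by positivity)
    have h3 : 1 / (4 * Real.sqrt Cs) * x ^ σ ≤ r * δ / (4 * Real.sqrt K) := by
      have h4 : x * δ ≤ r * δ := mul_le_mul_of_nonneg_right hr1 (by positivity)
      have h5 : x * δ = x ^ σ * x ^ (β * (1 + η/2)) := by
        rw [hδ, hσ, ← Real.rpow_add hn0]
        nth_rewrite 1 [← Real.rpow_one x]
        rw [← Real.rpow_add hn0]; congr 1; ring
      have hxp : 0 < x ^ (β * (1 + η/2)) := Real.rpow_pos_of_pos hn0 _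
      rw [hsK, le_div_iff₀ (by positivity)]
      refine le_trans (le_of_eq ?_) h4
      rw [h5]; field_simp
    linarith

end U11


namespace U11

theorem superpoly (A c σ p k : ℝ) (hA : 0 < A) (hc : 0 < c) (hσ : 0 < σ) :
    ∀ᶠ n : ℕ in atTop, A * (n:ℝ)^p * Real.exp (-(c * (n:ℝ)^σ)) ≤ (n:ℝ)^(-k) := by
  have h1 := tendsto_rpow_mul_exp_neg_mul_atTop_nhds_zero ((p + k) / σ) c hc
  have h2 : Tendsto (fun n : ℕ => (n:ℝ)^σ) atTop atTop := (tendsto_rpow_atTop hσ).comp tendsto_natCast_atTop_atTop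
  have h3 := (h1.comp h2).eventually_le_const (show (0:ℝ) < 1 / A by positivity)
  filter_upwards [h3, eventually_ge_atTop 1] with n hn hn1
  have hn0 : (0:ℝ) < n := by exact_mod_cast hn1
  simp only [Function.comp] at hn
  rw [← Real.rpow_mul hn0.le, mul_div_cancel₀ _ hσ.ne', Real.rpow_add hn0, le_div_iff₀ hA, neg_mul] at hn
  have hk : 0 < (n:ℝ)^k := Real.rpow_pos_of_pos hn0 _
  rw [Real.rpow_neg hn0.le, ← one_div, le_div_iff₀ hk]
  linarith

end U11

theorem statement11 (d : ℕ) (hd : 2 ≤ d) :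
    ∃ C₇ : ℝ, 0 < C₇ ∧ ∀ k : ℝ, 0 < k → ∃ Ck : ℝ, 0 < Ck ∧
      ∀ n : ℕ, 1 ≤ n → ∀ a : ℝ, 1 ≤ a → a ≤ 2 →
        μ0 {ω | ¬ uAggFrom (ball d n) ω ⌊(a - 1) * bn d n⌋₊ ⊆
            ball d ((n : ℝ) * a ^ ((1 : ℝ)/d) *
              (1 + C₇ * (n : ℝ) ^ (-(1 / (5 * (d : ℝ))))))} ≤
          ENNReal.ofReal (Ck * (n : ℝ) ^ (-k)) := by
  obtain ⟨A, c, σ, hA, hc, hσ, hmain⟩ := U11.main_bound d hd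
  refine ⟨1, one_pos, fun k hk => ?_⟩
  have hev := hmain.and ((U11.superpoly A c (1/10) ((3 * d : ℕ) : ℝ) k hA hc (by norm_num)).and
    (U11.superpoly A c σ ((3 * d : ℕ) : ℝ) k hA hc hσ))
  obtain ⟨n0, hn0⟩ := eventually_atTop.1 hev
  refine ⟨2 + ((n0:ℝ) + 1)^k, by positivity, fun n hn a ha1 ha2 => ?_⟩
  have hnp : (0:ℝ) < n := by exact_mod_cast hn
  have hX : 0 < (n:ℝ)^(-k) := Real.rpow_pos_of_pos hnp _
  have hY : 0 < ((n0:ℝ) + 1)^k := by positivity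
  by_cases h : n0 ≤ n
  · obtain ⟨h1, h2, h3⟩ := hn0 n h
    refine (h1 a ha1 ha2).trans ?_
    refine (add_le_add (ENNReal.ofReal_le_ofReal h2) (ENNReal.ofReal_le_ofReal h3)).trans ?_
    rw [← ENNReal.ofReal_add hX.le hX.le]
    refine ENNReal.ofReal_le_ofReal ?_
    have := mul_pos hY hX
    linarith
  · refine prob_le_one.trans ?_
    rw [← ENNReal.ofReal_one]
    refine ENNReal.ofReal_le_ofReal ?_
    have h1 : (n:ℝ)^k ≤ ((n0:ℝ)+1)^k := by
      refine Real.rpow_le_rpow hnp.le ?_ hk.le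
      have : (n:ℝ) ≤ n0 := by exact_mod_cast (by omega : n ≤ n0)
      linarith
    have h2 : (n:ℝ)^k * (n:ℝ)^(-k) = 1 := by rw [← Real.rpow_add hnp]; simp
    have h3 := mul_le_mul_of_nonneg_right h1 hX.le
    linarith
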